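/- Let f:(R,m) → (S,n) be a local homomorphism of noetherian local rings. If the flat dimension of S as an R-module equals edim(R) − edim(S), then f is an exceptional complete intersection map. -/

import Mathlib

/- ## Preliminary definitions -/

universe u

open IsLocalRing

noncomputable section

/-- The embedding dimension of a local ring: `dim_k (m/m²)`. -/
def embDim (R : Type u) [CommRing R] [IsLocalRing R] : ℕ :=
  Module.finrank (ResidueField R) (CotangentSpace R)

/-- Witness that `Q` is a Gorenstein flat `R`-module: a two-sided exact complex `F` of
flat modules, which stays exact after applying `I ⊗ᵣ -` for every injective module `I`,
with `Q` isomorphic to the image of the differential `F₁ → F₀`. -/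
structure GorensteinFlatWitness (R : Type u) [CommRing R] (Q : Type u) [AddCommGroup Q]
    [Module R Q] where
  F : ℤ → Type u
  [instAdd : ∀ i, AddCommGroup (F i)]
  [instMod : ∀ i, Module R (F i)]
  d : (i : ℤ) → F (i + 1) →ₗ[R] F i
  flat : ∀ i, Module.Flat R (F i)
  exact : ∀ i : ℤ, Function.Exact (d (i + 1)) (d i)
  exact_tensor : ∀ (I : Type u) [AddCommGroup I] [Module R I], Module.Injective R I →
    ∀ i : ℤ, Function.Exact (LinearMap.lTensor I (d (i + 1))) (LinearMap.lTensor I (d i))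
  iso : Nonempty (Q ≃ₗ[R] LinearMap.range (d 0))

/-- `Q` is a Gorenstein flat `R`-module. -/
def IsGorensteinFlat (R : Type u) [CommRing R] (Q : Type u) [AddCommGroup Q]
    [Module R Q] : Prop :=
  Nonempty (GorensteinFlatWitness R Q)

/-- Witness that `J` is a Gorenstein injective `R`-module: a two-sided exact complex `I` of
injective modules, which stays exact after applying `Hom_R(E, -)` for every injective module
`E`, with `J` isomorphic to the image of the differential `I₁ → I₀`. -/
structure GorensteinInjectiveWitness (R : Type u) [CommRing R] (J : Type u) [AddCommGroup J]
    [Module R J] where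
  I : ℤ → Type u
  [instAdd : ∀ i, AddCommGroup (I i)]
  [instMod : ∀ i, Module R (I i)]
  d : (i : ℤ) → I (i + 1) →ₗ[R] I i
  injective : ∀ i, Module.Injective R (I i)
  exact : ∀ i : ℤ, Function.Exact (d (i + 1)) (d i)
  exact_hom : ∀ (E : Type u) [AddCommGroup E] [Module R E], Module.Injective R E →
    ∀ i : ℤ, Function.Exact (LinearMap.llcomp (σ₁₂ := RingHom.id R) (σ₁₃ := RingHom.id R) R E (I (i + 1 + 1)) (I (i + 1)) (d (i + 1)))
      (LinearMap.llcomp (σ₁₂ := RingHom.id R) (σ₁₃ := RingHom.id R) R E (I (i + 1)) (I i) (d i))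
  iso : Nonempty (J ≃ₗ[R] LinearMap.range (d 0))

/-- `J` is a Gorenstein injective `R`-module. -/
def IsGorensteinInjective (R : Type u) [CommRing R] (J : Type u) [AddCommGroup J]
    [Module R J] : Prop :=
  Nonempty (GorensteinInjectiveWitness R J)

/-- A surjection onto `M` whose source is Gorenstein flat. -/
structure GorensteinFlatCover (R : Type u) [CommRing R] (M : Type u) [AddCommGroup M]
    [Module R M] where
  Q : Type u
  [instAdd : AddCommGroup Q]
  [instMod : Module R Q]
  π : Q →ₗ[R] M
  gflat : IsGorensteinFlat R Q
  surj : Function.Surjective π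

attribute [instance] GorensteinFlatCover.instAdd GorensteinFlatCover.instMod

/-- `M` admits an exact sequence `0 → Qₙ → ⋯ → Q₀ → M → 0` with all `Qᵢ` Gorenstein flat;
equivalently (by splicing), defined by recursion on `n`. -/
def gfdLE (R : Type u) [CommRing R] :
    (n : ℕ) → (M : Type u) → [AddCommGroup M] → [Module R M] → Prop
  | 0, M, _, _ => IsGorensteinFlat R M
  | n + 1, M, _, _ => ∃ c : GorensteinFlatCover R M, gfdLE R n (LinearMap.ker c.π)

/-- The Gorenstein flat dimension of `M` over `R`, as an element of `ℕ∞`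
(the zero module has Gorenstein flat dimension `0` here, and `⊤` means infinite). -/
def gfd (R : Type u) [CommRing R] (M : Type u) [AddCommGroup M] [Module R M] : ℕ∞ :=
  sInf ((↑) '' { n : ℕ | gfdLE R n M })

/-- A flat cover of `M`. -/
structure FlatCover (R : Type u) [CommRing R] (M : Type u) [AddCommGroup M]
    [Module R M] where
  Q : Type u
  [instAdd : AddCommGroup Q]
  [instMod : Module R Q]
  π : Q →ₗ[R] M
  flat : Module.Flat R Q
  surj : Function.Surjective π

attribute [instance] FlatCover.instAdd FlatCover.instMod

/-- `M` admits a flat resolution of length `≤ n`. -/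
def fdLE (R : Type u) [CommRing R] :
    (n : ℕ) → (M : Type u) → [AddCommGroup M] → [Module R M] → Prop
  | 0, M, _, _ => Module.Flat R M
  | n + 1, M, _, _ => ∃ c : FlatCover R M, fdLE R n (LinearMap.ker c.π)

/-- The flat dimension of `M` over `R`, as an element of `ℕ∞`. -/
def flatDim (R : Type u) [CommRing R] (M : Type u) [AddCommGroup M] [Module R M] : ℕ∞ :=
  sInf ((↑) '' { n : ℕ | fdLE R n M })

/-- An embedding of `M` into a Gorenstein injective module. -/
structure GorensteinInjectiveHull (R : Type u) [CommRing R] (M : Type u) [AddCommGroup M]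
    [Module R M] where
  J : Type u
  [instAdd : AddCommGroup J]
  [instMod : Module R J]
  ι : M →ₗ[R] J
  ginj : IsGorensteinInjective R J
  inj : Function.Injective ι

attribute [instance] GorensteinInjectiveHull.instAdd GorensteinInjectiveHull.instMod

/-- `M` admits an exact sequence `0 → M → J₀ → ⋯ → J₋ₙ → 0` with all `Jᵢ`
Gorenstein injective. -/
def gidLE (R : Type u) [CommRing R] :
    (n : ℕ) → (M : Type u) → [AddCommGroup M] → [Module R M] → Prop
  | 0, M, _, _ => IsGorensteinInjective R M
  | n + 1, M, _, _ => ∃ c : GorensteinInjectiveHull R M,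
      gidLE R n (c.J ⧸ LinearMap.range c.ι)

/-- The Gorenstein injective dimension of `M` over `R`, as an element of `ℕ∞`. -/
def gid (R : Type u) [CommRing R] (M : Type u) [AddCommGroup M] [Module R M] : ℕ∞ :=
  sInf ((↑) '' { n : ℕ | gidLE R n M })

/-- An embedding of `M` into an injective module. -/
structure InjectiveHullStep (R : Type u) [CommRing R] (M : Type u) [AddCommGroup M]
    [Module R M] where
  J : Type u
  [instAdd : AddCommGroup J]
  [instMod : Module R J]
  ι : M →ₗ[R] J
  injective : Module.Injective R J
  inj : Function.Injective ι

attribute [instance] InjectiveHullStep.instAdd InjectiveHullStep.instMod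

/-- `M` admits an injective resolution of length `≤ n`. -/
def idLE (R : Type u) [CommRing R] :
    (n : ℕ) → (M : Type u) → [AddCommGroup M] → [Module R M] → Prop
  | 0, M, _, _ => Module.Injective R M
  | n + 1, M, _, _ => ∃ c : InjectiveHullStep R M, idLE R n (c.J ⧸ LinearMap.range c.ι)

/-- The injective dimension of `M` over `R`, as an element of `ℕ∞`. -/
def injDim (R : Type u) [CommRing R] (M : Type u) [AddCommGroup M] [Module R M] : ℕ∞ :=
  sInf ((↑) '' { n : ℕ | idLE R n M })

/-- The `i`-th Ext module `Ext_R^i(N, M)`. -/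
def extModule (R : Type u) [CommRing R] (i : ℕ) (N M : Type u) [AddCommGroup N] [Module R N]
    [AddCommGroup M] [Module R M] : ModuleCat.{u} R :=
  ((Ext R (ModuleCat.{u} R) i).obj (Opposite.op (ModuleCat.of R N))).obj (ModuleCat.of R M)

/-- The depth of `M` with respect to the ideal `I`: the least `i` such that
`Ext_R^i(R/I, M) ≠ 0` (with value `⊤ : ℕ∞` if no such `i` exists). -/
def idealDepth (R : Type u) [CommRing R] (I : Ideal R) (M : Type u) [AddCommGroup M]
    [Module R M] : ℕ∞ :=
  sInf ((↑) '' { i : ℕ | ¬ Subsingleton (extModule R i (R ⧸ I) M) })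

/-- A finitely generated `S`-module `M` is totally reflexive if the biduality map
`M → Hom_S(Hom_S(M,S),S)` is bijective and `Ext_S^i(M,S) = 0 = Ext_S^i(M^*,S)`
for all `i ≥ 1`. -/
def IsTotallyReflexive (S : Type u) [CommRing S] (M : Type u) [AddCommGroup M]
    [Module S M] : Prop :=
  Module.Finite S M ∧ Function.Bijective (Module.Dual.eval S M) ∧
    ∀ i : ℕ, 1 ≤ i → Subsingleton (extModule S i M S) ∧
      Subsingleton (extModule S i (Module.Dual S M) S)

/-- A noetherian local ring is G-regular if every totally reflexive module is free. -/
def IsGRegular (S : Type u) [CommRing S] : Prop :=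
  ∀ (M : Type u) [AddCommGroup M] [Module S M], IsTotallyReflexive S M → Module.Free S M

/-- A commutative ring is a regular local ring if it is a noetherian local ring whose
maximal ideal is generated by a regular sequence. -/
def IsRegularLocal (A : Type u) [CommRing A] : Prop :=
  IsNoetherianRing A ∧ ∃ h : IsLocalRing A, ∃ rs : List A,
    RingTheory.Sequence.IsRegular A rs ∧
      Ideal.span { x | x ∈ rs } = @IsLocalRing.maximalIdeal A _ h

/-- A Gorenstein local ring: a noetherian local ring of finite self-injective dimension. -/
def IsGorensteinLocal (A : Type u) [CommRing A] : Prop :=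
  IsNoetherianRing A ∧ IsLocalRing A ∧ injDim A A < ⊤

/-- `E` is an injective envelope (injective hull) of the residue field of the local
ring `S`: an injective module containing the residue field as an essential submodule. -/
def IsInjEnvResidueField (S : Type u) [CommRing S] [IsLocalRing S] (E : Type u)
    [AddCommGroup E] [Module S E] : Prop :=
  Module.Injective S E ∧ ∃ ι : ResidueField S →ₗ[S] E, Function.Injective ι ∧
    ∀ N : Submodule S E, N ≠ ⊥ → N ⊓ LinearMap.range ι ≠ ⊥

end
/- ## Cohen factorizations and (exceptional) complete intersection maps -/

noncomputable section

/-- The canonical ring homomorphism from a local ring `S` to its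
maximal-adic completion. -/
def completionHom (S : Type u) [CommRing S] [IsLocalRing S] :
    S →+* AdicCompletion (maximalIdeal S) S :=
  algebraMap S (AdicCompletion (maximalIdeal S) S)

/-- `R → R' → Ŝ` is a Cohen factorization of the local homomorphism `f : R → S`:
`R'` is a complete noetherian local ring, `R → R'` is a flat local homomorphism with
regular closed fiber `R'/mR'`, and `R' → Ŝ` is surjective, the composite being the
composition of `f` with the completion map of `S`. -/
def IsCohenFactorization {R S R' : Type u} [CommRing R] [CommRing S] [IsLocalRing R]
    [IsLocalRing S] [CommRing R'] (f : R →+* S) (g : R →+* R')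
    (h : R' →+* AdicCompletion (maximalIdeal S) S) : Prop :=
  IsNoetherianRing R' ∧ IsLocalRing R' ∧ IsAdicComplete ((⊥ : Ideal R').jacobson) R' ∧
    h.comp g = (completionHom S).comp f ∧ IsLocalHom g ∧ g.Flat ∧
    IsRegularLocal (R' ⧸ (maximalIdeal R).map g) ∧ Function.Surjective h

/-- A local homomorphism `f : R → S` of noetherian local rings is a complete intersection
map if in some Cohen factorization `R → R' → Ŝ` the kernel of `R' → Ŝ` is generated by a
regular sequence. -/
def IsCIMap {R S : Type u} [CommRing R] [CommRing S] [IsLocalRing R] [IsLocalRing S]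
    (f : R →+* S) : Prop :=
  ∃ (R' : Type u) (_ : CommRing R') (g : R →+* R')
    (h : R' →+* AdicCompletion (maximalIdeal S) S),
    IsCohenFactorization f g h ∧ ∃ rs : List R',
      RingTheory.Sequence.IsRegular R' rs ∧ RingHom.ker h = Ideal.span { x | x ∈ rs }

/-- A local homomorphism `f : R → S` of noetherian local rings is an exceptional complete
intersection map if it is a complete intersection map and
`edim R - dim R = edim S - dim S`. -/
def IsExceptionalCIMap {R S : Type u} [CommRing R] [CommRing S] [IsLocalRing R]
    [IsLocalRing S] (f : R →+* S) : Prop :=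
  IsCIMap f ∧
    (embDim R : WithBot ℕ∞) + ringKrullDim S =
      (embDim S : WithBot ℕ∞) + ringKrullDim R

end
/- ## Homological dimensions along a ring homomorphism -/

noncomputable section

variable {R S : Type u} [CommRing R] [CommRing S]

/-- The flat dimension `fd_R S` of `S` as an `R`-module along `f : R → S`. -/
def flatDimAlong (f : R →+* S) : ℕ∞ :=
  letI := f.toModule; flatDim R S

/-- The Gorenstein flat dimension over `R` of an `S`-module `M`, viewed as an
`R`-module along `f : R → S`. -/
def gfdAlong (f : R →+* S) (M : Type u) [AddCommGroup M] [Module S M] : ℕ∞ :=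
  letI := Module.compHom M f; gfd R M

/-- The Gorenstein injective dimension over `R` of an `S`-module `M`, viewed as an
`R`-module along `f : R → S`. -/
def gidAlong (f : R →+* S) (M : Type u) [AddCommGroup M] [Module S M] : ℕ∞ :=
  letI := Module.compHom M f; gid R M

/-- `M` is Gorenstein flat as an `R`-module along `f : R → S`. -/
def IsGorensteinFlatAlong (f : R →+* S) (M : Type u) [AddCommGroup M] [Module S M] : Prop :=
  letI := Module.compHom M f; IsGorensteinFlat R M

/-- `M` is Gorenstein injective as an `R`-module along `f : R → S`. -/
def IsGorensteinInjectiveAlong (f : R →+* S) (M : Type u) [AddCommGroup M]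
    [Module S M] : Prop :=
  letI := Module.compHom M f; IsGorensteinInjective R M

end
/- ## Vanishing of Tor -/

section TorVanishing

open TensorProduct Function

variable {R : Type u} [CommRing R]

section Snake

variable {K P N L Q M : Type*} [AddCommGroup K] [AddCommGroup P] [AddCommGroup N]
  [AddCommGroup L] [AddCommGroup Q] [AddCommGroup M] [Module R K] [Module R P] [Module R N]
  [Module R L] [Module R Q] [Module R M]
  {i : K →ₗ[R] P} {p : P →ₗ[R] N} {j : L →ₗ[R] Q} {q : Q →ₗ[R] M}

lemma lTensor_injective_of_rTensor_injective_of_lTensor_injective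
    (hip : Exact i p) (hp : Surjective p) (hjP : Injective (j.lTensor P)) (hjq : Exact j q)
    (hq : Surjective q) (h : Injective (i.rTensor M)) : Injective (j.lTensor N) := by
  rw [injective_iff_map_eq_zero]
  intro x hx
  obtain ⟨x', rfl⟩ := p.rTensor_surjective L hp x
  have hcomm : (p.rTensor Q) ((j.lTensor P) x') = 0 := by
    rw [← hx, ← LinearMap.comp_apply, ← LinearMap.comp_apply, LinearMap.rTensor_comp_lTensor,
      LinearMap.lTensor_comp_rTensor]
  obtain ⟨y, hy⟩ := (rTensor_exact Q hip hp _).1 hcomm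
  have hyM : (q.lTensor K) y = 0 := by
    apply h
    rw [map_zero, ← LinearMap.comp_apply, LinearMap.rTensor_comp_lTensor,
      ← LinearMap.lTensor_comp_rTensor, LinearMap.comp_apply, hy, ← LinearMap.comp_apply,
      ← LinearMap.lTensor_comp, hjq.linearMap_comp_eq_zero]
    simp
  obtain ⟨z, rfl⟩ := (lTensor_exact K hjq hq _).1 hyM
  have : (i.rTensor L) z = x' := by
    apply hjP
    rw [← hy, ← LinearMap.comp_apply, ← LinearMap.comp_apply, LinearMap.rTensor_comp_lTensor,
      LinearMap.lTensor_comp_rTensor]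
  rw [← this, ← LinearMap.comp_apply, ← LinearMap.rTensor_comp, hip.linearMap_comp_eq_zero]
  simp

lemma lTensor_injective_of_rTensor_injective [Module.Flat R P]
    (hip : Exact i p) (hp : Surjective p) (hj : Injective j) (hjq : Exact j q)
    (hq : Surjective q) (h : Injective (i.rTensor M)) : Injective (j.lTensor N) :=
  lTensor_injective_of_rTensor_injective_of_lTensor_injective hip hp
    (Module.Flat.lTensor_preserves_injective_linearMap (M := P) j hj) hjq hq h

lemma rTensor_injective_iff_lTensor_injective [Module.Flat R P] [Module.Flat R Q]
    (hi : Injective i) (hip : Exact i p) (hp : Surjective p) (hj : Injective j) (hjq : Exact j q)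
    (hq : Surjective q) : Injective (i.rTensor M) ↔ Injective (j.lTensor N) := by
  refine ⟨lTensor_injective_of_rTensor_injective hip hp hj hjq hq, fun h ↦ ?_⟩
  rw [LinearMap.lTensor_inj_iff_rTensor_inj] at h
  rw [← LinearMap.lTensor_inj_iff_rTensor_inj]
  exact lTensor_injective_of_rTensor_injective hjq hq hi hip hp h

lemma rTensor_injective_iff_lTensor_injective_of_flat [Module.Flat R P] [Module.Flat R Q]
    (hi : Injective i) (hj : Injective j) :
    Injective (i.rTensor L) ↔ Injective (j.lTensor K) := by
  have h₁ := Module.Flat.lTensor_preserves_injective_linearMap (M := P) j hj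
  have h₂ := Module.Flat.rTensor_preserves_injective_linearMap (M := Q) i hi
  have hc : (j.lTensor P) ∘ (i.rTensor L) = (i.rTensor Q) ∘ (j.lTensor K) := by
    rw [← LinearMap.coe_comp, ← LinearMap.coe_comp, LinearMap.lTensor_comp_rTensor,
      LinearMap.rTensor_comp_lTensor]
  rw [← h₁.of_comp_iff, hc, h₂.of_comp_iff]

end Snake

/-- The canonical free cover of a module. -/
noncomputable abbrev freeCover (R : Type u) [CommRing R] (N : Type u) [AddCommGroup N] [Module R N] :
    (N →₀ R) →ₗ[R] N :=
  Finsupp.linearCombination R (id : N → N)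

lemma freeCover_surjective (N : Type u) [AddCommGroup N] [Module R N] :
    Surjective (freeCover R N) := fun x ↦ ⟨Finsupp.single x 1, by simp⟩

/-- `Tor₁(N, M) = 0`, computed through the canonical free cover of `N`. -/
def TorOneZero (R : Type u) [CommRing R] (N M : Type u) [AddCommGroup N] [Module R N]
    [AddCommGroup M] [Module R M] : Prop :=
  Injective ((LinearMap.ker (freeCover R N)).subtype.rTensor M)

/-- `Torₙ₊₁(N, M) = 0`, defined by passing to syzygies of `N`. -/
def TorSuccZero (R : Type u) [CommRing R] :
    (n : ℕ) → (N : Type u) → [AddCommGroup N] → [Module R N] → (M : Type u) →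
      [AddCommGroup M] → [Module R M] → Prop
  | 0, N, _, _, M, _, _ => TorOneZero R N M
  | n + 1, N, _, _, M, _, _ => TorSuccZero R n (LinearMap.ker (freeCover R N)) M

variable {N M L Q K P : Type u} [AddCommGroup N] [Module R N] [AddCommGroup M] [Module R M]
  [AddCommGroup L] [Module R L] [AddCommGroup Q] [Module R Q]
  [AddCommGroup K] [Module R K] [AddCommGroup P] [Module R P]

lemma exact_subtype_ker (p : P →ₗ[R] N) : Exact (LinearMap.ker p).subtype p :=
  LinearMap.exact_subtype_ker_map p

lemma torOneZero_iff_lTensor [Module.Flat R Q] {j : L →ₗ[R] Q} {q : Q →ₗ[R] M}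
    (hj : Injective j) (hjq : Exact j q) (hq : Surjective q) :
    TorOneZero R N M ↔ Injective (j.lTensor N) :=
  rTensor_injective_iff_lTensor_injective (Submodule.injective_subtype _)
    (exact_subtype_ker _) (freeCover_surjective N) hj hjq hq

lemma torOneZero_iff_rTensor [Module.Flat R P] {i : K →ₗ[R] P} {p : P →ₗ[R] N}
    (hi : Injective i) (hip : Exact i p) (hp : Surjective p) :
    TorOneZero R N M ↔ Injective (i.rTensor M) := by
  rw [torOneZero_iff_lTensor (Submodule.injective_subtype _)
    (exact_subtype_ker _) (freeCover_surjective M)]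
  exact (rTensor_injective_iff_lTensor_injective hi hip hp (Submodule.injective_subtype _)
    (exact_subtype_ker _) (freeCover_surjective M)).symm

lemma torOneZero_comm : TorOneZero R N M ↔ TorOneZero R M N := by
  rw [torOneZero_iff_lTensor (Submodule.injective_subtype _)
    (exact_subtype_ker _) (freeCover_surjective M), TorOneZero,
    ← LinearMap.lTensor_inj_iff_rTensor_inj]

lemma torOneZero_of_flat_right [Module.Flat R M] : TorOneZero R N M :=
  Module.Flat.rTensor_preserves_injective_linearMap _ (Submodule.injective_subtype _)

/-- Dimension shifting in the second variable. -/
lemma torSuccZero_succ_iff [Module.Flat R Q] {q : Q →ₗ[R] M} (hq : Surjective q) (n : ℕ) :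
    TorSuccZero R (n + 1) N M ↔ TorSuccZero R n N (LinearMap.ker q) := by
  induction n generalizing N with
  | zero =>
    change TorOneZero R (LinearMap.ker (freeCover R N)) M ↔ TorOneZero R N (LinearMap.ker q)
    rw [torOneZero_iff_lTensor (Submodule.injective_subtype _) (exact_subtype_ker _) hq]
    exact (rTensor_injective_iff_lTensor_injective_of_flat (Submodule.injective_subtype _)
      (Submodule.injective_subtype _)).symm
  | succ n ih => exact ih

lemma torSuccZero_of_fdLE (n : ℕ) (h : fdLE R n M) (N : Type u) [AddCommGroup N] [Module R N] :
    TorSuccZero R n N M := by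
  induction n generalizing M with
  | zero =>
    have : Module.Flat R M := h
    exact torOneZero_of_flat_right
  | succ n ih =>
    obtain ⟨c, hc⟩ := h
    have := c.flat
    exact (torSuccZero_succ_iff c.surj n).2 (ih hc)

lemma TorSuccZero.of_le {n m : ℕ} (hnm : n ≤ m)
    (h : ∀ (N : Type u) [AddCommGroup N] [Module R N], TorSuccZero R n N M)
    (N : Type u) [AddCommGroup N] [Module R N] : TorSuccZero R m N M := by
  induction m, hnm using Nat.le_induction generalizing N with
  | base => exact h N
  | succ m _ ih => exact ih _

/-- Flat base change along `S → T` preserves vanishing of `Tor^R(N, S)`. -/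
lemma TorSuccZero.tower {S T : Type u} [CommRing S] [CommRing T] [Algebra R S] [Algebra R T]
    [Algebra S T] [IsScalarTower R S T] [Module.Flat S T] {n : ℕ}
    (h : TorSuccZero R n N S) : TorSuccZero R n N T := by
  induction n generalizing N with
  | zero =>
    change Injective _ at h ⊢
    rw [← LinearMap.lTensor_inj_iff_rTensor_inj] at h ⊢
    set i := (LinearMap.ker (freeCover R N)).subtype
    have h₁ : Injective ((i.baseChange S).baseChange T) :=
      Module.Flat.lTensor_preserves_injective_linearMap (M := T)
        (i.baseChange S : _ →ₗ[S] _) h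
    have h₂ : i.lTensor T = ((AlgebraTensorModule.cancelBaseChange R S T T _).restrictScalars R).toLinearMap ∘ₗ
        ((i.baseChange S).baseChange T).restrictScalars R ∘ₗ
        ((AlgebraTensorModule.cancelBaseChange R S T T _).symm.restrictScalars R).toLinearMap := by
      ext t x
      simp
    rw [h₂]
    simpa using h₁
  | succ n ih => exact ih h

lemma lTensor_injective_of_exact [Module.Flat R Q] {j : L →ₗ[R] Q}
    {f : K →ₗ[R] N} {g : N →ₗ[R] P} (hfg : Exact f g) (h₁ : Injective (j.lTensor K))
    (h₂ : Injective (j.lTensor P)) (hf : Injective f) (hg : Surjective g) :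
    Injective (j.lTensor N) := by
  rw [injective_iff_map_eq_zero]
  intro x hx
  have hx0 : (g.rTensor _) x = 0 := by
    apply h₂
    rw [map_zero, ← LinearMap.comp_apply, LinearMap.lTensor_comp_rTensor,
      ← LinearMap.rTensor_comp_lTensor, LinearMap.comp_apply, hx, map_zero]
  obtain ⟨y, rfl⟩ := (rTensor_exact _ hfg hg _).1 hx0
  have hy : (j.lTensor K) y = 0 := by
    apply Module.Flat.rTensor_preserves_injective_linearMap (M := Q) f hf
    rw [map_zero, ← LinearMap.comp_apply, LinearMap.rTensor_comp_lTensor,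
      ← LinearMap.lTensor_comp_rTensor, LinearMap.comp_apply, hx]
  rw [(injective_iff_map_eq_zero _).1 h₁ y hy, map_zero]

lemma TorOneZero.of_exact_of_cover [Module.Flat R Q] {j : L →ₗ[R] Q} {q : Q →ₗ[R] M}
    (hj : Injective j) (hjq : Exact j q) (hq : Surjective q)
    {f : K →ₗ[R] N} {g : N →ₗ[R] P} (hfg : Exact f g)
    (h₁ : TorOneZero R K M) (h₂ : TorOneZero R P M) (hf : Injective f) (hg : Surjective g) :
    TorOneZero R N M := by
  rw [torOneZero_iff_lTensor hj hjq hq] at h₁ h₂ ⊢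
  exact lTensor_injective_of_exact hfg h₁ h₂ hf hg

/-- Vanishing of `Tor₁(-, M)` passes through extensions in the first variable. -/
lemma TorOneZero.of_exact {f : K →ₗ[R] N} {g : N →ₗ[R] P} (hfg : Exact f g)
    (h₁ : TorOneZero R K M) (h₂ : TorOneZero R P M) (hf : Injective f) (hg : Surjective g) :
    TorOneZero R N M :=
  TorOneZero.of_exact_of_cover (Submodule.injective_subtype _) (exact_subtype_ker _)
    (freeCover_surjective M) hfg h₁ h₂ hf hg

lemma TorOneZero.of_rTensor_injective_of_cover [Module.Flat R Q] {j : L →ₗ[R] Q} {q : Q →ₗ[R] M}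
    (hj : Injective j) (hjq : Exact j q) (hq : Surjective q)
    {f : K →ₗ[R] N} {g : N →ₗ[R] P} (hfg : Exact f g) (hg : Surjective g)
    (h₁ : TorOneZero R N M) (h₂ : Injective (f.rTensor M)) : TorOneZero R P M := by
  rw [torOneZero_iff_lTensor hj hjq hq] at h₁ ⊢
  exact lTensor_injective_of_rTensor_injective_of_lTensor_injective hfg hg h₁ hjq hq h₂

/-- If `K → N → P → 0` is exact, `Tor₁(N, M) = 0` and `K ⊗ M → N ⊗ M` is injective, then
`Tor₁(P, M) = 0`. -/
lemma TorOneZero.of_rTensor_injective {f : K →ₗ[R] N} {g : N →ₗ[R] P} (hfg : Exact f g)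
    (hg : Surjective g) (h₁ : TorOneZero R N M) (h₂ : Injective (f.rTensor M)) :
    TorOneZero R P M :=
  TorOneZero.of_rTensor_injective_of_cover (Submodule.injective_subtype _) (exact_subtype_ker _)
    (freeCover_surjective M) hfg hg h₁ h₂

lemma quotient_one_tmul_eq_zero_iff (I : Ideal R) (x : M) :
    (1 : R ⧸ I) ⊗ₜ[R] x = 0 ↔ x ∈ I • (⊤ : Submodule R M) := by
  rw [← (TensorProduct.quotTensorEquivQuotSMul M I).map_eq_zero_iff]
  have := TensorProduct.quotTensorEquivQuotSMul_mk_tmul (M := M) I 1 x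
  rw [map_one] at this
  rw [this]
  simp [Submodule.Quotient.mk_eq_zero]

lemma exists_quotient_one_tmul (I : Ideal R) (x : (R ⧸ I) ⊗[R] M) :
    ∃ y : M, x = (1 : R ⧸ I) ⊗ₜ[R] y := by
  induction x with
  | zero => exact ⟨0, by simp⟩
  | add x y hx hy =>
    obtain ⟨x, rfl⟩ := hx
    obtain ⟨y, rfl⟩ := hy
    exact ⟨x + y, by rw [TensorProduct.tmul_add]⟩
  | tmul a y =>
    obtain ⟨a, rfl⟩ := Ideal.Quotient.mk_surjective a
    refine ⟨a • y, ?_⟩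
    rw [← TensorProduct.smul_tmul, Algebra.smul_def, mul_one]
    rfl

/-- If `F` is flat then `Tor₁(R/I, F/L) = 0` means `IF ∩ L ⊆ IL`. -/
lemma torOneZero_quotient_iff [Module.Flat R Q] {I : Ideal R} {q : Q →ₗ[R] M}
    (hq : Surjective q) : TorOneZero R (R ⧸ I) M ↔ ∀ x : LinearMap.ker q,
      (x : Q) ∈ I • (⊤ : Submodule R Q) → x ∈ I • (⊤ : Submodule R (LinearMap.ker q)) := by
  rw [torOneZero_iff_lTensor (Submodule.injective_subtype _) (exact_subtype_ker _) hq,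
    injective_iff_map_eq_zero]
  constructor
  · intro h x hx
    rw [← quotient_one_tmul_eq_zero_iff] at hx ⊢
    exact h _ (by simpa using hx)
  · intro h x hx
    obtain ⟨x, rfl⟩ := exists_quotient_one_tmul I x
    rw [LinearMap.lTensor_tmul] at hx
    exact (quotient_one_tmul_eq_zero_iff I x).2 (h x ((quotient_one_tmul_eq_zero_iff I _).1 hx))

end TorVanishing

/- ## The local criterion of flatness -/

section LocalCriterion

open TensorProduct Function

variable {A : Type u} [CommRing A]

lemma TorOneZero.of_linearEquiv {N N' M : Type u} [AddCommGroup N] [Module A N]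
    [AddCommGroup N'] [Module A N'] [AddCommGroup M] [Module A M] (e : N ≃ₗ[A] N')
    (h : TorOneZero A N M) : TorOneZero A N' M := by
  rw [torOneZero_comm] at h ⊢
  refine Injective.of_comp (f := TensorProduct.congr (LinearEquiv.refl A _) e.symm) ?_
  have : TensorProduct.congr (LinearEquiv.refl A _) e.symm ∘
      (LinearMap.ker (freeCover A M)).subtype.rTensor N' =
      (LinearMap.ker (freeCover A M)).subtype.rTensor N ∘
        TensorProduct.congr (LinearEquiv.refl A _) e.symm := by
    rw [← LinearEquiv.coe_coe, ← LinearEquiv.coe_coe, ← LinearMap.coe_comp, ← LinearMap.coe_comp]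
    congr 1
    ext x y
    simp
  rw [this]
  exact h.comp (LinearEquiv.injective _)

lemma torOneZero_of_subsingleton {N M : Type u} [AddCommGroup N] [Module A N]
    [Subsingleton N] [AddCommGroup M] [Module A M] : TorOneZero A N M := by
  rw [torOneZero_comm]
  exact torOneZero_of_flat_right

lemma TorOneZero.lTensor_injective_of_cover {K N P M L Q : Type u} [AddCommGroup K] [Module A K]
    [AddCommGroup N] [Module A N] [AddCommGroup P] [Module A P] [AddCommGroup M] [Module A M]
    [AddCommGroup L] [Module A L] [AddCommGroup Q] [Module A Q] [Module.Flat A Q]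
    {j : L →ₗ[A] Q} {q : Q →ₗ[A] M} (hj : Injective j) (hjq : Exact j q) (hq : Surjective q)
    {f : K →ₗ[A] N} {g : N →ₗ[A] P} (h : TorOneZero A P M) (hf : Injective f) (hfg : Exact f g)
    (hg : Surjective g) : Injective (f.lTensor M) :=
  lTensor_injective_of_rTensor_injective hjq hq hf hfg hg
    ((torOneZero_iff_rTensor hj hjq hq).1 (torOneZero_comm.1 h))

/-- If `0 → K → N → P → 0` is exact and `Tor₁(P, M) = 0`, then `M ⊗ K → M ⊗ N` is injective. -/
lemma TorOneZero.lTensor_injective {K N P M : Type u} [AddCommGroup K] [Module A K]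
    [AddCommGroup N] [Module A N] [AddCommGroup P] [Module A P] [AddCommGroup M] [Module A M]
    {f : K →ₗ[A] N} {g : N →ₗ[A] P} (h : TorOneZero A P M) (hf : Injective f) (hfg : Exact f g)
    (hg : Surjective g) : Injective (f.lTensor M) :=
  TorOneZero.lTensor_injective_of_cover (Submodule.injective_subtype _) (exact_subtype_ker _)
    (freeCover_surjective M) h hf hfg hg

lemma TorOneZero.of_pow_smul_eq_bot [IsNoetherianRing A] [IsLocalRing A] {M : Type u}
    [AddCommGroup M] [Module A M] (h : TorOneZero A (A ⧸ maximalIdeal A) M)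
    (N : Type u) [AddCommGroup N] [Module A N] [hN : Module.Finite A N] {n : ℕ}
    (hn : ∀ a ∈ maximalIdeal A ^ n, ∀ x : N, a • x = 0) : TorOneZero A N M := by
  revert hn
  refine IsNoetherianRing.induction_on_isQuotientEquivQuotientPrime A hN
    (motive := fun N _ _ _ ↦ (∀ a ∈ maximalIdeal A ^ n, ∀ x : N, a • x = 0) → TorOneZero A N M)
    ?_ ?_ ?_
  · intro N _ _ _ _ _
    exact torOneZero_of_subsingleton
  · intro N _ _ _ p e hn
    have hp : p.1 = maximalIdeal A := by
      refine le_antisymm (le_maximalIdeal p.2.ne_top) ?_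
      refine p.2.le_of_pow_le (n := n) fun a ha ↦ ?_
      have := hn a ha (e.symm 1)
      rw [← map_smul, e.symm.map_eq_zero_iff, Algebra.smul_def, mul_one] at this
      exact Ideal.Quotient.eq_zero_iff_mem.1 this
    rw [← hp] at h
    exact h.of_linearEquiv e.symm
  · intro N₁ _ _ _ N₂ _ _ _ N₃ _ _ _ f g hf hg hfg h₁ h₃ hn
    refine TorOneZero.of_exact hfg (h₁ fun a ha x ↦ hf ?_) (h₃ fun a ha x ↦ ?_) hf hg
    · rw [map_smul, hn a ha, map_zero]
    · obtain ⟨y, rfl⟩ := hg x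
      rw [← map_smul, hn a ha, map_zero]

lemma flat_of_torOneZero [IsNoetherianRing A] [IsLocalRing A] {B : Type u} [CommRing B]
    [IsNoetherianRing B] [IsLocalRing B] [Algebra A B] [IsLocalHom (algebraMap A B)]
    (h : TorOneZero A (A ⧸ maximalIdeal A) B) : Module.Flat A B := by
  rw [Module.Flat.iff_lTensor_injective']
  intro 𝔞
  rw [injective_iff_map_eq_zero]
  intro z hz
  have hB : maximalIdeal B ≠ ⊤ := Ideal.IsPrime.ne_top'
  have key : z ∈ (⨅ i : ℕ, maximalIdeal B ^ i • ⊤ : Submodule B (B ⊗[A] 𝔞)) := by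
    rw [Submodule.mem_iInf]
    intro n
    obtain ⟨k, hk⟩ := (maximalIdeal A).exists_pow_inf_eq_pow_smul (M := A) 𝔞
    specialize hk (n + k) (Nat.le_add_left k n)
    let φ : 𝔞 →ₗ[A] A ⧸ (maximalIdeal A ^ (n + k)) := Submodule.mkQ _ ∘ₗ 𝔞.subtype
    have hker : ∀ x : 𝔞, x ∈ LinearMap.ker φ → x ∈ (maximalIdeal A ^ n) • (⊤ : Submodule A 𝔞) := by
      intro x hx
      have hx1 : (x : A) ∈ maximalIdeal A ^ (n + k) :=
        Ideal.Quotient.eq_zero_iff_mem.1 hx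
      have hx2 : (x : A) ∈ maximalIdeal A ^ (n + k) • (⊤ : Submodule A A) ⊓ 𝔞 :=
        ⟨by simpa using hx1, x.2⟩
      rw [hk, Nat.add_sub_cancel] at hx2
      have hx3 : (x : A) ∈ Submodule.map 𝔞.subtype ((maximalIdeal A ^ n) • (⊤ : Submodule A 𝔞)) := by
        rw [Submodule.map_smul'']
        refine Submodule.smul_mono le_rfl ?_ hx2
        intro y hy
        exact ⟨⟨y, hy.2⟩, trivial, rfl⟩
      obtain ⟨y, hy, hyx⟩ := hx3
      rwa [← Subtype.ext hyx]
    have hinj : Injective ((LinearMap.range φ).subtype.lTensor B) := by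
      refine TorOneZero.lTensor_injective (P := (A ⧸ (maximalIdeal A ^ (n + k))) ⧸ LinearMap.range φ)
        (g := (LinearMap.range φ).mkQ) (h.of_pow_smul_eq_bot _ (n := n + k) ?_)
        (Submodule.injective_subtype _) (LinearMap.exact_subtype_mkQ _) (Submodule.mkQ_surjective _)
      intro a ha x
      obtain ⟨x, rfl⟩ := Submodule.mkQ_surjective _ x
      obtain ⟨x, rfl⟩ := Ideal.Quotient.mk_surjective x
      rw [← map_smul, Algebra.smul_def]
      have : algebraMap A (A ⧸ maximalIdeal A ^ (n + k)) a = 0 :=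
        Ideal.Quotient.eq_zero_iff_mem.2 ha
      rw [this, zero_mul, map_zero]
    have h0 : (φ.rangeRestrict.lTensor B) z = 0 := by
      apply hinj
      rw [map_zero, ← LinearMap.comp_apply, ← LinearMap.lTensor_comp,
        LinearMap.subtype_comp_codRestrict, LinearMap.lTensor_comp, LinearMap.comp_apply, hz,
        map_zero]
    have hex : Exact (LinearMap.ker φ).subtype φ.rangeRestrict := by
      intro x
      simp [Subtype.ext_iff, φ]
    obtain ⟨w, rfl⟩ := (lTensor_exact B hex φ.surjective_rangeRestrict _).1 h0
    have hmap : ∀ x ∈ (maximalIdeal A ^ n) • (⊤ : Submodule A 𝔞), ∀ b : B,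
        b ⊗ₜ[A] x ∈ (maximalIdeal B ^ n • ⊤ : Submodule B (B ⊗[A] 𝔞)) := by
      intro x hx b
      induction hx using Submodule.smul_induction_on' with
      | smul a ha y _ =>
        rw [← TensorProduct.smul_tmul, Algebra.smul_def, ← smul_eq_mul, ← TensorProduct.smul_tmul']
        refine Submodule.smul_mem_smul ?_ trivial
        have := Ideal.mem_map_of_mem (algebraMap A B) ha
        rw [Ideal.map_pow] at this
        exact Ideal.pow_right_mono (((local_hom_TFAE (algebraMap A B)).out 0 2).1 ‹_›) n this
      | add x _ y _ hx hy =>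
        rw [TensorProduct.tmul_add]
        exact add_mem hx hy
    clear hz h0
    induction w with
    | zero => simp
    | add x y hx hy =>
      rw [map_add]
      exact add_mem hx hy
    | tmul b x => exact hmap _ (hker _ x.2) b
  rw [Ideal.iInf_pow_smul_eq_bot_of_isLocalRing _ hB] at key
  exact key

end LocalCriterion

section FlatRegular

open TensorProduct Function RingTheory.Sequence

variable {A : Type u} [CommRing A]

lemma torOneZero_quotient_ofList {B : Type u} [AddCommGroup B] [Module A B] (rs : List A)
    (hA : IsWeaklyRegular A rs) (hB : IsWeaklyRegular B rs) :
    TorOneZero A (A ⧸ Ideal.ofList rs) B := by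
  induction rs using List.reverseRecOn with
  | nil =>
    rw [torOneZero_comm]
    rw [Ideal.ofList_nil]
    have : Module.Flat A (A ⧸ (⊥ : Ideal A)) :=
      Module.Flat.of_linearEquiv (Submodule.quotEquivOfEqBot (⊥ : Ideal A) rfl)
    exact torOneZero_of_flat_right
  | append_singleton rs x ih =>
    rw [isWeaklyRegular_append_iff, isWeaklyRegular_singleton_iff,
      isSMulRegular_quotient_iff_mem_of_smul_mem] at hA hB
    set I := Ideal.ofList rs
    let f : (A ⧸ I) →ₗ[A] (A ⧸ I) := LinearMap.lsmul A _ x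
    have hle : I ≤ Ideal.ofList (rs ++ [x]) := by simp [I]
    let g : (A ⧸ I) →ₗ[A] (A ⧸ Ideal.ofList (rs ++ [x])) := Submodule.factor hle
    have hg : Surjective g := Submodule.factor_surjective hle
    have hfg : Exact f g := by
      intro y
      obtain ⟨y, rfl⟩ := Ideal.Quotient.mk_surjective y
      have : g (Ideal.Quotient.mk I y) = Ideal.Quotient.mk _ y := rfl
      rw [this, Ideal.Quotient.eq_zero_iff_mem, Ideal.ofList_append, Ideal.ofList_singleton,
        Submodule.mem_sup]
      constructor
      · rintro ⟨i, hi, z, hz, rfl⟩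
        obtain ⟨w, rfl⟩ := Ideal.mem_span_singleton.1 hz
        refine ⟨Ideal.Quotient.mk I w, ?_⟩
        rw [map_add, Ideal.Quotient.eq_zero_iff_mem.2 hi, zero_add]
        rfl
      · rintro ⟨w, hw⟩
        obtain ⟨w, rfl⟩ := Ideal.Quotient.mk_surjective w
        have hw : Ideal.Quotient.mk I (x * w) = Ideal.Quotient.mk I y := hw
        refine ⟨y - x * w, Ideal.Quotient.eq_zero_iff_mem.1 (by rw [map_sub, hw, sub_self]),
          x * w, Ideal.mem_span_singleton.2 ⟨w, rfl⟩, by ring⟩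
    refine TorOneZero.of_rTensor_injective hfg hg (ih hA.1 hB.1) ?_
    rw [injective_iff_map_eq_zero]
    intro z hz
    obtain ⟨b, rfl⟩ := exists_quotient_one_tmul I z
    rw [LinearMap.rTensor_tmul] at hz
    simp only [f, LinearMap.lsmul_apply] at hz
    rw [TensorProduct.smul_tmul, quotient_one_tmul_eq_zero_iff] at hz
    rw [quotient_one_tmul_eq_zero_iff]
    exact hB.2 b hz

lemma mem_smul_top_iff_mem_map {B : Type u} [CommRing B] [Algebra A B] (I : Ideal A) (b : B) :
    b ∈ (I • ⊤ : Submodule A B) ↔ b ∈ I.map (algebraMap A B) := by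
  rw [Ideal.smul_top_eq_map]
  rfl

variable [IsNoetherianRing A] [IsLocalRing A] {B : Type u} [CommRing B]
    [IsNoetherianRing B] [IsLocalRing B] [Algebra A B] [IsLocalHom (algebraMap A B)]

/-- A local ring is flat over a regular local base when a regular system of parameters of the
base stays regular. -/
lemma flat_of_isWeaklyRegular (rs : List A) (hm : Ideal.ofList rs = maximalIdeal A)
    (hA : IsWeaklyRegular A rs) (hB : IsWeaklyRegular B rs) : Module.Flat A B :=
  flat_of_torOneZero (hm ▸ torOneZero_quotient_ofList rs hA hB)

/-- An element of the maximal ideal which is regular on the closed fibre of a flat local map is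
regular, and the quotient by it is still flat. -/
lemma flat_quotient_of_regular_fibre [Module.Flat A B] {y : B} (hy : y ∈ maximalIdeal B)
    (hreg : ∀ b, y * b ∈ (maximalIdeal A).map (algebraMap A B) →
      b ∈ (maximalIdeal A).map (algebraMap A B)) :
    Module.Flat A (B ⧸ Ideal.span {y}) ∧ IsSMulRegular B y := by
  have hlt : Ideal.span {y} ≠ ⊤ := fun h ↦ (Ideal.IsPrime.ne_top' : maximalIdeal B ≠ ⊤)
    (top_le_iff.1 (h ▸ (Ideal.span_singleton_le_iff_mem _).2 hy))
  have : Nontrivial (B ⧸ Ideal.span {y}) := Ideal.Quotient.nontrivial_iff.2 hlt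
  have : IsLocalRing (B ⧸ Ideal.span {y}) :=
    .of_surjective' (Ideal.Quotient.mk _) Ideal.Quotient.mk_surjective
  have : IsLocalHom (Ideal.Quotient.mk (Ideal.span {y})) :=
    .of_surjective _ Ideal.Quotient.mk_surjective
  have : IsLocalHom (algebraMap A (B ⧸ Ideal.span {y})) :=
    inferInstanceAs (IsLocalHom ((Ideal.Quotient.mk (Ideal.span {y})).comp (algebraMap A B)))
  let q : B →ₗ[A] (B ⧸ Ideal.span {y}) := (Ideal.Quotient.mkₐ A (Ideal.span {y})).toLinearMap
  have hq : Surjective q := Ideal.Quotient.mk_surjective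
  have hker : ∀ b, b ∈ LinearMap.ker q ↔ ∃ c, y * c = b := by
    intro b
    rw [LinearMap.mem_ker]
    change Ideal.Quotient.mk _ b = 0 ↔ _
    rw [Ideal.Quotient.eq_zero_iff_mem, Ideal.mem_span_singleton]
    exact ⟨fun ⟨c, hc⟩ ↦ ⟨c, hc.symm⟩, fun ⟨c, hc⟩ ↦ ⟨c, hc.symm⟩⟩
  let s : B →ₗ[A] LinearMap.ker q :=
    (LinearMap.mulLeft A y).codRestrict _ fun c ↦ (hker _).2 ⟨c, rfl⟩
  have hs : Surjective s := by
    rintro ⟨b, hb⟩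
    obtain ⟨c, rfl⟩ := (hker b).1 hb
    exact ⟨c, rfl⟩
  have hflat : Module.Flat A (B ⧸ Ideal.span {y}) := by
    refine flat_of_torOneZero ((torOneZero_quotient_iff hq).2 fun x hx ↦ ?_)
    obtain ⟨c, rfl⟩ := hs x
    rw [mem_smul_top_iff_mem_map] at hx
    have hc := (mem_smul_top_iff_mem_map _ _).2 (hreg c hx)
    have := Submodule.mem_map_of_mem (f := s) hc
    rw [Submodule.map_smul''] at this
    exact Submodule.smul_mono le_rfl le_top this
  refine ⟨hflat, ?_⟩
  have htor : TorOneZero A (A ⧸ maximalIdeal A) (LinearMap.ker q) :=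
    (torSuccZero_succ_iff hq 0).1
      (TorSuccZero.of_le (Nat.zero_le 1) (fun N _ _ ↦ torOneZero_of_flat_right) _)
  rw [torOneZero_quotient_iff hs] at htor
  let K : Ideal B := LinearMap.ker (LinearMap.mulLeft B y)
  have hKmem (b : B) : b ∈ K ↔ y * b = 0 := Iff.rfl
  have hKs (b : B) : b ∈ LinearMap.ker s ↔ b ∈ K := by
    rw [LinearMap.mem_ker, Subtype.ext_iff]
    rfl
  have hK : K = ⊥ := by
    refine Submodule.eq_bot_of_le_smul_of_le_jacobson_bot (maximalIdeal B) K
      (IsNoetherian.noetherian _) ?_ (maximalIdeal_le_jacobson _)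
    intro b hb
    have h1 := htor ⟨b, (hKs b).2 hb⟩ ((mem_smul_top_iff_mem_map _ _).2
      (hreg b (by rw [(hKmem b).1 hb]; exact zero_mem _)))
    have h2 := Submodule.mem_map_of_mem (f := (LinearMap.ker s).subtype) h1
    rw [Submodule.map_smul''] at h2
    have hle : (maximalIdeal A).map (algebraMap A B) ≤ maximalIdeal B :=
      ((local_hom_TFAE (algebraMap A B)).out 0 2).1 ‹_›
    refine Submodule.smul_induction_on (p := fun x ↦ x ∈ maximalIdeal B • K) h2
      (fun a ha z hz ↦ ?_) fun x z hx hz ↦ add_mem hx hz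
    obtain ⟨z, _, rfl⟩ := hz
    rw [algebra_compatible_smul B a]
    exact Submodule.smul_mem_smul (hle (Ideal.mem_map_of_mem _ ha)) ((hKs _).1 z.2)
  intro a b hab
  have : a - b ∈ K := by
    rw [hKmem, mul_sub, sub_eq_zero]
    exact hab
  rw [hK] at this
  exact sub_eq_zero.1 this

end FlatRegular

/- ## Modules of finite projective dimension over a hypersurface section -/

section Nagata

open TensorProduct Function

variable {A : Type u} [CommRing A]

lemma TorSuccZero.of_linearEquiv {N M M' : Type u} [AddCommGroup N] [Module A N]
    [AddCommGroup M'] [Module A M'] [AddCommGroup M] [Module A M] (e : M ≃ₗ[A] M') {n : ℕ}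
    (h : TorSuccZero A n N M) : TorSuccZero A n N M' := by
  induction n generalizing N with
  | zero => exact torOneZero_comm.1 (TorOneZero.of_linearEquiv e (torOneZero_comm.1 h))
  | succ n ih => exact ih h

section

variable {X K P N G M : Type u} [AddCommGroup X] [Module A X] [AddCommGroup K] [Module A K]
  [AddCommGroup P] [Module A P] [AddCommGroup N] [Module A N] [AddCommGroup G] [Module A G]
  [AddCommGroup M] [Module A M] {f : N →ₗ[A] G} {g : G →ₗ[A] M}

lemma TorOneZero.of_syzygy [Module.Flat A P] {i : K →ₗ[A] P} {p : P →ₗ[A] X}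
    (hi : Injective i) (hip : Exact i p) (hp : Surjective p)
    (hf : Injective f) (hfg : Exact f g) (hg : Surjective g)
    (hM : TorOneZero A K M) (hG : TorOneZero A X G) : TorOneZero A X N := by
  rw [torOneZero_iff_rTensor hi hip hp] at hG ⊢
  have h₁ : Injective (f.lTensor K) := (torOneZero_comm.1 hM).lTensor_injective hf hfg hg
  have h₂ : Injective ((f.lTensor P) ∘ (i.rTensor N)) := by
    rw [← LinearMap.coe_comp, LinearMap.lTensor_comp_rTensor, ← LinearMap.rTensor_comp_lTensor,
      LinearMap.coe_comp]
    exact hG.comp h₁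
  exact h₂.of_comp

/-- A piece of the long exact sequence of Tor. -/
lemma TorSuccZero.of_exact (hf : Injective f) (hfg : Exact f g) (hg : Surjective g) {n : ℕ}
    (hM : TorSuccZero A (n + 1) X M) (hG : TorSuccZero A n X G) : TorSuccZero A n X N := by
  induction n generalizing X with
  | zero =>
    exact TorOneZero.of_syzygy (Submodule.injective_subtype _) (exact_subtype_ker _)
      (freeCover_surjective X) hf hfg hg hM hG
  | succ n ih => exact ih hM hG

end

lemma free_of_torOneZero [IsNoetherianRing A] [IsLocalRing A] {M : Type u} [AddCommGroup M]
    [Module A M] [Module.Finite A M] (h : TorOneZero A (A ⧸ maximalIdeal A) M) :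
    Module.Free A M := by
  obtain ⟨n, q, hq⟩ := Module.Finite.exists_fin' A M
  rw [torOneZero_iff_lTensor (Submodule.injective_subtype _) (exact_subtype_ker q) hq] at h
  exact Module.free_of_lTensor_residueField_injective _ q hq (exact_subtype_ker q) h

lemma exists_minimal_cover [IsLocalRing A] (M : Type u) [AddCommGroup M]
    [Module A M] [Module.Finite A M] :
    ∃ (n : ℕ) (q : (Fin n → A) →ₗ[A] M), Surjective q ∧
      ∀ v, q v = 0 → ∀ i, v i ∈ maximalIdeal A := by
  let w := Module.finBasis (ResidueField A) (ResidueField A ⊗[A] M)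
  obtain ⟨v, hv⟩ := (TensorProduct.mk_surjective A M (ResidueField A)
    Ideal.Quotient.mk_surjective).comp_left w
  refine ⟨_, Fintype.linearCombination A v, ?_, ?_⟩
  · rw [← LinearMap.range_eq_top, Fintype.range_linearCombination]
    exact span_eq_top_of_tmul_eq_basis _ w (congr_fun hv)
  · intro a ha i
    rw [Fintype.linearCombination_apply] at ha
    have h1 := congrArg (TensorProduct.mk A (ResidueField A) M 1) ha
    rw [map_sum, map_zero] at h1
    have h2 : ∑ i, residue A (a i) • w i = 0 := by
      rw [← h1]
      refine Finset.sum_congr rfl fun j _ ↦ ?_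
      rw [map_smul, ← congr_fun hv j, ← algebraMap_smul (ResidueField A) (a j)]
      rfl
    exact Ideal.Quotient.eq_zero_iff_mem.1 (Fintype.linearIndependent_iff.1 w.linearIndependent _ h2 i)

lemma coord_mem_of_mem_smul_top {ι : Type*} {I : Ideal A} {v : ι → A}
    (hv : v ∈ I • (⊤ : Submodule A (ι → A))) (i : ι) : v i ∈ I := by
  have := Submodule.mem_map_of_mem (f := LinearMap.proj (R := A) (φ := fun _ : ι ↦ A) i) hv
  rw [Submodule.map_smul''] at this
  have h2 := Submodule.smul_mono (le_refl I) (le_top (a := Submodule.map _ _)) this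
  simpa using h2

lemma ker_le_of_torSuccZero_one [IsNoetherianRing A] [IsLocalRing A] {x : A}
    (hx2 : x ∉ maximalIdeal A ^ 2)
    {M : Type u} [AddCommGroup M] [Module A M] (hM : ∀ m : M, x • m = 0)
    (h : TorSuccZero A 1 (A ⧸ maximalIdeal A) M) {n : ℕ} {q : (Fin n → A) →ₗ[A] M}
    (hq : Surjective q) (hmin : ∀ v, q v = 0 → ∀ i, v i ∈ maximalIdeal A) (v : Fin n → A)
    (hv : q v = 0) : ∃ w, v = x • w := by
  have hfree : Module.Free A (LinearMap.ker q) :=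
    free_of_torOneZero ((torSuccZero_succ_iff hq 0).1 h)
  let φ : (Fin n → A) →ₗ[A] LinearMap.ker q :=
    (LinearMap.lsmul A _ x).codRestrict _ fun v ↦ by simp [hM]
  have hφ : Injective (φ.lTensor (A ⧸ maximalIdeal A)) := by
    rw [injective_iff_map_eq_zero]
    intro z hz
    obtain ⟨w, rfl⟩ := exists_quotient_one_tmul _ z
    rw [LinearMap.lTensor_tmul, quotient_one_tmul_eq_zero_iff] at hz
    have h2 : x • w ∈ (maximalIdeal A ^ 2) • (⊤ : Submodule A (Fin n → A)) := by
      have := Submodule.mem_map_of_mem (f := (LinearMap.ker q).subtype) hz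
      rw [Submodule.map_smul''] at this
      rw [pow_two, Submodule.mul_smul]
      refine Submodule.smul_mono le_rfl ?_ this
      rintro _ ⟨y, _, rfl⟩
      rw [Submodule.subtype_apply, pi_eq_sum_univ (y : Fin n → A)]
      exact Submodule.sum_mem _ fun i _ ↦ Submodule.smul_mem_smul (hmin _ y.2 i) trivial
    rw [quotient_one_tmul_eq_zero_iff, pi_eq_sum_univ w]
    refine Submodule.sum_mem _ fun i _ ↦ Submodule.smul_mem_smul ?_ trivial
    by_contra hi
    have hu : IsUnit (w i) := by simpa using hi
    have h3 := coord_mem_of_mem_smul_top h2 i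
    rw [Pi.smul_apply, smul_eq_mul, mul_comm] at h3
    exact hx2 ((Ideal.unit_mul_mem_iff_mem _ hu).1 h3)
  obtain ⟨g, hg⟩ := (IsLocalRing.split_injective_iff_lTensor_residueField_injective φ).2 hφ
  have hinj : ∀ c : LinearMap.ker q, g c = 0 → c = 0 := by
    intro c hc
    have h1 : φ (c : Fin n → A) = x • c := rfl
    have h2 := LinearMap.congr_fun hg (c : Fin n → A)
    rw [LinearMap.comp_apply, h1, map_smul, hc, smul_zero] at h2
    exact Subtype.ext h2.symm
  let c : LinearMap.ker q := ⟨v, hv⟩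
  have h3 : c - φ (g c) = 0 := hinj _ (by
    rw [map_sub, ← LinearMap.comp_apply (f := g) (g := φ), hg, LinearMap.id_apply, sub_self])
  exact ⟨g c, congrArg Subtype.val (sub_eq_zero.1 h3)⟩

lemma free_quotient_of_torSuccZero_one [IsNoetherianRing A] [IsLocalRing A] {x : A}
    (hx2 : x ∉ maximalIdeal A ^ 2)
    {M : Type u} [AddCommGroup M] [Module A M] [Module (A ⧸ Ideal.span {x}) M]
    [IsScalarTower A (A ⧸ Ideal.span {x}) M] [Module.Finite A M]
    (h : TorSuccZero A 1 (A ⧸ maximalIdeal A) M) : Module.Free (A ⧸ Ideal.span {x}) M := by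
  obtain ⟨n, q, hq, hmin⟩ := exists_minimal_cover (A := A) M
  have hM : ∀ m : M, x • m = 0 := by
    intro m
    rw [← algebraMap_smul (A ⧸ Ideal.span {x}) x m]
    have : algebraMap A (A ⧸ Ideal.span {x}) x = 0 :=
      Ideal.Quotient.eq_zero_iff_mem.2 (Ideal.mem_span_singleton_self x)
    rw [this, zero_smul]
  let e : Fin n → M := fun i ↦ q (Pi.single i 1)
  have hqe (a : Fin n → A) : q a = ∑ i, Ideal.Quotient.mk (Ideal.span {x}) (a i) • e i := by
    conv_lhs => rw [pi_eq_sum_univ' a, map_sum]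
    refine Finset.sum_congr rfl fun i _ ↦ ?_
    rw [map_smul]
    exact (algebraMap_smul (A ⧸ Ideal.span {x}) (a i) (e i)).symm
  have hli : LinearIndependent (A ⧸ Ideal.span {x}) e := by
    rw [Fintype.linearIndependent_iff]
    intro a ha i
    choose b hb using fun i ↦ Ideal.Quotient.mk_surjective (a i)
    have h0 : q b = 0 := by
      rw [hqe, ← ha]
      simp_rw [hb]
    obtain ⟨w, rfl⟩ := ker_le_of_torSuccZero_one hx2 hM h hq hmin b h0
    rw [← hb i, Ideal.Quotient.eq_zero_iff_mem]
    exact Ideal.mem_span_singleton.2 ⟨w i, rfl⟩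
  refine Module.Free.of_basis (Module.Basis.mk hli ?_)
  rintro m -
  obtain ⟨a, rfl⟩ := hq m
  rw [hqe]
  exact Submodule.sum_mem _ fun i _ ↦ Submodule.smul_mem _ _ (Submodule.subset_span ⟨i, rfl⟩)


lemma torSuccZero_pi_quotient {x : A} (hreg : IsSMulRegular A x) (r n : ℕ) (X : Type u)
    [AddCommGroup X] [Module A X] : TorSuccZero A (n + 1) X (Fin r → A ⧸ Ideal.span {x}) := by
  refine TorSuccZero.of_le (n := 1) (Nat.le_add_left 1 n) (fun X _ _ ↦ ?_) X
  let q : (Fin r → A) →ₗ[A] (Fin r → A ⧸ Ideal.span {x}) :=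
    (Submodule.mkQ (Ideal.span {x})).compLeft (Fin r)
  have hq : Surjective q := fun y ↦ by
    choose b hb using fun i ↦ Ideal.Quotient.mk_surjective (y i)
    exact ⟨b, funext hb⟩
  let φ : (Fin r → A) →ₗ[A] LinearMap.ker q :=
    (LinearMap.lsmul A _ x).codRestrict _ fun v ↦ funext fun i ↦
      Ideal.Quotient.eq_zero_iff_mem.2 (Ideal.mem_span_singleton.2 ⟨v i, rfl⟩)
  have hφ : Bijective φ := by
    constructor
    · intro v w hvw
      have := congrArg Subtype.val hvw
      exact funext fun i ↦ hreg (congrFun this i)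
    · rintro ⟨v, hv⟩
      choose w hw using fun i ↦ Ideal.mem_span_singleton.1
        (Ideal.Quotient.eq_zero_iff_mem.1 (congrFun hv i))
      exact ⟨w, Subtype.ext (funext fun i ↦ (hw i).symm)⟩
  have : Module.Flat A (LinearMap.ker q) :=
    Module.Flat.of_linearEquiv (LinearEquiv.ofBijective φ hφ).symm
  exact (torSuccZero_succ_iff hq 0).2 torOneZero_of_flat_right

/-- Cutting by a regular element outside the square of the maximal ideal lowers the projective
dimension of a module that it annihilates. -/
lemma TorSuccZero.quotient_of_notMem_sq [IsNoetherianRing A] [IsLocalRing A] {x : A}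
    (hx2 : x ∉ maximalIdeal A ^ 2) (hreg : IsSMulRegular A x) (n : ℕ)
    (M : Type u) [AddCommGroup M] [Module A M] [Module (A ⧸ Ideal.span {x}) M]
    [IsScalarTower A (A ⧸ Ideal.span {x}) M] [Module.Finite A M]
    (h : TorSuccZero A (n + 1) (A ⧸ maximalIdeal A) M) (X : Type u) [AddCommGroup X]
    [Module (A ⧸ Ideal.span {x}) X] : TorSuccZero (A ⧸ Ideal.span {x}) n X M := by
  induction n generalizing M with
  | zero =>
    have := free_quotient_of_torSuccZero_one hx2 h
    exact torOneZero_of_flat_right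
  | succ n ih =>
    have : Module.Finite (A ⧸ Ideal.span {x}) M := Module.Finite.of_restrictScalars_finite A _ _
    obtain ⟨r, q, hq⟩ := Module.Finite.exists_fin' (A ⧸ Ideal.span {x}) M
    rw [torSuccZero_succ_iff hq]
    have hfin : Module.Finite A (LinearMap.ker (q.restrictScalars A)) := inferInstance
    refine @ih (LinearMap.ker q) _ _ _ _ hfin ?_
    exact TorSuccZero.of_exact (f := (LinearMap.ker (q.restrictScalars A)).subtype)
      (g := q.restrictScalars A) (Submodule.injective_subtype _) (exact_subtype_ker _) hq h
      (torSuccZero_pi_quotient hreg r n _)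

end Nagata

/- ## Embedding dimension -/

section EmbDim

variable {A : Type u} [CommRing A] [IsNoetherianRing A] [IsLocalRing A]

lemma embDim_le_iff {n : ℕ} :
    embDim A ≤ n ↔ ∃ s : Finset A, s.card ≤ n ∧ Ideal.span (s : Set A) = maximalIdeal A := by
  have hfg : (maximalIdeal A).FG := (isNoetherianRing_iff_ideal_fg A).1 inferInstance _
  rw [embDim, ← spanFinrank_maximalIdeal_eq_finrank_cotangentSpace]
  constructor
  · intro h
    have hfin := Submodule.FG.finite_generators hfg
    refine ⟨hfin.toFinset, ?_, ?_⟩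
    · rw [← Set.ncard_eq_toFinset_card _ hfin, Submodule.FG.generators_ncard hfg]
      exact h
    · rw [Set.Finite.coe_toFinset]
      exact Submodule.span_generators _
  · rintro ⟨s, hs, h⟩
    rw [← h]
    refine (Submodule.spanFinrank_span_le_ncard_of_finite s.finite_toSet).trans ?_
    rwa [Set.ncard_coe_finset]

lemma exists_span_eq_maximalIdeal (A : Type u) [CommRing A] [IsNoetherianRing A] [IsLocalRing A] :
    ∃ s : Finset A, s.card = embDim A ∧ Ideal.span (s : Set A) = maximalIdeal A := by
  obtain ⟨s, hs, h⟩ := embDim_le_iff.1 (le_refl (embDim A))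
  exact ⟨s, le_antisymm hs (embDim_le_iff.2 ⟨s, le_rfl, h⟩), h⟩

lemma eq_maximalIdeal_of_le_sup_sq {J : Ideal A} (hJ : J ≤ maximalIdeal A)
    (h : maximalIdeal A ≤ J ⊔ maximalIdeal A ^ 2) : J = maximalIdeal A := by
  refine le_antisymm hJ ?_
  refine Submodule.le_of_le_smul_of_le_jacobson_bot (I := maximalIdeal A)
    ((isNoetherianRing_iff_ideal_fg A).1 inferInstance _) (maximalIdeal_le_jacobson ⊥) ?_
  rwa [smul_eq_mul, ← pow_two]

lemma maximalIdeal_map_mk {A : Type*} [CommRing A] [IsLocalRing A] {I : Ideal A} [IsLocalRing (A ⧸ I)] :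
    (maximalIdeal A).map (Ideal.Quotient.mk I) = maximalIdeal (A ⧸ I) :=
  map_maximalIdeal_of_surjective _ Ideal.Quotient.mk_surjective

lemma exists_finset_lift {I : Ideal A} [IsLocalRing (A ⧸ I)] : ∃ s : Finset A,
    s.card ≤ embDim (A ⧸ I) ∧ Ideal.span (s : Set A) ⊔ I = maximalIdeal A := by
  classical
  obtain ⟨t, ht, h⟩ := exists_span_eq_maximalIdeal (A ⧸ I)
  have hI : I ≤ maximalIdeal A := le_maximalIdeal (by
    rintro rfl
    exact not_subsingleton (A ⧸ (⊤ : Ideal A)) (Ideal.Quotient.subsingleton_iff.2 rfl))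
  choose g hg using Ideal.Quotient.mk_surjective (I := I)
  refine ⟨t.image g, Finset.card_image_le.trans_eq ht, ?_⟩
  have h3 : (Ideal.span (t.image g : Set A)).map (Ideal.Quotient.mk I) =
      (maximalIdeal A).map (Ideal.Quotient.mk I) := by
    rw [maximalIdeal_map_mk, ← h, Ideal.map_span]
    congr 1
    ext y
    simp [hg]
  have := congrArg (Ideal.comap (Ideal.Quotient.mk I)) h3
  rwa [Ideal.comap_map_of_surjective _ Ideal.Quotient.mk_surjective,
    Ideal.comap_map_of_surjective _ Ideal.Quotient.mk_surjective, ← RingHom.ker_eq_comap_bot,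
    Ideal.mk_ker, sup_eq_left.2 hI] at this

lemma embDim_le_of_le_sq {I : Ideal A} [IsLocalRing (A ⧸ I)] (hI : I ≤ maximalIdeal A ^ 2) :
    embDim A ≤ embDim (A ⧸ I) := by
  obtain ⟨s, hs, h⟩ := exists_finset_lift (I := I)
  refine embDim_le_iff.2 ⟨s, hs, eq_maximalIdeal_of_le_sup_sq ?_ ?_⟩
  · rw [← h]; exact le_sup_left
  · rw [← h]; exact sup_le_sup le_rfl (by rwa [h])

lemma embDim_le_succ {x : A} [IsLocalRing (A ⧸ Ideal.span {x})] :
    embDim A ≤ embDim (A ⧸ Ideal.span {x}) + 1 := by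
  classical
  obtain ⟨s, hs, h⟩ := exists_finset_lift (I := Ideal.span {x})
  refine embDim_le_iff.2 ⟨insert x s, (Finset.card_insert_le x s).trans (by omega), ?_⟩
  rw [Finset.coe_insert, Ideal.span_insert, sup_comm, h]

lemma succ_embDim_le {x : A} [IsLocalRing (A ⧸ Ideal.span {x})]
    (hx : x ∈ maximalIdeal A) (hx2 : x ∉ maximalIdeal A ^ 2) :
    embDim (A ⧸ Ideal.span {x}) + 1 ≤ embDim A := by
  classical
  obtain ⟨s, hs, h⟩ := exists_span_eq_maximalIdeal A
  rw [← h] at hx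
  obtain ⟨a, ha⟩ := Submodule.mem_span_finset'.1 hx
  have : ∃ i : s, IsUnit (a i) := by
    by_contra! hu
    apply hx2
    rw [← ha, pow_two]
    refine Ideal.sum_mem _ fun i _ ↦ Ideal.mul_mem_mul (hu i) ?_
    rw [← h]
    exact Ideal.subset_span i.2
  obtain ⟨⟨i, hi⟩, u, hu⟩ := this
  have hle : embDim (A ⧸ Ideal.span {x}) ≤ (s.erase i).card := by
    refine embDim_le_iff.2 ⟨(s.erase i).image (Ideal.Quotient.mk (Ideal.span {x})),
      Finset.card_image_le, ?_⟩
    rw [Finset.coe_image, ← Ideal.map_span, ← maximalIdeal_map_mk]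
    refine le_antisymm (Ideal.map_mono ?_) ?_
    · rw [← h]
      exact Ideal.span_mono (by simp)
    · rw [← h, Ideal.map_le_iff_le_comap, Ideal.span_le]
      intro y hy
      by_cases hyi : y = i
      · subst hyi
        rw [SetLike.mem_coe, Ideal.comap_map_of_surjective _ Ideal.Quotient.mk_surjective,
          ← RingHom.ker_eq_comap_bot, Ideal.mk_ker]
        have hsplit := Finset.add_sum_erase Finset.univ (fun j : s ↦ a j • (j : A))
          (Finset.mem_univ ⟨y, hi⟩)
        rw [ha] at hsplit
        have hy1 : y = (↑u⁻¹ : A) * (x - ∑ j ∈ Finset.univ.erase (⟨y, hi⟩ : s), a j • (j : A)) := by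
          rw [← hsplit, ← hu, add_sub_cancel_right, smul_eq_mul, Units.inv_mul_cancel_left]
        refine (congrArg (· ∈ _) hy1).mpr ?_
        refine Ideal.mul_mem_left _ _ (Ideal.sub_mem _ (Ideal.mem_sup_right
          (Ideal.mem_span_singleton_self x)) (Ideal.mem_sup_left (Ideal.sum_mem _ fun j hj ↦ ?_)))
        refine Ideal.mul_mem_left _ _ (Ideal.subset_span ?_)
        rw [Finset.coe_erase]
        refine ⟨j.2, fun h ↦ (Finset.mem_erase.1 hj).1 (Subtype.ext h)⟩
      · exact Ideal.mem_map_of_mem _ (Ideal.subset_span (by simp [hy, hyi]))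
  have hc := Finset.card_erase_add_one hi
  omega

end EmbDim

section NonZeroDivisor

open TensorProduct Function

lemma free_and_finrank_of_exact {A : Type u} [CommRing A] [IsLocalRing A] {s : A} (hs : s ≠ 0)
    (hsm : ∀ a ∈ maximalIdeal A, s * a = 0) {Z F M : Type u} [AddCommGroup Z] [Module A Z]
    [AddCommGroup F] [Module A F] [AddCommGroup M] [Module A M] [Module.Free A Z]
    [Module.Finite A Z] [Module.Free A F] [Module.Finite A F] {i : Z →ₗ[A] F} {p : F →ₗ[A] M}
    (hi : Injective i) (hip : Exact i p) (hp : Surjective p) :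
    Module.Free A M ∧ Module.finrank A F = Module.finrank A Z + Module.finrank A M := by
  have hinj : Injective (i.lTensor (A ⧸ maximalIdeal A)) := by
    rw [injective_iff_map_eq_zero]
    intro z hz
    obtain ⟨z, rfl⟩ := exists_quotient_one_tmul _ z
    rw [LinearMap.lTensor_tmul, quotient_one_tmul_eq_zero_iff] at hz
    have h1 : s • z = 0 := by
      apply hi
      rw [map_smul, map_zero]
      have h2 := Submodule.smul_mem_smul (Ideal.mem_span_singleton_self s) hz
      rw [← Submodule.mul_smul] at h2
      have h3 : Ideal.span {s} * maximalIdeal A = ⊥ := by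
        rw [eq_bot_iff, Ideal.span_singleton_mul_le_iff]
        exact fun a ha ↦ (hsm a ha)
      rw [h3, Submodule.bot_smul] at h2
      exact h2
    rw [quotient_one_tmul_eq_zero_iff]
    let b := Module.Free.chooseBasis A Z
    rw [← b.sum_repr z]
    refine Submodule.sum_mem _ fun j _ ↦ Submodule.smul_mem_smul ?_ trivial
    intro hu
    have h4 : s * b.repr z j = 0 := by
      have := congrArg (fun y ↦ b.repr y j) h1
      simpa using this
    exact hs (hu.mul_left_eq_zero.1 h4)
  have hfree : Module.Free A M := Module.free_of_lTensor_residueField_injective i p hp hip hinj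
  have hfin : Module.Finite A M := Module.Finite.of_surjective p hp
  obtain ⟨l, hl⟩ := LinearMap.exists_rightInverse_of_surjective p (LinearMap.range_eq_top.2 hp)
  have e := (hip.splitSurjectiveEquiv hi ⟨l, hl⟩).1
  exact ⟨hfree, by rw [e.finrank_eq, Module.finrank_prod]⟩

variable {A : Type u} [CommRing A] [IsNoetherianRing A]

lemma exists_socle_of_mem_associatedPrimes {P : Ideal A} [P.IsPrime]
    (hP : P ∈ associatedPrimes A A) : ∃ s : Localization.AtPrime P, s ≠ 0 ∧
      ∀ a ∈ maximalIdeal (Localization.AtPrime P), s * a = 0 := by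
  obtain ⟨-, s, hs⟩ := isAssociatedPrime_iff.1 hP
  refine ⟨algebraMap A _ s, fun h ↦ ?_, fun a ha ↦ ?_⟩
  · obtain ⟨⟨m, hm⟩, hms⟩ := (IsLocalization.map_eq_zero_iff P.primeCompl _ s).1 h
    exact hm (hs ▸ by simpa [Submodule.mem_colon_singleton] using hms)
  · rw [← Localization.AtPrime.map_eq_maximalIdeal] at ha
    refine Submodule.span_induction ?_ (mul_zero _) ?_ ?_ ha
    · rintro _ ⟨b, hb, rfl⟩
      rw [SetLike.mem_coe, hs, Submodule.mem_colon_singleton, Submodule.mem_bot, smul_eq_mul] at hb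
      rw [← map_mul, mul_comm, hb, map_zero]
    · intro x y _ _ hx hy
      rw [mul_add, hx, hy, add_zero]
    · intro c x _ hx
      rw [smul_eq_mul, mul_left_comm, hx, mul_zero]

variable [IsLocalRing A]

lemma exists_finrank_localization (n : ℕ) (M : Type u) [AddCommGroup M] [Module A M]
    [Module.Finite A M] (h : TorSuccZero A n (A ⧸ maximalIdeal A) M) :
    ∃ r : ℕ, ∀ (P : Ideal A) [P.IsPrime], P ∈ associatedPrimes A A →
      Module.Free (Localization.AtPrime P) (Localization.AtPrime P ⊗[A] M) ∧
      Module.finrank (Localization.AtPrime P) (Localization.AtPrime P ⊗[A] M) = r := by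
  induction n generalizing M with
  | zero =>
    have : Module.Free A M := free_of_torOneZero h
    exact ⟨Module.finrank A M, fun P _ _ ↦ ⟨inferInstance, Module.finrank_baseChange⟩⟩
  | succ n ih =>
    obtain ⟨k, q, hq⟩ := Module.Finite.exists_fin' A M
    obtain ⟨r, hr⟩ := ih (LinearMap.ker q) ((torSuccZero_succ_iff hq n).1 h)
    refine ⟨k - r, fun P _ hP ↦ ?_⟩
    obtain ⟨hfree, hrank⟩ := hr P hP
    obtain ⟨s, hs, hsm⟩ := exists_socle_of_mem_associatedPrimes hP
    have hex := lTensor_exact (Localization.AtPrime P) (exact_subtype_ker q) hq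
    have hinj := Module.Flat.lTensor_preserves_injective_linearMap
      (M := Localization.AtPrime P) _ (Submodule.injective_subtype (LinearMap.ker q))
    have hsurj := LinearMap.lTensor_surjective (Localization.AtPrime P) hq
    obtain ⟨h1, h2⟩ := free_and_finrank_of_exact hs hsm
      (i := (LinearMap.ker q).subtype.baseChange (Localization.AtPrime P))
      (p := q.baseChange (Localization.AtPrime P)) hinj hex hsurj
    refine ⟨h1, ?_⟩
    rw [hrank, Module.finrank_baseChange, Module.finrank_fin_fun] at h2
    omega

lemma eq_bot_of_le_associatedPrime {n : ℕ} {I : Ideal A}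
    (h : TorSuccZero A n (A ⧸ maximalIdeal A) (A ⧸ I)) {P : Ideal A}
    (hP : P ∈ associatedPrimes A A) (hIP : I ≤ P) : I = ⊥ := by
  obtain ⟨r, hr⟩ := exists_finrank_localization n (A ⧸ I) h
  have hr0 : r ≠ 0 := by
    have := hP.1
    obtain ⟨h1, h2⟩ := hr P hP
    rintro rfl
    have := (Module.finrank_eq_zero_iff_of_free _ _).1 h2
    let φ : A ⧸ I →ₐ[A] P.ResidueField := Ideal.Quotient.liftₐ I (Algebra.ofId _ _) fun a ha ↦ by
      exact (Ideal.algebraMap_residueField_eq_zero).2 (hIP ha)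
    let ψ : Localization.AtPrime P ⊗[A] (A ⧸ I) →ₐ[A] P.ResidueField :=
      Algebra.TensorProduct.lift (IsScalarTower.toAlgHom A _ _) φ fun _ _ ↦ mul_comm _ _
    have h3 := congrArg ψ (Subsingleton.elim (1 : Localization.AtPrime P ⊗[A] (A ⧸ I)) 0)
    rw [map_one, map_zero] at h3
    exact one_ne_zero h3
  rw [eq_bot_iff]
  intro x hx
  by_contra hx0
  obtain ⟨P', hP', hle⟩ := exists_le_isAssociatedPrime_of_isNoetherianRing A x hx0
  have := hP'.1
  obtain ⟨h1, h2⟩ := hr P' hP'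
  have : Nontrivial (Localization.AtPrime P' ⊗[A] (A ⧸ I)) := by
    by_contra hn
    rw [not_nontrivial_iff_subsingleton] at hn
    exact hr0 (h2.symm.trans (Module.finrank_zero_of_subsingleton))
  have h3 : algebraMap A (Localization.AtPrime P') x = 0 := by
    apply FaithfulSMul.algebraMap_injective (Localization.AtPrime P')
      (Localization.AtPrime P' ⊗[A] (A ⧸ I))
    rw [map_zero, ← IsScalarTower.algebraMap_apply]
    have : algebraMap A (A ⧸ I) x = 0 := Ideal.Quotient.eq_zero_iff_mem.2 hx
    rw [Algebra.TensorProduct.algebraMap_apply, Algebra.algebraMap_eq_smul_one, TensorProduct.smul_tmul, ← Algebra.algebraMap_eq_smul_one,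
      this, TensorProduct.tmul_zero]
  obtain ⟨⟨m, hm⟩, hmx⟩ := (IsLocalization.map_eq_zero_iff P'.primeCompl _ x).1 h3
  exact hm (hle (by simpa [Submodule.mem_colon_singleton] using hmx))

end NonZeroDivisor

section RegularKernel

open TensorProduct Function RingTheory.Sequence

lemma exists_regular_mem_notMem_sq {A : Type u} [CommRing A] [IsNoetherianRing A] [IsLocalRing A]
    {n : ℕ} {I : Ideal A} (h : TorSuccZero A n (A ⧸ maximalIdeal A) (A ⧸ I))
    (hI : ¬ I ≤ maximalIdeal A ^ 2) :
    ∃ x ∈ I, x ∉ maximalIdeal A ^ 2 ∧ IsSMulRegular A x := by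
  classical
  by_contra! hcon
  let s : Finset (Ideal A) := insert (maximalIdeal A ^ 2) (associatedPrimes.finite A A).toFinset
  have hsub : (I : Set A) ⊆ ⋃ J ∈ (s : Set (Ideal A)), (J : Set A) := by
    intro x hx
    by_cases hx2 : x ∈ maximalIdeal A ^ 2
    · exact Set.mem_biUnion (x := maximalIdeal A ^ 2) (by simp [s]) hx2
    · have h1 : x ∈ (nonZeroDivisors A : Set A)ᶜ := by
        intro h2
        exact hcon x hx hx2 (isSMulRegular_iff_right_eq_zero_of_smul.2 fun y hy ↦
          (mem_nonZeroDivisors_iff_right.1 h2) y (by rwa [mul_comm]))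
      rw [← biUnion_associatedPrimes_eq_compl_nonZeroDivisors] at h1
      obtain ⟨P, hP, hxP⟩ := Set.mem_iUnion₂.1 h1
      exact Set.mem_biUnion (x := P) (by simp [s, hP]) hxP
  obtain ⟨J, hJ, hIJ⟩ := (Ideal.subset_union_prime (f := fun J : Ideal A ↦ J) (maximalIdeal A ^ 2)
    (maximalIdeal A ^ 2) (fun J hJ h1 _ ↦ by
      have : J ∈ associatedPrimes A A := by simpa [s, h1] using hJ
      exact this.1)).1 hsub
  rcases Finset.mem_insert.1 hJ with rfl | hJ
  · exact hI hIJ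
  · have := eq_bot_of_le_associatedPrime h (by simpa using hJ) hIJ
    exact hI (this ▸ bot_le)

lemma embDim_le_of_surjective {A B : Type u} [CommRing A] [IsNoetherianRing A] [IsLocalRing A]
    [CommRing B] [IsNoetherianRing B] [IsLocalRing B] (f : A →+* B) (hf : Surjective f) :
    embDim B ≤ embDim A := by
  classical
  obtain ⟨s, hs, h⟩ := exists_span_eq_maximalIdeal A
  refine embDim_le_iff.2 ⟨s.image f, Finset.card_image_le.trans_eq hs, ?_⟩
  rw [Finset.coe_image, ← Ideal.map_span, h, map_maximalIdeal_of_surjective f hf]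

/-- The quotient `A / xA` as a module and as a ring. -/
noncomputable def quotSMulTopEquiv {A : Type*} [CommRing A] (x : A) :
    QuotSMulTop x A ≃ₗ[A] A ⧸ Ideal.span {x} :=
  Submodule.quotEquivOfEq _ _ (by
    ext y
    rw [Submodule.mem_smul_pointwise_iff_exists, Ideal.mem_span_singleton]
    simp [Dvd.dvd, eq_comm])

lemma torSuccZero_of_quotient_ringEquiv {A : Type u} [CommRing A] [IsNoetherianRing A]
    [IsLocalRing A] {x : A} (hx2 : x ∉ maximalIdeal A ^ 2) (hreg : IsSMulRegular A x) (n : ℕ)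
    {I : Ideal A} (h : TorSuccZero A (n + 1) (A ⧸ maximalIdeal A) (A ⧸ I))
    (B : Type u) [CommRing B] [Algebra (A ⧸ Ideal.span {x}) B] (e : (A ⧸ I) ≃+* B)
    (he : ∀ a, e (Ideal.Quotient.mk I a) =
      algebraMap (A ⧸ Ideal.span {x}) B (Ideal.Quotient.mk (Ideal.span {x}) a))
    (X : Type u) [AddCommGroup X] [Module (A ⧸ Ideal.span {x}) X] :
    TorSuccZero (A ⧸ Ideal.span {x}) n X B := by
  algebraize [(algebraMap (A ⧸ Ideal.span {x}) B).comp (Ideal.Quotient.mk (Ideal.span {x}))]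
  have : IsScalarTower A (A ⧸ Ideal.span {x}) B := IsScalarTower.of_algebraMap_eq fun _ ↦ rfl
  let e : (A ⧸ I) ≃ₐ[A] B := AlgEquiv.ofRingEquiv (f := e) he
  have : Module.Finite A B := Module.Finite.equiv e.toLinearEquiv
  exact TorSuccZero.quotient_of_notMem_sq hx2 hreg n B (h.of_linearEquiv e.toLinearEquiv) X

/-- A quotient `A / I` of projective dimension at most `c ≤ edim A - edim (A / I)` is cut out by a
regular sequence of length `c`. -/
theorem exists_isRegular_of_torSuccZero (c : ℕ) {A : Type u} [CommRing A] [IsNoetherianRing A]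
    [IsLocalRing A] (I : Ideal A) [IsLocalRing (A ⧸ I)]
    (h : TorSuccZero A c (A ⧸ maximalIdeal A) (A ⧸ I)) (he : c + embDim (A ⧸ I) ≤ embDim A) :
    ∃ rs : List A, IsRegular A rs ∧ rs.length = c ∧ I = Ideal.ofList rs := by
  induction c generalizing A with
  | zero =>
    refine ⟨[], ?_, rfl, ?_⟩
    · exact IsRegular.nil A A
    · rw [Ideal.ofList_nil]
      have h1 := (torOneZero_quotient_iff (R := A) (Q := A) (q := Submodule.mkQ I)
        (Submodule.mkQ_surjective I)).1 h
      have hI : I ≤ maximalIdeal A := le_maximalIdeal (by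
        rintro rfl
        exact not_subsingleton (A ⧸ (⊤ : Ideal A)) (Ideal.Quotient.subsingleton_iff.2 rfl))
      refine Submodule.eq_bot_of_le_smul_of_le_jacobson_bot (maximalIdeal A) I
        ((isNoetherianRing_iff_ideal_fg A).1 inferInstance _) ?_ (maximalIdeal_le_jacobson ⊥)
      intro x hx
      have h2 := h1 ⟨x, by simpa using hx⟩ (by simpa using hI hx)
      have h3 := Submodule.mem_map_of_mem (f := (LinearMap.ker (Submodule.mkQ I)).subtype) h2
      rw [Submodule.map_smul''] at h3
      refine Submodule.smul_mono le_rfl ?_ h3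
      rw [Submodule.map_top, Submodule.range_subtype, Submodule.ker_mkQ]
  | succ c ih =>
    obtain ⟨x, hxI, hx2, hreg⟩ := exists_regular_mem_notMem_sq h (fun hI ↦ by
      have := embDim_le_of_le_sq hI
      omega)
    have hI : I ≤ maximalIdeal A := le_maximalIdeal (by
      rintro rfl
      exact not_subsingleton (A ⧸ (⊤ : Ideal A)) (Ideal.Quotient.subsingleton_iff.2 rfl))
    have hx := hI hxI
    have hxle : Ideal.span {x} ≤ I := (Ideal.span_singleton_le_iff_mem I).2 hxI
    have : Nontrivial (A ⧸ Ideal.span {x}) := Ideal.Quotient.nontrivial_iff.2 fun h ↦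
      (maximalIdeal.isMaximal A).ne_top (top_le_iff.1 (h ▸ hxle.trans hI))
    have hloc : IsLocalRing (A ⧸ Ideal.span {x}) := .of_surjective' _ Ideal.Quotient.mk_surjective
    let e := DoubleQuot.quotQuotEquivQuotOfLE hxle
    have : IsLocalRing ((A ⧸ Ideal.span {x}) ⧸ I.map (Ideal.Quotient.mk (Ideal.span {x}))) :=
      e.symm.isLocalRing
    have h1 := torSuccZero_of_quotient_ringEquiv hx2 hreg c h
      ((A ⧸ Ideal.span {x}) ⧸ I.map (Ideal.Quotient.mk (Ideal.span {x})))
      e.symm (fun _ ↦ rfl)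
      ((A ⧸ Ideal.span {x}) ⧸ maximalIdeal (A ⧸ Ideal.span {x}))
    have h2 := embDim_le_succ (x := x)
    have h3 := embDim_le_of_surjective e.symm.toRingHom e.symm.surjective
    obtain ⟨rs, hrs, hlen, hI1⟩ := ih (I.map (Ideal.Quotient.mk (Ideal.span {x}))) h1 (by omega)
    obtain ⟨ts, rfl⟩ := List.map_surjective_iff.2
      (Ideal.Quotient.mk_surjective (I := Ideal.span {x})) rs
    have hI2 : I = Ideal.ofList (x :: ts) := by
      rw [← Ideal.map_ofList] at hI1
      have := congrArg (Ideal.comap (Ideal.Quotient.mk (Ideal.span {x}))) hI1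
      rwa [Ideal.comap_map_of_surjective _ Ideal.Quotient.mk_surjective,
        Ideal.comap_map_of_surjective _ Ideal.Quotient.mk_surjective, ← RingHom.ker_eq_comap_bot,
        Ideal.mk_ker, sup_eq_left.2 hxle, sup_comm, ← Ideal.ofList_cons] at this
    refine ⟨x :: ts, ?_, by simpa using hlen, hI2⟩
    rw [IsLocalRing.isRegular_iff_isWeaklyRegular_of_subset_maximalIdeal, isWeaklyRegular_cons_iff]
    · refine ⟨hreg, ?_⟩
      have h4 := (isWeaklyRegular_map_algebraMap_iff (A ⧸ Ideal.span {x}) (A ⧸ Ideal.span {x})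
        ts).1 hrs.toIsWeaklyRegular
      exact ((quotSMulTopEquiv x).isWeaklyRegular_congr ts).2 h4
    · intro r hr
      exact hI (hI2 ▸ Ideal.subset_span hr)

end RegularKernel

/- ## Change of rings along a flat map with regular closed fibre -/

section ChangeOfRings

open TensorProduct Function RingTheory.Sequence

variable {B : Type u} [CommRing B]

lemma TorSuccZero.of_linearEquiv_left {N N' M : Type u} [AddCommGroup N] [Module B N]
    [AddCommGroup N'] [Module B N'] [AddCommGroup M] [Module B M] (e : N ≃ₗ[B] N') {n : ℕ}
    (h : TorSuccZero B n N M) : TorSuccZero B n N' M := by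
  induction n generalizing M with
  | zero => exact TorOneZero.of_linearEquiv e h
  | succ n ih =>
    rw [torSuccZero_succ_iff (freeCover_surjective M)] at h ⊢
    exact ih h

lemma TorOneZero.of_injective_of_cover {X Y L Q M : Type u} [AddCommGroup X] [Module B X]
    [AddCommGroup Y] [Module B Y] [AddCommGroup L] [Module B L] [AddCommGroup Q] [Module B Q]
    [AddCommGroup M] [Module B M] [Module.Flat B Q] {j : L →ₗ[B] Q} {q : Q →ₗ[B] M} (hj : Injective j) (hjq : Exact j q)
    (hq : Surjective q) {f : X →ₗ[B] X} {g : X →ₗ[B] Y} (hf : Injective f) (hfg : Exact f g)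
    (hg : Surjective g) (h : TorOneZero B X M) (h' : TorOneZero B X L) : TorOneZero B Y L := by
  have h1 : Injective (j.lTensor X) := (torOneZero_iff_lTensor hj hjq hq).1 h
  have h2 : Injective ((j.lTensor X) ∘ (f.rTensor L)) := by
    rw [← LinearMap.coe_comp, LinearMap.lTensor_comp_rTensor, ← LinearMap.rTensor_comp_lTensor,
      LinearMap.coe_comp]
    exact (Module.Flat.rTensor_preserves_injective_linearMap f hf).comp h1
  exact TorOneZero.of_rTensor_injective hfg hg h' h2.of_comp

lemma TorSuccZero.of_injective {X Y M : Type u} [AddCommGroup X] [Module B X]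
    [AddCommGroup Y] [Module B Y] [AddCommGroup M] [Module B M] {f : X →ₗ[B] X} {g : X →ₗ[B] Y}
    (hf : Injective f) (hfg : Exact f g) (hg : Surjective g) {n : ℕ}
    (h : TorSuccZero B n X M) (h' : TorSuccZero B (n + 1) X M) : TorSuccZero B (n + 1) Y M := by
  induction n generalizing M with
  | zero =>
    rw [torSuccZero_succ_iff (freeCover_surjective M)] at h' ⊢
    exact TorOneZero.of_injective_of_cover (Submodule.injective_subtype _) (exact_subtype_ker _)
      (freeCover_surjective M) hf hfg hg h h'
  | succ n ih =>
    rw [torSuccZero_succ_iff (freeCover_surjective M)] at h h' ⊢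
    exact ih h h'

lemma TorSuccZero.quotient_ofList {M : Type u} [AddCommGroup M] [Module B M] (ys : List B)
    {X : Type u} [AddCommGroup X] [Module B X] {n : ℕ} (h : ∀ j ≥ n, TorSuccZero B j X M)
    (hX : IsWeaklyRegular X ys) :
    ∀ j ≥ n + ys.length, TorSuccZero B j (X ⧸ (Ideal.ofList ys • ⊤ : Submodule B X)) M := by
  induction ys generalizing X n with
  | nil =>
    intro j hj
    have e : (X ⧸ (Ideal.ofList ([] : List B) • ⊤ : Submodule B X)) ≃ₗ[B] X :=
      Submodule.quotEquivOfEqBot _ (by rw [Ideal.ofList_nil, Submodule.bot_smul])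
    exact TorSuccZero.of_linearEquiv_left e.symm (h j (by simpa using hj))
  | cons y ys ih =>
    intro j hj
    rw [isWeaklyRegular_cons_iff] at hX
    refine (ih (X := QuotSMulTop y X) (n := n + 1) (fun j hj ↦ ?_) hX.2 j
      (by simp at hj; omega)).of_linearEquiv_left
      (Submodule.quotOfListConsSMulTopEquivQuotSMulTopInner X y ys).symm
    obtain ⟨j, rfl⟩ : ∃ i, j = i + 1 := ⟨j - 1, by omega⟩
    refine TorSuccZero.of_injective (f := LinearMap.lsmul B X y) (g := Submodule.mkQ _) hX.1
      ?_ (Submodule.mkQ_surjective _) (h j (by omega)) (h (j + 1) (by omega))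
    rw [LinearMap.exact_iff, Submodule.ker_mkQ]
    ext z
    simp [Submodule.mem_smul_pointwise_iff_exists]

section

variable {A : Type u} [CommRing A] [Algebra A B] [Module.Flat A B]
  {I : Ideal A} {n : ℕ} {M Q : Type u} [AddCommGroup M] [Module A M] [Module B M]
  [IsScalarTower A B M]

lemma TorOneZero.baseChange_of_cover [AddCommGroup Q] [Module A Q] [Module B Q]
    [IsScalarTower A B Q] [Module.Flat B Q] {q : Q →ₗ[B] M} (hq : Surjective q)
    (h : TorOneZero A (A ⧸ I) M) : TorOneZero B (B ⧸ I.map (algebraMap A B)) M := by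
  have : Module.Flat A Q := Module.Flat.trans A B Q
  rw [torOneZero_quotient_iff (q := q.restrictScalars A) hq] at h
  rw [torOneZero_quotient_iff hq]
  intro x hx
  have h1 := Ideal.smul_restrictScalars I (⊤ : Submodule B Q)
  have h2 := Ideal.smul_restrictScalars I (⊤ : Submodule B (LinearMap.ker q))
  have h3 : (x : Q) ∈ I • (⊤ : Submodule B Q).restrictScalars A := by
    rw [← h1]; exact hx
  have h4 := h x h3
  change x ∈ (I.map (algebraMap A B) • (⊤ : Submodule B (LinearMap.ker q))).restrictScalars A
  rw [h2]
  exact h4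

lemma TorSuccZero.baseChange (h : TorSuccZero A n (A ⧸ I) M) :
    TorSuccZero B n (B ⧸ I.map (algebraMap A B)) M := by
  induction n generalizing M with
  | zero => exact TorOneZero.baseChange_of_cover (freeCover_surjective M) h
  | succ n ih =>
    obtain ⟨Q, _, _, _, _, _, q, hq⟩ : ∃ (Q : Type u) (_ : AddCommGroup Q) (_ : Module A Q)
        (_ : Module B Q) (_ : IsScalarTower A B Q) (_ : Module.Flat B Q) (q : Q →ₗ[B] M),
        Surjective q :=
      ⟨M →₀ B, inferInstance, inferInstance, inferInstance, inferInstance, inferInstance,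
        freeCover B M, freeCover_surjective M⟩
    rw [torSuccZero_succ_iff hq]
    have : Module.Flat A Q := Module.Flat.trans A B _
    have h1 := (torSuccZero_succ_iff (q := q.restrictScalars A) hq n).1 h
    refine @ih (LinearMap.ker q) _ (LinearMap.ker (q.restrictScalars A)).module _ ?_ h1
    exact @IsScalarTower.mk _ _ _ _ _ _ fun a b x ↦ Subtype.ext (smul_assoc a b (x : Q))

end

/-- If `A → B` is flat, the list `ys` is regular on the closed fibre and generates its maximal
ideal, then vanishing of `Tor` over `A` against the residue field passes to `B` with a shift. -/
lemma TorSuccZero.of_regular_fibre {A : Type u} [CommRing A] [IsLocalRing A] [IsLocalRing B]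
    [Algebra A B] [Module.Flat A B] {n : ℕ} {M : Type u} [AddCommGroup M] [Module A M]
    [Module B M] [IsScalarTower A B M] (h : ∀ j ≥ n, TorSuccZero A j (A ⧸ maximalIdeal A) M)
    {ys : List B} (hys : IsWeaklyRegular (B ⧸ (maximalIdeal A).map (algebraMap A B)) ys)
    (hm : (maximalIdeal A).map (algebraMap A B) ⊔ Ideal.ofList ys = maximalIdeal B) :
    TorSuccZero B (n + ys.length) (B ⧸ maximalIdeal B) M := by
  have h1 := TorSuccZero.quotient_ofList ys (fun j hj ↦ (h j hj).baseChange (B := B)) hys _ le_rfl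
  refine h1.of_linearEquiv_left ?_
  set J := (maximalIdeal A).map (algebraMap A B)
  have h2 : (Ideal.ofList ys • ⊤ : Submodule B (B ⧸ J)) = Submodule.map J.mkQ (maximalIdeal B) := by
    rw [← hm, Submodule.map_sup, Submodule.mkQ_map_self, bot_sup_eq, ← Submodule.range_mkQ J,
      ← Submodule.map_top, ← Submodule.map_smul'', smul_eq_mul, Ideal.mul_top]
  exact Submodule.quotEquivOfEq _ _ h2 ≪≫ₗ
    Submodule.quotientQuotientEquivQuotient J _ (hm ▸ le_sup_left)

end ChangeOfRings

/- ## Regular sequences modulo an ideal; dimension and embedding dimension of flat extensions -/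

section Numerics

open Function RingTheory.Sequence
open scoped Pointwise

/-- The list is a weakly regular sequence on the quotient of `B` by the ideal. -/
def IsRegularMod {B : Type*} [CommRing B] : List B → Ideal B → Prop
  | [], _ => True
  | y :: ys, J => (∀ b, y * b ∈ J → b ∈ J) ∧ IsRegularMod ys (J ⊔ Ideal.span {y})

lemma smul_top_quotient {B : Type*} [CommRing B] (y : B) (J : Ideal B) :
    y • (⊤ : Submodule B (B ⧸ J)) = Submodule.map J.mkQ (J ⊔ Ideal.span {y}) := by
  rw [Submodule.map_sup, Submodule.mkQ_map_self, bot_sup_eq, ← Submodule.range_mkQ J,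
    ← Submodule.map_top, ← Submodule.map_pointwise_smul]
  congr 1
  ext z
  rw [Submodule.mem_smul_pointwise_iff_exists, Ideal.mem_span_singleton]
  simp [Dvd.dvd, eq_comm]

/-- `(B / J) / y = B / (J + y)`. -/
noncomputable def quotSMulTopQuotientEquiv {B : Type*} [CommRing B] (y : B) (J : Ideal B) :
    QuotSMulTop y (B ⧸ J) ≃ₗ[B] B ⧸ (J ⊔ Ideal.span {y}) :=
  Submodule.quotEquivOfEq _ _ (smul_top_quotient y J) ≪≫ₗ
    Submodule.quotientQuotientEquivQuotient J _ le_sup_left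

lemma isWeaklyRegular_quotient_iff {B : Type*} [CommRing B] (ys : List B) (J : Ideal B) :
    IsWeaklyRegular (B ⧸ J) ys ↔ IsRegularMod ys J := by
  induction ys generalizing J with
  | nil => simp [IsRegularMod]
  | cons y ys ih =>
    rw [isWeaklyRegular_cons_iff, (quotSMulTopQuotientEquiv y J).isWeaklyRegular_congr, ih,
      IsRegularMod, isSMulRegular_iff_right_eq_zero_of_smul]
    refine and_congr_left fun _ ↦ ⟨fun h b hb ↦ ?_, fun h b hb ↦ ?_⟩
    · exact Ideal.Quotient.eq_zero_iff_mem.1 (h (Ideal.Quotient.mk J b)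
        (Ideal.Quotient.eq_zero_iff_mem.2 hb))
    · obtain ⟨b, rfl⟩ := Ideal.Quotient.mk_surjective b
      exact Ideal.Quotient.eq_zero_iff_mem.2 (h b (Ideal.Quotient.eq_zero_iff_mem.1 hb))

lemma isWeaklyRegular_iff_isRegularMod_bot {B : Type*} [CommRing B] (ys : List B) :
    IsWeaklyRegular B ys ↔ IsRegularMod ys (⊥ : Ideal B) := by
  rw [← isWeaklyRegular_quotient_iff,
    (Submodule.quotEquivOfEqBot (⊥ : Ideal B) rfl).isWeaklyRegular_congr]

lemma isRegularMod_comap_iff {B B' : Type*} [CommRing B] [CommRing B'] (π : B →+* B')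
    (hπ : Surjective π) (ys : List B) (J : Ideal B') :
    IsRegularMod ys (J.comap π) ↔ IsRegularMod (ys.map π) J := by
  induction ys generalizing J with
  | nil => simp [IsRegularMod]
  | cons y ys ih =>
    have h : J.comap π ⊔ Ideal.span {y} = (J ⊔ Ideal.span {π y}).comap π := by
      have h1 : J ⊔ Ideal.span {π y} = (J.comap π ⊔ Ideal.span {y}).map π := by
        rw [Ideal.map_sup, Ideal.map_comap_of_surjective π hπ, Ideal.map_span,
          Set.image_singleton]
      rw [h1, Ideal.comap_map_of_surjective π hπ, eq_comm, sup_eq_left]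
      exact (Ideal.comap_mono bot_le).trans le_sup_left
    rw [List.map_cons, IsRegularMod, IsRegularMod, h, ih, hπ.forall]
    simp [Ideal.mem_comap]

lemma ringKrullDim_eq_length {F : Type*} [CommRing F] [IsNoetherianRing F] [IsLocalRing F]
    {zs : List F} (hz : IsWeaklyRegular F zs) (hm : Ideal.ofList zs = maximalIdeal F) :
    ringKrullDim F = zs.length := by
  have h1 : IsRegular F zs :=
    (IsLocalRing.isRegular_iff_isWeaklyRegular_of_subset_maximalIdeal fun r hr ↦
      hm ▸ Ideal.subset_span hr).2 hz
  rw [← ringKrullDim_add_length_eq_ringKrullDim_of_isRegular zs h1, hm]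
  have : ringKrullDim (F ⧸ maximalIdeal F) = 0 :=
    ringKrullDim_eq_zero_of_isField ((Ideal.Quotient.maximal_ideal_iff_isField_quotient _).1
      inferInstance)
  rw [this, zero_add]

lemma ofList_map_mk {B : Type*} [CommRing B] {J K : Ideal B} {ys : List B}
    (h : J ⊔ Ideal.ofList ys = K) :
    Ideal.ofList (ys.map (Ideal.Quotient.mk J)) = K.map (Ideal.Quotient.mk J) := by
  rw [← h, Ideal.map_sup, Ideal.map_quotient_self, bot_sup_eq, Ideal.map_ofList]

lemma comap_mk_bot {B : Type*} [CommRing B] (J : Ideal B) :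
    (⊥ : Ideal (B ⧸ J)).comap (Ideal.Quotient.mk J) = J := by
  rw [← RingHom.ker_eq_comap_bot, Ideal.mk_ker]

lemma ringKrullDim_quotient_eq_length {B : Type*} [CommRing B] [IsNoetherianRing B] [IsLocalRing B]
    {J : Ideal B} {ys : List B} (hys : IsRegularMod ys J)
    (hm : J ⊔ Ideal.ofList ys = maximalIdeal B) : ringKrullDim (B ⧸ J) = ys.length := by
  have hJ : J ≤ maximalIdeal B := hm ▸ le_sup_left
  have : Nontrivial (B ⧸ J) := Ideal.Quotient.nontrivial_iff.2 fun h ↦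
    (maximalIdeal.isMaximal B).ne_top (top_le_iff.1 (h ▸ hJ))
  have : IsLocalRing (B ⧸ J) := .of_surjective' _ Ideal.Quotient.mk_surjective
  rw [← ys.length_map (f := Ideal.Quotient.mk J)]
  refine ringKrullDim_eq_length ?_ ((ofList_map_mk hm).trans maximalIdeal_map_mk)
  rw [isWeaklyRegular_iff_isRegularMod_bot,
    ← isRegularMod_comap_iff _ Ideal.Quotient.mk_surjective, comap_mk_bot]
  exact hys

lemma notMem_sq_of_isRegularMod {B : Type*} [CommRing B] [IsNoetherianRing B] [IsLocalRing B]
    {J : Ideal B} {y : B} {ys : List B} (hys : IsRegularMod (y :: ys) J)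
    (hm : J ⊔ Ideal.ofList (y :: ys) = maximalIdeal B) : y ∉ maximalIdeal B ^ 2 := by
  classical
  intro hy
  have h1 : J ⊔ Ideal.ofList ys = maximalIdeal B := by
    refine eq_maximalIdeal_of_le_sup_sq ?_ ?_
    · rw [← hm, Ideal.ofList_cons]
      exact sup_le_sup le_rfl le_sup_right
    · conv_lhs => rw [← hm]
      rw [Ideal.ofList_cons]
      refine sup_le (le_sup_left.trans le_sup_left) (sup_le ?_ (le_sup_right.trans le_sup_left))
      exact le_sup_of_le_right ((Ideal.span_singleton_le_iff_mem _).2 hy)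
  have h2 := ringKrullDim_quotient_eq_length hys hm
  have hJ : J ≤ maximalIdeal B := hm ▸ le_sup_left
  have : Nontrivial (B ⧸ J) := Ideal.Quotient.nontrivial_iff.2 fun h ↦
    (maximalIdeal.isMaximal B).ne_top (top_le_iff.1 (h ▸ hJ))
  have : IsLocalRing (B ⧸ J) := .of_surjective' _ Ideal.Quotient.mk_surjective
  have h3 := ringKrullDim_le_spanFinrank_maximalIdeal (R := B ⧸ J)
  have h4 := (ofList_map_mk h1).trans maximalIdeal_map_mk
  have h5 : (maximalIdeal (B ⧸ J)).spanFinrank ≤ ys.length := by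
    rw [← h4, ← ys.length_map (f := Ideal.Quotient.mk J)]
    refine (Submodule.spanFinrank_span_le_ncard_of_finite (List.finite_toSet _)).trans ?_
    rw [← List.coe_toFinset, Set.ncard_coe_finset]
    exact List.toFinset_card_le _
  rw [h2] at h3
  have h6 : (y :: ys).length ≤ (maximalIdeal (B ⧸ J)).spanFinrank := by exact_mod_cast h3
  simp at h6
  omega

section Flat

variable {A : Type u} [CommRing A] [IsNoetherianRing A] [IsLocalRing A]

lemma embDim_le_of_map_maximalIdeal {B : Type u} [CommRing B] [IsNoetherianRing B] [IsLocalRing B]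
    [Algebra A B] [IsLocalHom (algebraMap A B)] [Module.Flat A B]
    (h : (maximalIdeal A).map (algebraMap A B) = maximalIdeal B) : embDim A ≤ embDim B := by
  classical
  obtain ⟨s, hs, hspan⟩ := exists_span_eq_maximalIdeal A
  have hsm : ∀ a ∈ s, algebraMap A B a ∈ maximalIdeal B := fun a ha ↦
    h ▸ Ideal.mem_map_of_mem _ (hspan ▸ Ideal.subset_span ha)
  let φ : s → CotangentSpace B := fun a ↦ (maximalIdeal B).toCotangent ⟨_, hsm a a.2⟩
  have key : ∀ t : Set s, Submodule.span (ResidueField B) (φ '' t) = ⊤ ↔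
      Ideal.span ((fun a : s ↦ algebraMap A B a) '' t) = maximalIdeal B := by
    intro t
    have := CotangentSpace.span_image_eq_top_iff (R := B)
      (s := (fun a : s ↦ (⟨_, hsm a a.2⟩ : maximalIdeal B)) '' t)
    rw [Set.image_image] at this
    rw [this]
    rw [← (Submodule.map_injective_of_injective (maximalIdeal B).injective_subtype).eq_iff,
      Submodule.map_span, Submodule.map_top, Submodule.range_subtype, Set.image_image]
    rfl
  have h1 : Submodule.span (ResidueField B) (Set.range φ) = ⊤ := by
    rw [← Set.image_univ, key, ← h, ← hspan, Ideal.map_span]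
    congr 1
    ext; simp
  obtain ⟨b, hb, hbs, hli⟩ := exists_linearIndependent (ResidueField B) (Set.range φ)
  rw [h1] at hbs
  choose g hg using hb
  have hfin : b.Finite := (Set.finite_range φ).subset fun x hx ↦ ⟨g hx, hg hx⟩
  have : Fintype b := hfin.fintype
  let g' : b → s := fun x ↦ g x.2
  have hc : b.toFinset.card = embDim B := by
    rw [← finrank_span_set_eq_card hli, hbs, finrank_top]; rfl
  have h2 : φ '' (Set.range g') = b := by
    rw [← Set.range_comp]
    have : φ ∘ g' = Subtype.val := funext fun x ↦ hg x.2
    rw [this, Subtype.range_coe]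
  have h3 := (key (Set.range g')).1 (by rw [h2, hbs])
  rw [← hc]
  refine embDim_le_iff.2 ⟨Finset.univ.image (fun x ↦ (g' x : A)),
    Finset.card_image_le.trans (by simp), ?_⟩
  have : Module.FaithfullyFlat A B := .of_flat_of_isLocalHom
  rw [← Ideal.comap_map_eq_self_of_faithfullyFlat (B := B) (maximalIdeal A), h, ← h3,
    ← Ideal.comap_map_eq_self_of_faithfullyFlat (B := B) (Ideal.span _), Ideal.map_span]
  congr 2
  simp only [Finset.coe_image, Finset.coe_univ, Set.image_univ, ← Set.range_comp]
  rfl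

lemma embDim_add_length_le (n : ℕ) : ∀ (B : Type u) [CommRing B] [IsNoetherianRing B]
    [IsLocalRing B] [Algebra A B] [IsLocalHom (algebraMap A B)] [Module.Flat A B] (ys : List B),
    ys.length = n → IsRegularMod ys ((maximalIdeal A).map (algebraMap A B)) →
    (maximalIdeal A).map (algebraMap A B) ⊔ Ideal.ofList ys = maximalIdeal B →
    embDim A + n ≤ embDim B := by
  induction n with
  | zero =>
    intro B _ _ _ _ _ _ ys hn _ hm
    obtain rfl := List.length_eq_zero_iff.1 hn
    rw [Ideal.ofList_nil, sup_bot_eq] at hm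
    exact embDim_le_of_map_maximalIdeal hm
  | succ n ih =>
    intro B _ _ _ _ _ _ ys hn hys hm
    obtain _ | ⟨y, ys⟩ := ys
    · simp at hn
    have hy : y ∈ maximalIdeal B := hm ▸ le_sup_right
      (a := (maximalIdeal A).map (algebraMap A B)) (Ideal.subset_span List.mem_cons_self)
    have hlt : Ideal.span {y} ≠ ⊤ := fun h ↦ (Ideal.IsPrime.ne_top' : maximalIdeal B ≠ ⊤)
      (top_le_iff.1 (h ▸ (Ideal.span_singleton_le_iff_mem _).2 hy))
    have : Nontrivial (B ⧸ Ideal.span {y}) := Ideal.Quotient.nontrivial_iff.2 hlt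
    have : IsLocalRing (B ⧸ Ideal.span {y}) :=
      .of_surjective' (Ideal.Quotient.mk _) Ideal.Quotient.mk_surjective
    have : IsLocalHom (Ideal.Quotient.mk (Ideal.span {y})) :=
      .of_surjective _ Ideal.Quotient.mk_surjective
    have : IsLocalHom (algebraMap A (B ⧸ Ideal.span {y})) :=
      inferInstanceAs (IsLocalHom ((Ideal.Quotient.mk (Ideal.span {y})).comp (algebraMap A B)))
    have hfl := (flat_quotient_of_regular_fibre hy hys.1).1
    have hmap : (maximalIdeal A).map (algebraMap A (B ⧸ Ideal.span {y})) =
        ((maximalIdeal A).map (algebraMap A B)).map (Ideal.Quotient.mk (Ideal.span {y})) := by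
      rw [Ideal.map_map]; rfl
    have h1 := ih (B ⧸ Ideal.span {y}) (ys.map (Ideal.Quotient.mk _)) (by simpa using hn) ?_ ?_
    · have h2 := succ_embDim_le hy (notMem_sq_of_isRegularMod hys hm)
      omega
    · rw [← isRegularMod_comap_iff _ Ideal.Quotient.mk_surjective, hmap,
        Ideal.comap_map_of_surjective _ Ideal.Quotient.mk_surjective, comap_mk_bot]
      exact hys.2
    · rw [hmap, ← Ideal.map_ofList, ← Ideal.map_sup, ← maximalIdeal_map_mk (I := Ideal.span {y}),
        ← hm, Ideal.ofList_cons]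
      simp [Ideal.map_sup, Ideal.map_quotient_self]

lemma ringKrullDim_eq_add_length {B : Type u} [CommRing B] [IsNoetherianRing B]
    [IsLocalRing B] [Algebra A B] [IsLocalHom (algebraMap A B)] [Module.Flat A B] {ys : List B}
    (hys : IsRegularMod ys ((maximalIdeal A).map (algebraMap A B)))
    (hm : (maximalIdeal A).map (algebraMap A B) ⊔ Ideal.ofList ys = maximalIdeal B) :
    ringKrullDim B = ringKrullDim A + ys.length := by
  have h0 : (maximalIdeal B).LiesOver (maximalIdeal A) :=
    by
    have h : (maximalIdeal B).comap (algebraMap A B) = maximalIdeal A :=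
      ((local_hom_TFAE (algebraMap A B)).out 0 4).1 ‹_›
    exact ⟨h.symm⟩
  have h1 := Ideal.height_eq_height_add_of_liesOver_of_hasGoingDown (maximalIdeal A)
    (maximalIdeal B)
  have h2 := ringKrullDim_quotient_eq_length hys hm
  have hJ : (maximalIdeal A).map (algebraMap A B) ≤ maximalIdeal B := hm ▸ le_sup_left
  have : Nontrivial (B ⧸ (maximalIdeal A).map (algebraMap A B)) :=
    Ideal.Quotient.nontrivial_iff.2 fun h ↦
    (maximalIdeal.isMaximal B).ne_top (top_le_iff.1 (h ▸ hJ))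
  have : IsLocalRing (B ⧸ (maximalIdeal A).map (algebraMap A B)) :=
    .of_surjective' _ Ideal.Quotient.mk_surjective
  rw [maximalIdeal_map_mk] at h1
  rw [← IsLocalRing.maximalIdeal_height_eq_ringKrullDim] at h2
  rw [← IsLocalRing.maximalIdeal_height_eq_ringKrullDim,
    ← IsLocalRing.maximalIdeal_height_eq_ringKrullDim, h1, ← h2]
  push_cast
  rfl

end Flat

end Numerics

/- ## Splitting square-zero extensions of a field -/

section FieldSection

open Function Polynomial

/-- A square-zero extension of a field of characteristic zero splits. -/
lemma exists_section_of_charZero {k E : Type u} [Field k] [CharZero k] [CommRing E]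
    (π : E →+* k) (hπ : Surjective π) (hker : RingHom.ker π ^ 2 = ⊥) :
    ∃ s : k →+* E, π.comp s = RingHom.id k := by
  obtain ⟨v, hv⟩ := exists_isTranscendenceBasis ℚ k
  have hv' := hv.isAlgebraic_field
  have : Algebra.FormallySmooth ℚ k := .of_algebraicIndependent_of_isSeparable hv.1
  have : Algebra.FormallySmooth ℤ ℚ := .of_isLocalization (nonZeroDivisors ℤ)
  have : Algebra.FormallySmooth ℤ k := .comp ℤ ℚ k
  refine ⟨(Algebra.FormallySmooth.liftOfSurjective (AlgHom.id ℤ k) π.toIntAlgHom hπ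
    ⟨2, hker⟩).toRingHom, RingHom.ext fun x ↦ ?_⟩
  exact Algebra.FormallySmooth.liftOfSurjective_apply (AlgHom.id ℤ k) π.toIntAlgHom hπ ⟨2, hker⟩ x

/-- In characteristic `p`, a partial section defined on a subring containing all `p`-th powers
extends to any further element. -/
lemma eq_zero_of_mem_adjoin {k E : Type u} [Field k] [CommRing E] {p : ℕ} (hp : p.Prime)
    (π : E →+* k) (T : Subring E) (hT : ∀ e : E, e ^ p ∈ T) (hπ : Surjective π)
    [CharP k p] (hinj : ∀ t ∈ T, π t = 0 → t = 0) (e : E) (he : π e ∉ T.map π) (y : E)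
    (hy : y ∈ Algebra.adjoin T {e}) (hy0 : π y = 0) : y = 0 := by
  have : Fact p.Prime := ⟨hp⟩
  rw [Algebra.adjoin_singleton_eq_range_aeval] at hy
  obtain ⟨f, rfl⟩ := hy
  have hinv : ∀ x ∈ T.map π, x⁻¹ ∈ T.map π := by
    intro x hx
    by_cases h0 : x = 0
    · rw [h0, inv_zero]; exact zero_mem _
    obtain ⟨z, hz⟩ := hπ x⁻¹
    have h1 : x⁻¹ ^ p ∈ T.map π := ⟨z ^ p, hT z, by simp [hz]⟩
    have h2 : x⁻¹ = x ^ (p - 1) * x⁻¹ ^ p := by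
      obtain ⟨q, rfl⟩ := Nat.exists_eq_succ_of_ne_zero hp.ne_zero
      simp only [Nat.succ_eq_add_one, Nat.add_sub_cancel, pow_succ, ← mul_assoc, ← mul_pow]
      rw [mul_inv_cancel₀ h0]; simp
    rw [h2]
    exact mul_mem (pow_mem hx _) h1
  let K : Subfield k := { T.map π with inv_mem' := hinv }
  let ρ : T →+* K := (π.comp T.subtype).codRestrict K fun t ↦ ⟨t, t.2, rfl⟩
  have hρ : Injective ρ := (injective_iff_map_eq_zero ρ).2 fun t ht ↦
    Subtype.ext (hinj t t.2 (congrArg Subtype.val ht))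
  have : Nontrivial T := ρ.domain_nontrivial
  let g : T[X] := X ^ p - C (⟨e ^ p, hT e⟩ : T)
  have hg : g.Monic := monic_X_pow_sub_C _ hp.ne_zero
  have hge : aeval e g = 0 := by simp [g, Subring.smul_def, Algebra.algebraMap_eq_smul_one]
  have hfr : aeval e f = aeval e (f %ₘ g) := by
    conv_lhs => rw [← modByMonic_add_div f g]
    simp [hge]
  have hdeg : (f %ₘ g).degree < p := by
    have := degree_modByMonic_lt f hg
    rwa [degree_X_pow_sub_C hp.pos] at this
  have hcomp : ∀ r : T[X], aeval (π e) (r.map ρ) = π (aeval e r) := by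
    intro r
    rw [aeval_def, eval₂_map, aeval_def, hom_eval₂]
    rfl
  have hirr : Irreducible (g.map ρ) := by
    have : g.map ρ = X ^ p - C (ρ ⟨e ^ p, hT e⟩) := by simp [g]
    rw [this]
    refine X_pow_sub_C_irreducible_of_prime hp fun b hb ↦ he ?_
    have h1 : (b : k) ^ p = (π e) ^ p := by
      rw [← map_pow]
      exact congrArg Subtype.val hb
    have h2 : (b : k) = π e := frobenius_inj k p h1
    rw [← h2]
    exact b.2
  have hmin : g.map ρ = minpoly K (π e) := by
    refine minpoly.eq_of_irreducible_of_monic hirr ?_ (hg.map ρ)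
    rw [hcomp, hge, map_zero]
  have hr : (f %ₘ g).map ρ = 0 := by
    by_contra h
    have h1 := minpoly.degree_le_of_ne_zero K (π e) h (by rw [hcomp, ← hfr]; exact hy0)
    rw [← hmin, degree_map_eq_of_injective hρ, degree_map_eq_of_injective hρ,
      degree_X_pow_sub_C hp.pos] at h1
    exact absurd hdeg (not_lt.2 h1)
  have hr0 : f %ₘ g = 0 := (Polynomial.map_eq_zero_iff hρ).1 hr
  change aeval e f = 0
  rw [hfr, hr0, map_zero]

/-- A square-zero extension of a field of characteristic `p` by a ring of characteristic `p`
splits. -/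
lemma exists_section_of_charP {k E : Type u} [Field k] [CommRing E] {p : ℕ} (hp : p.Prime)
    [CharP k p] (hE : (p : E) = 0)
    (π : E →+* k) (hπ : Surjective π) (hker : RingHom.ker π ^ 2 = ⊥) :
    ∃ s : k →+* E, π.comp s = RingHom.id k := by
  have : Fact p.Prime := ⟨hp⟩
  have : Nontrivial E := π.domain_nontrivial
  have : CharP E p := (CharP.charP_iff_prime_eq_zero hp).2 hE
  let P : Set (Subring E) := {T | (frobenius E p).range ≤ T ∧ ∀ t ∈ T, π t = 0 → t = 0}
  have h0 : (frobenius E p).range ∈ P := by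
    refine ⟨le_rfl, ?_⟩
    rintro _ ⟨e, rfl⟩ he
    have h1 : e ∈ RingHom.ker π := by
      rw [RingHom.mem_ker]
      rw [frobenius_def, map_pow] at he
      exact eq_zero_of_pow_eq_zero he
    have h2 : e ^ 2 ∈ RingHom.ker π ^ 2 := Ideal.pow_mem_pow h1 2
    rw [hker, Ideal.mem_bot] at h2
    rw [frobenius_def]
    exact pow_eq_zero_of_le hp.two_le h2
  obtain ⟨T, hT0, hT⟩ := zorn_le_nonempty₀ P (by
    intro c hc hchain T0 hT0
    refine ⟨sSup c, ⟨(hc hT0).1.trans (le_sSup hT0), fun t ht h ↦ ?_⟩, fun z hz ↦ le_sSup hz⟩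
    obtain ⟨T, hTc, htT⟩ := (Subring.mem_sSup_of_directedOn ⟨T0, hT0⟩ hchain.directedOn).1 ht
    exact (hc hTc).2 t htT h) _ h0
  have hTp : ∀ e : E, e ^ p ∈ T := fun e ↦ hT.1.1 ⟨e, rfl⟩
  have hsurj : ∀ x : k, x ∈ T.map π := by
    intro x
    by_contra hx
    obtain ⟨e, rfl⟩ := hπ x
    have hle : T ≤ (Algebra.adjoin T {e}).toSubring := fun t ht ↦
      Subalgebra.algebraMap_mem (Algebra.adjoin T {e}) (⟨t, ht⟩ : T)
    have hmem : (Algebra.adjoin T {e}).toSubring ∈ P :=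
      ⟨hT.1.1.trans hle, fun t ht ↦ eq_zero_of_mem_adjoin hp π T hTp hπ hT.1.2 e hx t ht⟩
    exact hx ⟨e, hT.2 hmem hle (Algebra.self_mem_adjoin_singleton T e), rfl⟩
  have hbij : Bijective (π.comp T.subtype) := by
    refine ⟨(injective_iff_map_eq_zero _).2 fun t ht ↦ Subtype.ext (hT.1.2 t t.2 ht), fun x ↦ ?_⟩
    obtain ⟨t, ht, rfl⟩ := hsurj x
    exact ⟨⟨t, ht⟩, rfl⟩
  refine ⟨T.subtype.comp (RingEquiv.ofBijective _ hbij).symm.toRingHom, RingHom.ext fun x ↦ ?_⟩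
  exact (RingEquiv.ofBijective _ hbij).apply_symm_apply x

lemma exists_section {k E : Type u} [Field k] [CommRing E] (p : ℕ)
    [CharP k p] (hE : (p : E) = 0)
    (π : E →+* k) (hπ : Surjective π) (hker : RingHom.ker π ^ 2 = ⊥) :
    ∃ s : k →+* E, π.comp s = RingHom.id k := by
  rcases CharP.char_is_prime_or_zero k p with hp | rfl
  · exact exists_section_of_charP hp hE π hπ hker
  · have : CharZero k := CharP.charP_to_charZero k
    exact exists_section_of_charZero π hπ hker

end FieldSection

/- ## Cohen rings -/

section AdicCriteria

variable {A : Type*} [CommRing A] (I : Ideal A)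

lemma exists_adic_limit [IsAdicComplete I A] (f : ℕ → A) (h : ∀ n, f (n + 1) - f n ∈ I ^ n) :
    ∃ a, ∀ n, a - f n ∈ I ^ n := by
  have h1 : ∀ m d, f (m + d) - f m ∈ I ^ m := by
    intro m d
    induction d with
    | zero => simp
    | succ d ih =>
      have := add_mem (Ideal.pow_le_pow_right (Nat.le_add_right m d) (h (m + d))) ih
      rwa [sub_add_sub_cancel] at this
  obtain ⟨a, ha⟩ := IsPrecomplete.prec' (I := I) (M := A) f (by
    intro m n hmn
    obtain ⟨d, rfl⟩ := Nat.exists_eq_add_of_le hmn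
    rw [SModEq.sub_mem, smul_eq_mul, Ideal.mul_top, ← neg_mem_iff, neg_sub]
    exact h1 m d)
  refine ⟨a, fun n ↦ ?_⟩
  have := ha n
  rwa [SModEq.sub_mem, smul_eq_mul, Ideal.mul_top, ← neg_mem_iff, neg_sub] at this

lemma isAdicComplete_of_exists_limit (h0 : ∀ a, (∀ n, a ∈ I ^ n) → a = 0)
    (h : ∀ f : ℕ → A, (∀ n, f (n + 1) - f n ∈ I ^ n) → ∃ a, ∀ n, a - f n ∈ I ^ n) :
    IsAdicComplete I A where
  haus' a ha := h0 a fun n ↦ by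
    have := ha n
    rwa [SModEq.zero, smul_eq_mul, Ideal.mul_top] at this
  prec' f hf := by
    obtain ⟨a, ha⟩ := h f fun n ↦ by
      have := hf n.le_succ
      rwa [SModEq.sub_mem, smul_eq_mul, Ideal.mul_top, ← neg_mem_iff, neg_sub] at this
    refine ⟨a, fun n ↦ ?_⟩
    rw [SModEq.sub_mem, smul_eq_mul, Ideal.mul_top, ← neg_mem_iff, neg_sub]
    exact ha n

lemma eq_zero_of_forall_mem_pow [IsHausdorff I A] {a : A} (h : ∀ n, a ∈ I ^ n) : a = 0 :=
  IsHausdorff.haus' (I := I) a fun n ↦ by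
    rw [SModEq.zero, smul_eq_mul, Ideal.mul_top]
    exact h n

end AdicCriteria

section Cohen

open Function

/-- A Cohen ring of the field `k` of characteristic exponent `p`: the field itself if `p = 0`, and
otherwise a `p`-adically complete `p`-torsion free ring with `C / p = k`. -/
structure IsCohenRing (p : ℕ) {k C : Type u} [Field k] [CommRing C] (π : C →+* k) : Prop where
  surj : Surjective π
  ker_eq : ∀ c, π c = 0 → ∃ d, c = p * d
  complete : IsAdicComplete (Ideal.span {(p : C)}) C
  regular : p = 0 ∨ ∀ c : C, p * c = 0 → c = 0

lemma exists_subring_of_charP {k B : Type u} [Field k] [CommRing B] (p : ℕ) [CharP k p]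
    (ρ : B →+* k) (hρ : Surjective ρ)
    (h : ∀ x y, ρ x = 0 → ρ y = 0 → ∃ z, x * y = p * z) :
    ∃ B' : Subring B, (∀ b : B, p * b ∈ B') ∧ (∀ b ∈ B', ρ b = 0 → ∃ z, b = p * z) ∧
      ∀ x, ∃ b ∈ B', ρ b = x := by
  let I : Ideal B := Ideal.span {(p : B)}
  have hI : ∀ b, Ideal.Quotient.mk I b = 0 ↔ ∃ z, b = p * z := fun b ↦ by
    rw [Ideal.Quotient.eq_zero_iff_mem, Ideal.mem_span_singleton]; rfl
  have hlift : ∀ b ∈ I, ρ b = 0 := fun b hb ↦ by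
    obtain ⟨z, rfl⟩ := (hI b).1 (Ideal.Quotient.eq_zero_iff_mem.2 hb)
    simp
  let ρ' : B ⧸ I →+* k := Ideal.Quotient.lift I ρ hlift
  have hρ' : ∀ b, ρ' (Ideal.Quotient.mk I b) = ρ b := fun b ↦ Ideal.Quotient.lift_mk I ρ hlift
  obtain ⟨s, hs⟩ := exists_section p
    (by simpa using (hI (p : B)).2 ⟨1, (mul_one _).symm⟩) ρ'
    (fun x ↦ (hρ x).imp' _ fun b hb ↦ (hρ' b).trans hb) (by
      rw [eq_bot_iff, pow_two, Ideal.mul_le]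
      intro x hx y hy
      obtain ⟨x, rfl⟩ := Ideal.Quotient.mk_surjective x
      obtain ⟨y, rfl⟩ := Ideal.Quotient.mk_surjective y
      rw [Ideal.mem_bot, ← map_mul, hI]
      exact h x y ((hρ' x).symm.trans hx) ((hρ' y).symm.trans hy))
  have hs' : ∀ x, ρ' (s x) = x := fun x ↦ congr($hs x)
  refine ⟨RingHom.eqLocus (Ideal.Quotient.mk I) (s.comp ρ), fun b ↦ ?_, fun b hb h0 ↦ ?_,
    fun x ↦ ?_⟩
  · change Ideal.Quotient.mk I (p * b) = s (ρ (p * b))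
    rw [(hI _).2 ⟨b, rfl⟩]
    simp
  · rw [← hI]
    change Ideal.Quotient.mk I b = s (ρ b) at hb
    rw [hb, h0, map_zero]
  · obtain ⟨b, hb⟩ := Ideal.Quotient.mk_surjective (s x)
    have : ρ b = x := by rw [← hρ', hb, hs']
    refine ⟨b, ?_, this⟩
    change Ideal.Quotient.mk I b = s (ρ b)
    rw [hb, this]

variable {p : ℕ} {k C : Type u} [Field k] [CharP k p] [CommRing C] {π : C →+* k}

/-- A square-zero extension of a Cohen ring by an ideal killed by `p` splits. -/
lemma IsCohenRing.exists_section (hC : IsCohenRing p π) {E : Type u} [CommRing E] (q : E →+* C)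
    (hq : Surjective q) (hN : ∀ x y, q x = 0 → q y = 0 → x * y = 0)
    (hpN : ∀ x, q x = 0 → p * x = 0) : ∃ s : C →+* E, q.comp s = RingHom.id C := by
  have hdec : ∀ x, π (q x) = 0 → ∃ n e, q n = 0 ∧ x = n + p * e := by
    intro x hx
    obtain ⟨c, hc⟩ := hC.ker_eq _ hx
    obtain ⟨e, rfl⟩ := hq c
    exact ⟨x - p * e, e, by simp [hc], by ring⟩
  obtain ⟨E', h1, h2, h3⟩ := exists_subring_of_charP p (π.comp q) (hC.surj.comp hq) (by
    intro x y hx hy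
    obtain ⟨n, e, hn, rfl⟩ := hdec x hx
    obtain ⟨n', e', hn', rfl⟩ := hdec y hy
    refine ⟨p * (e * e'), ?_⟩
    linear_combination hN n n' hn hn' + e' * hpN n hn + e * hpN n' hn')
  have hbij : Bijective (q.comp E'.subtype) := by
    constructor
    · refine (injective_iff_map_eq_zero _).2 fun e he ↦ Subtype.ext ?_
      have he' : q e = 0 := he
      obtain ⟨z, hz⟩ := h2 e e.2 (by simp [he'])
      rcases hC.regular with h0 | h0
      · rw [hz, h0]; simp
      · rw [hz]
        refine hpN z (h0 _ ?_)
        rw [← he', hz]; simp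
    · intro c
      obtain ⟨e, he, hec⟩ := h3 (π c)
      obtain ⟨d, hd⟩ := hC.ker_eq (c - q e) (by
        rw [map_sub, sub_eq_zero]; exact hec.symm)
      obtain ⟨d, rfl⟩ := hq d
      refine ⟨⟨e + p * d, add_mem he (h1 d)⟩, ?_⟩
      change q (e + p * d) = c
      rw [map_add, map_mul, map_natCast, ← hd]; ring
  refine ⟨E'.subtype.comp (RingEquiv.ofBijective _ hbij).symm.toRingHom, RingHom.ext fun x ↦ ?_⟩
  exact (RingEquiv.ofBijective _ hbij).apply_symm_apply x

/-- Homomorphisms from a Cohen ring lift along square-zero extensions by an ideal killed by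
`p`. -/
lemma IsCohenRing.exists_lift (hC : IsCohenRing p π) {T T' : Type u} [CommRing T] [CommRing T']
    (q : T →+* T') (hq : Surjective q) (hN : ∀ x y, q x = 0 → q y = 0 → x * y = 0)
    (hpN : ∀ x, q x = 0 → p * x = 0) (g : C →+* T') : ∃ s : C →+* T, q.comp s = g := by
  let E : Subring (T × C) := RingHom.eqLocus (q.comp (RingHom.fst T C)) (g.comp (RingHom.snd T C))
  obtain ⟨s, hs⟩ := hC.exists_section ((RingHom.snd T C).comp E.subtype)
    (fun c ↦ by
      obtain ⟨t, ht⟩ := hq (g c)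
      exact ⟨⟨(t, c), ht⟩, rfl⟩)
    (fun x y hx hy ↦ by
      have hx' : x.1.2 = 0 := hx
      have hy' : y.1.2 = 0 := hy
      have hx1 : q x.1.1 = g x.1.2 := x.2
      have hy1 : q y.1.1 = g y.1.2 := y.2
      refine Subtype.ext (Prod.ext ?_ ?_)
      · exact hN _ _ (by rw [hx1, hx', map_zero]) (by rw [hy1, hy', map_zero])
      · change x.1.2 * y.1.2 = 0
        rw [hx', zero_mul])
    (fun x hx ↦ by
      have hx' : x.1.2 = 0 := hx
      have hx1 : q x.1.1 = g x.1.2 := x.2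
      refine Subtype.ext (Prod.ext ?_ ?_)
      · have := hpN x.1.1 (by rw [hx1, hx', map_zero])
        simpa using this
      · simp [hx'])
  refine ⟨((RingHom.fst T C).comp E.subtype).comp s, RingHom.ext fun c ↦ ?_⟩
  have h1 : q (s c).1.1 = g (s c).1.2 := (s c).2
  have h2 : (s c).1.2 = c := congr($hs c)
  change q (s c).1.1 = g c
  rw [h1, h2]

/-- Homomorphisms from a Cohen ring to a quotient of an adically complete ring lift. -/
lemma IsCohenRing.exists_lift_of_isAdicComplete (hC : IsCohenRing p π) {A : Type u} [CommRing A]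
    (M K : Ideal A) [IsAdicComplete M A] (hp : (p : A) ∈ M) (hKM : K ≤ M)
    (hK : ∀ x, (∀ n, x ∈ K ⊔ M ^ n) → x ∈ K) (φ : C →+* A ⧸ K) :
    ∃ Φ : C →+* A, (Ideal.Quotient.mk K).comp Φ = φ := by
  let I : ℕ → Ideal A := fun n ↦ M ^ (n + 1) ⊓ K
  have hI : ∀ n, I (n + 1) ≤ I n := fun n ↦
    inf_le_inf (Ideal.pow_le_pow_right (Nat.le_succ _)) le_rfl
  have hI0 : I 0 = K := by simp [I, hKM]
  have step : ∀ n (ψ : C →+* A ⧸ I n), ∃ ψ' : C →+* A ⧸ I (n + 1),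
      (Ideal.Quotient.factor (hI n)).comp ψ' = ψ := by
    intro n ψ
    refine hC.exists_lift _ (Ideal.Quotient.factor_surjective (hI n)) ?_ ?_ ψ
    · intro x y hx hy
      obtain ⟨x, rfl⟩ := Ideal.Quotient.mk_surjective x
      obtain ⟨y, rfl⟩ := Ideal.Quotient.mk_surjective y
      rw [Ideal.Quotient.factor_mk, Ideal.Quotient.eq_zero_iff_mem] at hx hy
      rw [← map_mul, Ideal.Quotient.eq_zero_iff_mem]
      refine ⟨?_, K.mul_mem_right _ hx.2⟩
      rw [pow_succ]
      exact Ideal.mul_mem_mul hx.1 (hKM hy.2)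
    · intro x hx
      obtain ⟨x, rfl⟩ := Ideal.Quotient.mk_surjective x
      rw [Ideal.Quotient.factor_mk, Ideal.Quotient.eq_zero_iff_mem] at hx
      rw [← map_natCast (Ideal.Quotient.mk (I (n + 1))), ← map_mul, Ideal.Quotient.eq_zero_iff_mem]
      refine ⟨?_, K.mul_mem_left _ hx.2⟩
      rw [pow_succ, mul_comm (p : A) x]
      exact Ideal.mul_mem_mul hx.1 hp
  choose next hnext using step
  let ψ : ∀ n, C →+* A ⧸ I n := fun n ↦
    Nat.rec ((Ideal.Quotient.factor hI0.ge).comp φ) (fun n ψ ↦ next n ψ) n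
  have hψ : ∀ n c, Ideal.Quotient.factor (hI n) (ψ (n + 1) c) = ψ n c := fun n c ↦
    congr($(hnext n (ψ n)) c)
  have hle : ∀ n, I n ≤ M ^ n := fun n ↦ inf_le_left.trans (Ideal.pow_le_pow_right n.le_succ)
  have hψK : ∀ n c, Ideal.Quotient.factor (inf_le_right : I n ≤ K) (ψ n c) = φ c := by
    intro n c
    induction n with
    | zero =>
      obtain ⟨a, ha⟩ := Ideal.Quotient.mk_surjective (φ c)
      change Ideal.Quotient.factor (inf_le_right : I 0 ≤ K) (Ideal.Quotient.factor hI0.ge (φ c)) = φ c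
      rw [← ha]; rfl
    | succ n ih =>
      rw [← ih, ← hψ n c]
      obtain ⟨a, ha⟩ := Ideal.Quotient.mk_surjective (ψ (n + 1) c)
      rw [← ha]; rfl
  let f : ∀ n, C →+* A ⧸ M ^ n := fun n ↦ (Ideal.Quotient.factor (hle n)).comp (ψ n)
  have hf1 : ∀ n c, Ideal.Quotient.factor (Ideal.pow_le_pow_right n.le_succ) (f (n + 1) c) =
      f n c := by
    intro n c
    change Ideal.Quotient.factor _ (Ideal.Quotient.factor (hle (n + 1)) (ψ (n + 1) c)) =
      Ideal.Quotient.factor (hle n) (ψ n c)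
    rw [← hψ n c]
    obtain ⟨a, ha⟩ := Ideal.Quotient.mk_surjective (ψ (n + 1) c)
    rw [← ha]; rfl
  have hf : ∀ {m n : ℕ} (hmn : m ≤ n),
      (Ideal.Quotient.factorPow M hmn).comp (f n) = f m := by
    intro m n hmn
    obtain ⟨d, rfl⟩ := Nat.exists_eq_add_of_le hmn
    refine RingHom.ext fun c ↦ ?_
    induction d with
    | zero =>
      obtain ⟨a, ha⟩ := Ideal.Quotient.mk_surjective (f m c)
      change Ideal.Quotient.factor (Ideal.pow_le_pow_right hmn) (f m c) = f m c
      rw [← ha]; rfl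
    | succ d ih =>
      rw [← ih (Nat.le_add_right m d)]
      change Ideal.Quotient.factor (Ideal.pow_le_pow_right hmn) (f (m + d + 1) c) =
        Ideal.Quotient.factor (Ideal.pow_le_pow_right (Nat.le_add_right m d)) (f (m + d) c)
      rw [← hf1 (m + d) c]
      obtain ⟨a, ha⟩ := Ideal.Quotient.mk_surjective (f (m + d + 1) c)
      rw [← ha]; rfl
  refine ⟨IsAdicComplete.liftRingHom M f hf, RingHom.ext fun c ↦ ?_⟩
  obtain ⟨b, hb⟩ := Ideal.Quotient.mk_surjective (φ c)
  rw [RingHom.comp_apply, ← hb, Ideal.Quotient.eq]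
  refine hK _ fun n ↦ ?_
  obtain ⟨a, ha⟩ := Ideal.Quotient.mk_surjective (ψ n c)
  have h1 : IsAdicComplete.liftRingHom M f hf c - a ∈ M ^ n := by
    rw [← Ideal.Quotient.eq, IsAdicComplete.mk_liftRingHom]
    change Ideal.Quotient.factor (hle n) (ψ n c) = _
    rw [← ha]; rfl
  have h2 : a - b ∈ K := by
    rw [← Ideal.Quotient.eq, hb, ← hψK n c, ← ha]; rfl
  rw [← sub_add_sub_cancel _ a b]
  exact add_mem (Ideal.mem_sup_right h1) (Ideal.mem_sup_left h2)

end Cohen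

section ExistsCohen

open Function

lemma RingHom.exists_factor_of_forall_exists {B k Ω : Type*} [CommRing B] [Field k] [CommRing Ω]
    [Nontrivial Ω] (g : B →+* Ω) (i : k →+* Ω) (h : ∀ b, ∃ x, g b = i x) :
    ∃ ρ : B →+* k, ∀ b, i (ρ b) = g b := by
  choose ρ hρ using h
  refine ⟨⟨⟨⟨ρ, ?_⟩, ?_⟩, ?_, ?_⟩, fun b ↦ (hρ b).symm⟩
  · exact i.injective (by rw [← hρ]; simp)
  · exact fun a b ↦ i.injective (by rw [map_mul, ← hρ, ← hρ, ← hρ, map_mul])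
  · exact i.injective (by change i (ρ 0) = i 0; rw [← hρ]; simp)
  · exact fun a b ↦ i.injective (by change i (ρ (a + b)) = i (ρ a + ρ b); rw [map_add, ← hρ, ← hρ, ← hρ, map_add])

/-- The relation between consecutive terms of the chain of subrings whose intersection is a Cohen
ring. -/
structure CohenStep (p : ℕ) {W Ω k : Type u} [CommRing W] [Field Ω] [Field k] (φ : W →+* Ω)
    (i : k →+* Ω) (A B : Subring W) : Prop where
  le : B ≤ A
  mul_mem : ∀ a ∈ A, p * a ∈ B
  ker : ∀ b ∈ B, φ b = 0 → ∃ a ∈ A, b = p * a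
  surj : ∀ x, ∃ b ∈ B, φ b = i x
  range : ∀ b ∈ B, ∃ x, φ b = i x

variable {p : ℕ} {W Ω k : Type u} [CommRing W] [Field Ω] [Field k] [CharP k p] {φ : W →+* Ω}
  {i : k →+* Ω}

lemma CohenStep.exists_next {A B : Subring W} (h : CohenStep p φ i A B) :
    ∃ B', CohenStep p φ i B B' := by
  obtain ⟨ρ, hρ⟩ := RingHom.exists_factor_of_forall_exists (φ.comp B.subtype) i
    fun b ↦ h.range b b.2
  obtain ⟨B', h1, h2, h3⟩ := exists_subring_of_charP p ρ
    (fun x ↦ by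
      obtain ⟨b, hb, hbx⟩ := h.surj x
      exact ⟨⟨b, hb⟩, i.injective ((hρ _).trans hbx)⟩)
    (fun x y hx hy ↦ by
      have hx' := hρ x
      have hy' := hρ y
      rw [hx, map_zero] at hx'
      rw [hy, map_zero] at hy'
      obtain ⟨a, ha, hxa⟩ := h.ker x x.2 hx'.symm
      obtain ⟨b, hb, hyb⟩ := h.ker y y.2 hy'.symm
      refine ⟨⟨p * (a * b), h.mul_mem _ (A.mul_mem ha hb)⟩, Subtype.ext ?_⟩
      change (x : W) * y = (p : B) * (p * (a * b))
      rw [hxa, hyb]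
      push_cast
      ring)
  refine ⟨B'.map B.subtype, ?_, ?_, ?_, ?_, ?_⟩
  · rintro _ ⟨b, -, rfl⟩
    exact b.2
  · intro a ha
    exact ⟨_, h1 ⟨a, ha⟩, by simp⟩
  · rintro _ ⟨b, hb, rfl⟩ h0
    obtain ⟨z, hz⟩ := h2 b hb (i.injective (by rw [hρ, map_zero]; exact h0))
    exact ⟨z, z.2, by rw [hz]; simp⟩
  · intro x
    obtain ⟨b, hb, hbx⟩ := h3 x
    exact ⟨b, ⟨b, hb, rfl⟩, by rw [← hbx, hρ]; rfl⟩
  · rintro _ ⟨b, -, rfl⟩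
    exact h.range b b.2

lemma exists_cohenStep_chain (hφ : Surjective φ) (hker : ∀ w, φ w = 0 → ∃ v, w = p * v) :
    ∃ D : ℕ → Subring W, D 0 = ⊤ ∧ ∀ n, CohenStep p φ i (D n) (D (n + 1)) := by
  have hΩ : (p : Ω) = 0 := by rw [← map_natCast i, CharP.cast_eq_zero, map_zero]
  have h0 : CohenStep p φ i ⊤ (i.range.comap φ) := by
    refine ⟨le_top, fun a _ ↦ ?_, fun b _ h ↦ ?_, fun x ↦ ?_, fun b hb ↦ ?_⟩
    · exact ⟨0, by simp [hΩ]⟩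
    · obtain ⟨v, hv⟩ := hker b h
      exact ⟨v, trivial, hv⟩
    · obtain ⟨b, hb⟩ := hφ (i x)
      exact ⟨b, ⟨x, hb.symm⟩, hb⟩
    · obtain ⟨x, hx⟩ := hb
      exact ⟨x, hx.symm⟩
  choose next hnext using fun P : {P : Subring W × Subring W // CohenStep p φ i P.1 P.2} ↦
    P.2.exists_next
  let F : ℕ → {P : Subring W × Subring W // CohenStep p φ i P.1 P.2} := fun n ↦
    Nat.rec ⟨(⊤, _), h0⟩ (fun _ P ↦ ⟨(P.1.2, next P), hnext P⟩) n
  exact ⟨fun n ↦ (F n).1.1, rfl, fun n ↦ (F n).2⟩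

theorem exists_isCohenRing_of_hom [IsAdicComplete (Ideal.span {(p : W)}) W] (hφ : Surjective φ)
    (hker : ∀ w, φ w = 0 → ∃ v, w = p * v) (hreg : ∀ w : W, p * w = 0 → w = 0) (i : k →+* Ω) :
    ∃ (C : Type u) (_ : CommRing C) (π : C →+* k), IsCohenRing p π := by
  obtain ⟨D, hD0, hD⟩ := exists_cohenStep_chain (i := i) hφ hker
  have hΩ : (p : Ω) = 0 := by rw [← map_natCast i, CharP.cast_eq_zero, map_zero]
  have hmem : ∀ (R : Type u) [CommRing R] (n : ℕ) (w : R), w ∈ Ideal.span {(p : R)} ^ n ↔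
      ∃ v, w = p ^ n * v := fun R _ n w ↦ by
    rw [Ideal.span_singleton_pow, Ideal.mem_span_singleton]; rfl
  have hpow : ∀ n w, (p : W) ^ n * w ∈ D n := by
    intro n
    induction n with
    | zero => simp [hD0]
    | succ n ih =>
      intro w
      rw [pow_succ', mul_assoc]
      exact (hD n).mul_mem _ (ih w)
  have happrox : ∀ n, ∀ d ∈ D n, ∃ d' ∈ D (n + 1), ∃ v, d' - d = p ^ n * v := by
    intro n
    induction n with
    | zero => exact fun d _ ↦ ⟨0, zero_mem _, -d, by simp⟩
    | succ n ih =>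
      intro d hd
      obtain ⟨x, hx⟩ := (hD n).range d hd
      obtain ⟨b, hb, hbx⟩ := (hD (n + 1)).surj x
      obtain ⟨a, ha, hda⟩ := (hD n).ker (d - b) (sub_mem hd ((hD (n + 1)).le hb)) (by
        rw [map_sub, hx, hbx, sub_self])
      obtain ⟨a', ha', v, hv⟩ := ih a ha
      refine ⟨b + p * a', add_mem hb ((hD (n + 1)).mul_mem _ ha'), v, ?_⟩
      rw [pow_succ']
      linear_combination -hda + p * hv
  let C : Subring W := ⨅ n, D n
  have hC : ∀ w, w ∈ C ↔ ∀ n, w ∈ D n := fun w ↦ Subring.mem_iInf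
  have hclosed : ∀ w, (∀ n, ∃ d ∈ D n, w - d ∈ Ideal.span {(p : W)} ^ n) → w ∈ C := by
    intro w h
    rw [hC]
    intro n
    obtain ⟨d, hd, hwd⟩ := h n
    obtain ⟨v, hv⟩ := (hmem W n _).1 hwd
    rw [← sub_add_cancel w d, hv]
    exact add_mem (hpow n v) hd
  have hkerC : ∀ c ∈ C, φ c = 0 → ∃ d ∈ C, c = p * d := by
    intro c hc h0
    obtain ⟨w, hw⟩ := hker c h0
    refine ⟨w, (hC w).2 fun n ↦ ?_, hw⟩
    obtain ⟨a, ha, hca⟩ := (hD n).ker c ((hC c).1 hc (n + 1)) h0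
    have : w = a := sub_eq_zero.1 (hreg _ (by rw [mul_sub, ← hw, ← hca, sub_self]))
    rwa [this]
  have hpowC : ∀ n w, (p : W) ^ n * w ∈ C → w ∈ C := by
    intro n
    induction n with
    | zero => simp
    | succ n ih =>
      intro w hw
      obtain ⟨d, hd, hwd⟩ := hkerC _ hw (by simp [hΩ])
      rw [pow_succ', mul_assoc] at hwd
      have := sub_eq_zero.1 (hreg (p ^ n * w - d) (by rw [mul_sub, hwd, sub_self]))
      exact ih w (by rwa [this])
  have hsurj : ∀ x, ∃ c ∈ C, φ c = i x := by
    intro x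
    obtain ⟨b, hb, hbx⟩ := (hD 0).surj x
    choose g hg v hv using happrox
    let F : ∀ n, {d // d ∈ D (n + 1)} := fun n ↦
      Nat.rec ⟨b, hb⟩ (fun n d ↦ ⟨g (n + 1) d.1 d.2, hg (n + 1) d.1 d.2⟩) n
    have hF : ∀ n, (F (n + 1)).1 - (F n).1 ∈ Ideal.span {(p : W)} ^ (n + 1) := fun n ↦
      (hmem W _ _).2 ⟨_, hv (n + 1) (F n).1 (F n).2⟩
    obtain ⟨a, ha⟩ := exists_adic_limit (Ideal.span {(p : W)}) (fun n ↦ (F n).1) fun n ↦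
      Ideal.pow_le_pow_right n.le_succ (hF n)
    refine ⟨a, hclosed a fun n ↦ ⟨_, (hD n).le (F n).2, ha n⟩, ?_⟩
    obtain ⟨w, hw⟩ := (hmem W 1 _).1 (add_mem (ha 1) (hF 0))
    rw [← hbx, ← sub_eq_zero, ← map_sub]
    have hw' : a - b = p ^ 1 * w := (sub_add_sub_cancel a (F 1).1 (F 0).1).symm.trans hw
    rw [hw']
    simp [hΩ]
  obtain ⟨π, hπ⟩ := RingHom.exists_factor_of_forall_exists (φ.comp C.subtype) i
    fun c ↦ (hD 0).range c ((hC c).1 c.2 1)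
  refine ⟨C, inferInstance, π, ⟨fun x ↦ ?_, fun c hc ↦ ?_, ?_, Or.inr fun c hc ↦ ?_⟩⟩
  · obtain ⟨c, hc, hcx⟩ := hsurj x
    exact ⟨⟨c, hc⟩, i.injective ((hπ _).trans hcx)⟩
  · obtain ⟨d, hd, hcd⟩ := hkerC c c.2 (by
      have := hπ c
      rw [hc, map_zero] at this
      exact this.symm)
    exact ⟨⟨d, hd⟩, Subtype.ext (by rw [hcd]; simp)⟩
  · have hmemC : ∀ (n : ℕ) (c : C), c ∈ Ideal.span {(p : C)} ^ n ↔
        (c : W) ∈ Ideal.span {(p : W)} ^ n := by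
      intro n c
      rw [hmem C, hmem W]
      constructor
      · rintro ⟨v, hv⟩
        exact ⟨v, by rw [hv]; simp⟩
      · rintro ⟨v, hv⟩
        exact ⟨⟨v, hpowC n v (hv ▸ c.2)⟩, Subtype.ext (hv.trans (by simp))⟩
    refine isAdicComplete_of_exists_limit _ (fun a ha ↦ Subtype.ext ?_) fun f hf ↦ ?_
    · exact eq_zero_of_forall_mem_pow _ fun n ↦ (hmemC n a).1 (ha n)
    · obtain ⟨a, ha⟩ := exists_adic_limit (Ideal.span {(p : W)}) (fun n ↦ (f n : W)) fun n ↦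
        (hmemC n _).1 (hf n)
      exact ⟨⟨a, hclosed a fun n ↦ ⟨f n, (hC _).1 (f n).2 n, ha n⟩⟩, fun n ↦ (hmemC n _).2 (ha n)⟩
  · have h1 : (p : W) * c = 0 := by simpa using congrArg Subtype.val hc
    exact Subtype.ext (hreg c h1)

/-- Every field has a Cohen ring. -/
theorem exists_isCohenRing (p : ℕ) (k : Type u) [Field k] [CharP k p] :
    ∃ (C : Type u) (_ : CommRing C) (π : C →+* k), IsCohenRing p π := by
  rcases Nat.eq_zero_or_pos p with rfl | hp
  · refine ⟨k, inferInstance, RingHom.id k, surjective_id, fun c hc ↦ ⟨0, by simpa using hc⟩, ?_,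
      Or.inl rfl⟩
    rw [Nat.cast_zero, Ideal.span_singleton_eq_bot.2 rfl]
    infer_instance
  · have : Fact p.Prime := ⟨(CharP.char_is_prime_or_zero k p).resolve_right hp.ne'⟩
    have : CharP (AlgebraicClosure k) p := charP_of_injective_algebraMap
      (algebraMap k (AlgebraicClosure k)).injective p
    refine exists_isCohenRing_of_hom (W := WittVector p (AlgebraicClosure k))
      (φ := WittVector.constantCoeff) (WittVector.constantCoeff_surjective p) (fun w hw ↦ ?_)
      (fun w hw ↦ WittVector.eq_zero_of_p_mul_eq_zero w (by rwa [mul_comm]))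
      (algebraMap k (AlgebraicClosure k))
    have : w ∈ RingHom.ker (WittVector.constantCoeff (p := p) (R := AlgebraicClosure k)) := hw
    rw [WittVector.ker_constantCoeff, Ideal.mem_span_singleton] at this
    exact this

end ExistsCohen

/- ## Power series over complete local rings -/

section PowerSeriesEval

open PowerSeries Polynomial

variable {B T : Type*} [CommRing B] [CommRing T]

lemma PowerSeries.eval₂_trunc_eq {ψ : B →+* T} {s : T} {n : ℕ} (hs : s ^ n = 0) {f : B⟦X⟧}
    {P : B[X]} (h : ∀ d < n, PowerSeries.coeff d f = P.coeff d) :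
    Polynomial.eval₂ ψ s (trunc n f) = Polynomial.eval₂ ψ s P := by
  obtain ⟨Q, hQ⟩ : Polynomial.X ^ n ∣ trunc n f - P := by
    rw [Polynomial.X_pow_dvd_iff]
    intro d hd
    rw [Polynomial.coeff_sub, coeff_trunc, if_pos hd, h d hd, sub_self]
  rw [← sub_eq_zero, ← Polynomial.eval₂_sub, hQ, Polynomial.eval₂_mul, Polynomial.eval₂_X_pow, hs, zero_mul]

/-- Evaluation of a power series at a nilpotent element. -/
noncomputable def PowerSeries.evalNilpotent (ψ : B →+* T) (s : T) (n : ℕ) (hs : s ^ n = 0) :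
    B⟦X⟧ →+* T where
  toFun f := Polynomial.eval₂ ψ s (trunc n f)
  map_one' := (eval₂_trunc_eq hs (P := 1) fun d _ ↦ by
    rw [PowerSeries.coeff_one, Polynomial.coeff_one]).trans (Polynomial.eval₂_one ψ s)
  map_zero' := by simp
  map_add' f g := by simp
  map_mul' f g := by
    rw [← Polynomial.eval₂_mul]
    refine eval₂_trunc_eq hs fun d hd ↦ ?_
    rw [coeff_mul_eq_coeff_trunc_mul_trunc f g hd, ← Polynomial.coe_mul, Polynomial.coeff_coe]

lemma PowerSeries.evalNilpotent_C (ψ : B →+* T) (s : T) (n : ℕ) (hs : s ^ n = 0) (b : B) :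
    evalNilpotent ψ s n hs (C b) = ψ b :=
  (eval₂_trunc_eq hs (P := Polynomial.C b) fun d _ ↦ by
    rw [PowerSeries.coeff_C, Polynomial.coeff_C]).trans (Polynomial.eval₂_C ψ s)

lemma PowerSeries.evalNilpotent_X (ψ : B →+* T) (s : T) (n : ℕ) (hs : s ^ n = 0) :
    evalNilpotent ψ s n hs X = s :=
  (eval₂_trunc_eq hs (P := Polynomial.X) fun d _ ↦ by
    rw [PowerSeries.coeff_X, Polynomial.coeff_X]; simp [eq_comm]).trans (Polynomial.eval₂_X ψ s)

lemma PowerSeries.exists_eval {A : Type*} [CommRing A] (N : Ideal A) [IsAdicComplete N A]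
    (ψ : B →+* A) (a : A) (ha : a ∈ N) : ∃ e : B⟦X⟧ →+* A, e.comp C = ψ ∧ e X = a := by
  have hs : ∀ n, Ideal.Quotient.mk (N ^ n) a ^ n = 0 := fun n ↦ by
    rw [← map_pow, Ideal.Quotient.eq_zero_iff_mem]
    exact Ideal.pow_mem_pow ha n
  let f : ∀ n, B⟦X⟧ →+* A ⧸ N ^ n := fun n ↦
    evalNilpotent ((Ideal.Quotient.mk (N ^ n)).comp ψ) _ n (hs n)
  have hf : ∀ {m n : ℕ} (hle : m ≤ n), (Ideal.Quotient.factorPow N hle).comp (f n) = f m := by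
    intro m n hle
    refine RingHom.ext fun g ↦ ?_
    have h1 : Ideal.Quotient.factorPow N hle (Ideal.Quotient.mk (N ^ n) a) =
      Ideal.Quotient.mk (N ^ m) a := rfl
    have h2 : (Ideal.Quotient.factorPow N hle).comp ((Ideal.Quotient.mk (N ^ n)).comp ψ) =
      (Ideal.Quotient.mk (N ^ m)).comp ψ := rfl
    change Ideal.Quotient.factorPow N hle (Polynomial.eval₂ _ _ (trunc n g)) = Polynomial.eval₂ _ _ (trunc m g)
    rw [Polynomial.hom_eval₂, h1, h2]
    refine (eval₂_trunc_eq (hs m) fun d hd ↦ ?_).symm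
    rw [coeff_trunc, if_pos (hd.trans_le hle)]
  have key : ∀ x y, (∀ n, f n x = Ideal.Quotient.mk (N ^ n) y) →
      IsAdicComplete.liftRingHom N f hf x = y := fun x y h ↦ by
    rw [← sub_eq_zero]
    refine eq_zero_of_forall_mem_pow N fun n ↦ ?_
    rw [← Ideal.Quotient.eq, IsAdicComplete.mk_liftRingHom, h]
  exact ⟨IsAdicComplete.liftRingHom N f hf,
    RingHom.ext fun b ↦ key _ _ fun n ↦ evalNilpotent_C _ _ _ _ _,
    key _ _ fun n ↦ evalNilpotent_X _ _ _ _⟩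

lemma PowerSeries.hom_ext {A : Type*} [CommRing A] (N : Ideal A) [IsHausdorff N A]
    {g g' : B⟦X⟧ →+* A} (hC : g.comp C = g'.comp C) (hX : g X = g' X) (h : g X ∈ N) : g = g' := by
  have hpoly : g.comp Polynomial.coeToPowerSeries.ringHom =
      g'.comp Polynomial.coeToPowerSeries.ringHom := by
    refine Polynomial.ringHom_ext (fun b ↦ ?_) ?_
    · simpa using congr($hC b)
    · simpa using hX
  refine RingHom.ext fun f ↦ sub_eq_zero.1 (eq_zero_of_forall_mem_pow N fun n ↦ ?_)
  have h1 : g (trunc n f : B⟦X⟧) = g' (trunc n f : B⟦X⟧) := congr($hpoly (trunc n f))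
  rw [eq_X_pow_mul_shift_add_trunc n f]
  simp only [map_add, map_mul, map_pow, ← hX, h1, add_sub_add_right_eq_sub, ← mul_sub]
  exact Ideal.mul_mem_right _ _ (Ideal.pow_mem_pow h n)

end PowerSeriesEval

section PowerSeriesComplete

open PowerSeries

variable {B : Type*} [CommRing B] [IsLocalRing B]

lemma PowerSeries.mem_maximalIdeal_iff (f : B⟦X⟧) :
    f ∈ maximalIdeal B⟦X⟧ ↔ constantCoeff f ∈ maximalIdeal B := by
  rw [mem_maximalIdeal, mem_maximalIdeal, mem_nonunits_iff, mem_nonunits_iff,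
    isUnit_iff_constantCoeff]

lemma PowerSeries.mem_maximalIdeal_pow_iff (n : ℕ) (f : B⟦X⟧) :
    f ∈ maximalIdeal B⟦X⟧ ^ n ↔ ∀ i, coeff i f ∈ maximalIdeal B ^ (n - i) := by
  constructor
  · induction n generalizing f with
    | zero => simp
    | succ n ih =>
      intro hf
      rw [pow_succ'] at hf
      induction hf using Submodule.mul_induction_on' with
      | mem_mul_mem g hg h hh =>
        intro i
        rw [coeff_mul]
        refine sum_mem fun x hx ↦ ?_
        rw [Finset.HasAntidiagonal.mem_antidiagonal] at hx
        rcases Nat.eq_zero_or_pos x.1 with h0 | h0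
        · rcases Nat.lt_or_ge n i with hi | hi
          · rw [Nat.sub_eq_zero_of_le hi, pow_zero, Ideal.one_eq_top]
            trivial
          · rw [h0, Nat.sub_add_comm hi, pow_succ']
            refine Ideal.mul_mem_mul ?_ ?_
            · rw [coeff_zero_eq_constantCoeff_apply]
              exact (mem_maximalIdeal_iff g).1 hg
            · have := ih h hh x.2
              rwa [show x.2 = i by omega] at this ⊢
        · exact Ideal.mul_mem_left _ _ (Ideal.pow_le_pow_right (by omega) (ih h hh x.2))
      | add g _ h _ hg hh => exact fun i ↦ by rw [map_add]; exact add_mem (hg i) (hh i)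
  · intro h
    have hX : (X : B⟦X⟧) ∈ maximalIdeal B⟦X⟧ := (mem_maximalIdeal_iff _).2 (by simp)
    have hC : ∀ (j : ℕ) b, b ∈ maximalIdeal B ^ j → C b ∈ maximalIdeal B⟦X⟧ ^ j := by
      intro j b hb
      have h1 : (maximalIdeal B).map (C : B →+* B⟦X⟧) ≤ maximalIdeal B⟦X⟧ := by
        rw [Ideal.map_le_iff_le_comap]
        intro b hb
        rw [Ideal.mem_comap, mem_maximalIdeal_iff, constantCoeff_C]
        exact hb
      refine Ideal.pow_right_mono h1 j ?_
      rw [← Ideal.map_pow]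
      exact Ideal.mem_map_of_mem _ hb
    rw [eq_X_pow_mul_shift_add_trunc n f]
    refine add_mem (Ideal.mul_mem_right _ _ (Ideal.pow_mem_pow hX n)) ?_
    rw [trunc_apply, ← Polynomial.coeToPowerSeries.ringHom_apply, map_sum]
    refine sum_mem fun i hi ↦ ?_
    rw [Polynomial.coeToPowerSeries.ringHom_apply, Polynomial.coe_monomial,
      monomial_eq_C_mul_X_pow]
    have h2 := Ideal.mul_mem_mul (hC _ _ (h i)) (Ideal.pow_mem_pow hX i)
    rw [← pow_add] at h2
    exact Ideal.pow_le_pow_right (by omega) h2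

lemma PowerSeries.isAdicComplete_maximalIdeal [IsAdicComplete (maximalIdeal B) B] :
    IsAdicComplete (maximalIdeal B⟦X⟧) B⟦X⟧ := by
  refine isAdicComplete_of_exists_limit _ (fun f hf ↦ ?_) fun f hf ↦ ?_
  · ext i
    refine eq_zero_of_forall_mem_pow (maximalIdeal B) fun n ↦ ?_
    have := (mem_maximalIdeal_pow_iff (n + i) f).1 (hf _) i
    rwa [Nat.add_sub_cancel] at this
  · have h : ∀ i, ∃ a, ∀ n, a - coeff i (f (n + i)) ∈ maximalIdeal B ^ n := by
      intro i
      refine exists_adic_limit (maximalIdeal B) _ fun n ↦ ?_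
      have := (mem_maximalIdeal_pow_iff (n + i) _).1 (hf (n + i)) i
      rw [Nat.add_sub_cancel, map_sub] at this
      rwa [Nat.add_right_comm]
    choose a ha using h
    refine ⟨mk a, fun n ↦ (mem_maximalIdeal_pow_iff n _).2 fun i ↦ ?_⟩
    rw [map_sub, coeff_mk]
    rcases Nat.lt_or_ge n i with hi | hi
    · rw [Nat.sub_eq_zero_of_le hi.le, pow_zero, Ideal.one_eq_top]
      trivial
    · have := ha i (n - i)
      rwa [Nat.sub_add_cancel hi] at this

lemma PowerSeries.ker_constantCoeff_eq {B : Type*} [CommRing B] :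
    Ideal.span {(X : B⟦X⟧)} = (⊥ : Ideal B).comap constantCoeff := by
  ext f
  rw [Ideal.mem_span_singleton, X_dvd_iff, Ideal.mem_comap, Ideal.mem_bot]

lemma PowerSeries.isRegularMod_X_cons {B : Type*} [CommRing B] {zs : List B}
    (h : IsRegularMod zs ⊥) : IsRegularMod ((X : B⟦X⟧) :: zs.map C) ⊥ := by
  refine ⟨fun b hb ↦ ?_, ?_⟩
  · rw [Ideal.mem_bot] at hb ⊢
    exact X_mul_injective (hb.trans (mul_zero _).symm)
  · rw [bot_sup_eq, ker_constantCoeff_eq,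
      isRegularMod_comap_iff _ (fun b ↦ ⟨C b, constantCoeff_C b⟩), List.map_map]
    convert h
    convert List.map_id zs
    ext b
    simp

lemma PowerSeries.ofList_X_cons {zs : List B} (h : Ideal.ofList zs = maximalIdeal B) :
    Ideal.ofList ((X : B⟦X⟧) :: zs.map C) = maximalIdeal B⟦X⟧ := by
  rw [Ideal.ofList_cons, ← Ideal.map_ofList, h]
  apply le_antisymm
  · refine sup_le ?_ ?_
    · rw [Ideal.span_singleton_le_iff_mem, mem_maximalIdeal_iff]
      simp
    · rw [Ideal.map_le_iff_le_comap]
      intro b hb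
      rw [Ideal.mem_comap, mem_maximalIdeal_iff, constantCoeff_C]
      exact hb
  · intro f hf
    rw [mem_maximalIdeal_iff] at hf
    rw [← sub_add_cancel f (C (constantCoeff f))]
    refine add_mem (Ideal.mem_sup_left ?_) (Ideal.mem_sup_right (Ideal.mem_map_of_mem _ hf))
    rw [Ideal.mem_span_singleton, X_dvd_iff]
    simp

end PowerSeriesComplete

section FormalPowers

open PowerSeries

/-- The universal property of the ring of formal power series over `C` in the variables `xs`, with
respect to adically complete rings. -/
structure IsFormalPower {C B : Type u} [CommRing C] [CommRing B] (i : C →+* B) (xs : List B) :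
    Prop where
  exists_lift : ∀ (A : Type u) [CommRing A] (N : Ideal A) [IsAdicComplete N A] (ψ : C →+* A)
    (as : List A), as.length = xs.length → (∀ a ∈ as, a ∈ N) →
      ∃ e : B →+* A, e.comp i = ψ ∧ xs.map e = as
  hom_ext : ∀ (A : Type u) [CommRing A] (N : Ideal A) [IsAdicComplete N A] (g g' : B →+* A),
    g.comp i = g'.comp i → xs.map g = xs.map g' → (∀ x ∈ xs, g x ∈ N) → g = g'

lemma IsFormalPower.powerSeries {C B : Type u} [CommRing C] [CommRing B] {i : C →+* B}
    {xs : List B} (h : IsFormalPower i xs) :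
    IsFormalPower ((PowerSeries.C : B →+* B⟦X⟧).comp i) (X :: xs.map PowerSeries.C) where
  exists_lift A _ N _ ψ as hl has := by
    rcases as with _ | ⟨a, as⟩
    · simp at hl
    · obtain ⟨e, he, hes⟩ := h.exists_lift A N ψ as (by simpa using hl)
        fun b hb ↦ has b (List.mem_cons_of_mem _ hb)
      obtain ⟨E, hE, hEX⟩ := PowerSeries.exists_eval N e a (has a List.mem_cons_self)
      refine ⟨E, by rw [← RingHom.comp_assoc, hE, he], ?_⟩
      rw [List.map_cons, hEX, List.map_map, ← hes, ← hE]
      rfl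
  hom_ext A _ N _ g g' hi hxs hN := by
    rw [List.map_cons, List.map_cons, List.cons.injEq, List.map_map, List.map_map] at hxs
    refine PowerSeries.hom_ext N ?_ hxs.1 (hN _ List.mem_cons_self)
    exact h.hom_ext A N _ _ (by rwa [RingHom.comp_assoc, RingHom.comp_assoc]) hxs.2
      fun x hx ↦ hN _ (List.mem_cons_of_mem _ (List.mem_map_of_mem hx))

theorem exists_isFormalPower {C : Type u} [CommRing C] [IsNoetherianRing C] [IsLocalRing C]
    [IsAdicComplete (maximalIdeal C) C] {ys : List C} (hys : IsRegularMod ys ⊥)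
    (hm : Ideal.ofList ys = maximalIdeal C) (n : ℕ) :
    ∃ (B : Type u) (_ : CommRing B) (_ : IsNoetherianRing B) (_ : IsLocalRing B)
      (_ : IsAdicComplete (maximalIdeal B) B) (i : C →+* B) (xs : List B), xs.length = n ∧
      IsRegularMod (xs ++ ys.map i) ⊥ ∧ Ideal.ofList (xs ++ ys.map i) = maximalIdeal B ∧
      IsFormalPower i xs := by
  induction n with
  | zero =>
    refine ⟨C, inferInstance, inferInstance, inferInstance, inferInstance, RingHom.id C, [], rfl,
      by simpa using hys, by simpa using hm, ⟨fun A _ N _ ψ as hl _ ↦ ⟨ψ, rfl, ?_⟩,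
      fun A _ N _ g g' h _ _ ↦ h⟩⟩
    rw [List.length_eq_zero_iff.1 hl, List.map_nil]
  | succ n ih =>
    obtain ⟨B, _, _, _, _, i, xs, hl, hreg, hmax, hB⟩ := ih
    refine ⟨B⟦X⟧, inferInstance, inferInstance, inferInstance,
      PowerSeries.isAdicComplete_maximalIdeal, (PowerSeries.C : B →+* B⟦X⟧).comp i,
      X :: xs.map PowerSeries.C, by simp [hl], ?_, ?_, hB.powerSeries⟩
    · have := PowerSeries.isRegularMod_X_cons hreg
      simpa using this
    · have := PowerSeries.ofList_X_cons hmax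
      simpa using this

end FormalPowers

section CohenLocal

open Function

variable {p : ℕ} {k C : Type u} [Field k] [CharP k p] [CommRing C] {π : C →+* k}

lemma IsCohenRing.ker_eq_span (hC : IsCohenRing p π) : RingHom.ker π = Ideal.span {(p : C)} := by
  refine le_antisymm (fun c hc ↦ ?_) ?_
  · obtain ⟨d, rfl⟩ := hC.ker_eq c hc
    exact Ideal.mul_mem_right _ _ (Ideal.mem_span_singleton_self _)
  · rw [Ideal.span_singleton_le_iff_mem, RingHom.mem_ker, map_natCast, CharP.cast_eq_zero]

lemma IsCohenRing.isMaximal (hC : IsCohenRing p π) : (Ideal.span {(p : C)}).IsMaximal :=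
  hC.ker_eq_span ▸ RingHom.ker_isMaximal_of_surjective π hC.surj

lemma IsCohenRing.isLocalRing (hC : IsCohenRing p π) : IsLocalRing C :=
  have := hC.isMaximal
  have := hC.complete
  isLocalRing_of_isAdicComplete_maximal (Ideal.span {(p : C)})

lemma IsCohenRing.isNoetherianRing (hC : IsCohenRing p π) : IsNoetherianRing C := by
  refine .of_prime_ne_bot fun P hP hP0 ↦ ?_
  have hmax := hC.isMaximal
  have := hC.isLocalRing
  have hm := IsLocalRing.eq_maximalIdeal hmax
  by_cases hp : (p : C) ∈ P
  · rw [← hmax.eq_of_le hP.ne_top ((Ideal.span_singleton_le_iff_mem _).2 hp)]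
    exact ⟨{(p : C)}, by simp⟩
  · have hdiv : ∀ x ∈ P, ∃ y ∈ P, x = p * y := fun x hx ↦ by
      obtain ⟨y, rfl⟩ := Ideal.mem_span_singleton.1 (hm ▸ IsLocalRing.le_maximalIdeal hP.ne_top hx)
      exact ⟨y, (hP.mem_or_mem hx).resolve_left hp, rfl⟩
    have hpow : ∀ n, ∀ x ∈ P, x ∈ Ideal.span {(p : C)} ^ n := by
      intro n
      induction n with
      | zero => simp
      | succ n ih =>
        intro x hx
        obtain ⟨y, hy, rfl⟩ := hdiv x hx
        rw [pow_succ']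
        exact Ideal.mul_mem_mul (Ideal.mem_span_singleton_self _) (ih y hy)
    have := hC.complete
    exact (hP0 ((Submodule.eq_bot_iff _).2 fun x hx ↦
      eq_zero_of_forall_mem_pow (Ideal.span {(p : C)}) fun n ↦ hpow n x hx)).elim

/-- The regular system of parameters of a Cohen ring. -/
def cohenParameters (p : ℕ) (A : Type*) [CommRing A] : List A := if p = 0 then [] else [(p : A)]

lemma map_cohenParameters {A B : Type*} [CommRing A] [CommRing B] (f : A →+* B) :
    (cohenParameters p A).map f = cohenParameters p B := by
  unfold cohenParameters
  split <;> simp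

lemma ofList_cohenParameters (A : Type*) [CommRing A] :
    Ideal.ofList (cohenParameters p A) = Ideal.span {(p : A)} := by
  unfold cohenParameters
  split
  · simp [*]
  · simp

lemma IsCohenRing.isRegularMod {k C : Type u} [Field k] [CommRing C] {π : C →+* k}
    (hC : IsCohenRing p π) :
    IsRegularMod (cohenParameters p C) ⊥ := by
  unfold cohenParameters
  split
  · trivial
  · exact ⟨fun b hb ↦ (hC.regular.resolve_left ‹_›) b hb, trivial⟩

end CohenLocal

section Surjectivity

open Function

variable {A B : Type*} [CommRing A] [CommRing B]

lemma isAdicComplete_of_surjective [IsLocalRing A] [IsLocalRing B] [IsNoetherianRing B]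
    [IsAdicComplete (maximalIdeal A) A] (q : A →+* B) (hq : Surjective q) :
    IsAdicComplete (maximalIdeal B) B := by
  have hm := IsLocalRing.map_maximalIdeal_of_surjective q hq
  have : IsHausdorff (maximalIdeal B) B := .of_isLocalRing _ _ (maximalIdeal.isMaximal B).ne_top
  refine isAdicComplete_of_exists_limit _ (fun b hb ↦ eq_zero_of_forall_mem_pow _ hb)
    fun f hf ↦ ?_
  have hlift : ∀ n, ∀ b ∈ maximalIdeal B ^ n, ∃ a ∈ maximalIdeal A ^ n, q a = b := by
    intro n b hb
    rw [← hm, ← Ideal.map_pow] at hb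
    exact (Ideal.mem_map_iff_of_surjective q hq).1 hb
  choose d hd hqd using fun n ↦ hlift n _ (hf n)
  obtain ⟨a0, ha0⟩ := hq (f 0)
  let F : ℕ → A := fun n ↦ a0 + ∑ i ∈ Finset.range n, d i
  have hF : ∀ n, q (F n) = f n := fun n ↦ by
    simp only [F, map_add, map_sum, ha0, hqd, Finset.sum_range_sub]
    ring
  obtain ⟨a, ha⟩ := exists_adic_limit (maximalIdeal A) F fun n ↦ by
    simpa [F, Finset.sum_range_succ] using hd n
  refine ⟨q a, fun n ↦ ?_⟩
  rw [← hF, ← map_sub, ← hm, ← Ideal.map_pow]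
  exact Ideal.mem_map_of_mem q (ha n)

lemma surjective_of_map_maximalIdeal [IsLocalRing A] [IsLocalRing B]
    [IsAdicComplete (maximalIdeal A) A] [IsHausdorff (maximalIdeal B) B] (e : A →+* B)
    (hm : (maximalIdeal A).map e = maximalIdeal B) (hr : ∀ b, ∃ a, e a - b ∈ maximalIdeal B) :
    Surjective e := by
  have : IsHausdorff ((maximalIdeal A).map e) B := hm ▸ inferInstance
  refine surjective_of_mk_map_comp_surjective (I := maximalIdeal A) e fun b ↦ ?_
  obtain ⟨b, rfl⟩ := Ideal.Quotient.mk_surjective b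
  obtain ⟨a, ha⟩ := hr b
  exact ⟨a, Ideal.Quotient.eq.2 (hm ▸ ha)⟩

end Surjectivity

section Presentation

open Function

variable {p : ℕ} {C A B : Type u} [CommRing C] [CommRing A] [IsLocalRing A]
  [IsAdicComplete (maximalIdeal A) A] [CharP (ResidueField A) p] [CommRing B]

lemma natCast_mem_maximalIdeal {A : Type*} [CommRing A] [IsLocalRing A]
    [CharP (ResidueField A) p] : (p : A) ∈ maximalIdeal A := by
  rw [← residue_eq_zero_iff, map_natCast, CharP.cast_eq_zero]

lemma IsCohenRing.exists_lift_residue {π : C →+* ResidueField A} (hC : IsCohenRing p π) :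
    ∃ ψ : C →+* A, (residue A).comp ψ = π :=
  hC.exists_lift_of_isAdicComplete (maximalIdeal A) (maximalIdeal A) natCast_mem_maximalIdeal
    le_rfl (fun x hx ↦ by simpa using hx 1) π

lemma IsFormalPower.exists_surjective [IsLocalRing B] [IsAdicComplete (maximalIdeal B) B]
    {π : C →+* ResidueField A} (hC : IsCohenRing p π) {i : C →+* B} {xs : List B}
    (hB : IsFormalPower i xs) (hm : Ideal.ofList (xs ++ cohenParameters p B) = maximalIdeal B)
    {as : List A} (hl : as.length = xs.length) (has : Ideal.ofList as = maximalIdeal A) :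
    ∃ e : B →+* A, Surjective e ∧ xs.map e = as := by
  obtain ⟨ψ, hψ⟩ := hC.exists_lift_residue
  obtain ⟨e, he, hes⟩ := hB.exists_lift A (maximalIdeal A) ψ as hl
    fun a ha ↦ has ▸ Ideal.subset_span ha
  refine ⟨e, surjective_of_map_maximalIdeal e ?_ fun a ↦ ?_, hes⟩
  · rw [← hm, Ideal.map_ofList, List.map_append, hes, map_cohenParameters, Ideal.ofList_append, has,
      ofList_cohenParameters, sup_eq_left, Ideal.span_singleton_le_iff_mem]
    exact natCast_mem_maximalIdeal
  · obtain ⟨c, hc⟩ := hC.surj (residue A a)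
    refine ⟨i c, ?_⟩
    rw [← residue_eq_zero_iff, map_sub, sub_eq_zero, ← hc, ← hψ, ← he]
    rfl

end Presentation

/- ## Cohen factorizations -/

section CohenFactorization

open Function TensorProduct RingTheory.Sequence

lemma isRegularMod_append_iff {B : Type*} [CommRing B] (xs ys : List B) (J : Ideal B) :
    IsRegularMod (xs ++ ys) J ↔ IsRegularMod xs J ∧ IsRegularMod ys (J ⊔ Ideal.ofList xs) := by
  induction xs generalizing J with
  | nil => simp [IsRegularMod]
  | cons x xs ih =>
    rw [List.cons_append, IsRegularMod, IsRegularMod, ih, Ideal.ofList_cons, sup_assoc, and_assoc]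

/-- The pushout of a flat homomorphism along a surjective one. -/
lemma exists_flat_pushout {B A D T : Type u} [CommRing B] [CommRing A] [CommRing D] [CommRing T]
    (e : B →+* A) (he : Surjective e) (θ : B →+* D) (hθ : θ.Flat) (g : A →+* T) (d : D →+* T)
    (h : d.comp θ = g.comp e) :
    ∃ (P : Type u) (_ : CommRing P) (g' : A →+* P) (q : D →+* P) (r : P →+* T), g'.Flat ∧
      Surjective q ∧ g'.comp e = q.comp θ ∧ r.comp g' = g ∧ r.comp q = d ∧
      RingHom.ker q ≤ (RingHom.ker e).map θ := by
  algebraize [e, θ, g.comp e]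
  let I : Ideal D := (RingHom.ker e).map θ
  let gA : A →ₐ[B] T := ⟨g, fun _ ↦ rfl⟩
  let dA : D →ₐ[B] T := ⟨d, fun b ↦ congr($h b)⟩
  let r : A ⊗[B] D →ₐ[B] T := Algebra.TensorProduct.productMap gA dA
  let s : A →ₐ[B] D ⧸ I := AlgHom.liftOfSurjective (Algebra.ofId B A) he (Algebra.ofId B (D ⧸ I))
    fun b hb ↦ Ideal.Quotient.eq_zero_iff_mem.2 (Ideal.mem_map_of_mem θ hb)
  let t : A ⊗[B] D →ₐ[B] D ⧸ I := Algebra.TensorProduct.productMap s (Ideal.Quotient.mkₐ B I)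
  refine ⟨A ⊗[B] D, inferInstance, algebraMap A (A ⊗[B] D),
    (Algebra.TensorProduct.includeRight : D →ₐ[B] A ⊗[B] D).toRingHom, r.toRingHom, ?_,
    Algebra.TensorProduct.includeRight_surjective D he, ?_, ?_, ?_, ?_⟩
  · rw [RingHom.flat_algebraMap_iff]
    infer_instance
  · refine RingHom.ext fun b ↦ ?_
    change algebraMap A (A ⊗[B] D) (algebraMap B A b) =
      (Algebra.TensorProduct.includeRight : D →ₐ[B] A ⊗[B] D) (algebraMap B D b)
    rw [AlgHom.commutes, ← IsScalarTower.algebraMap_apply]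
  · exact RingHom.ext fun a ↦ Algebra.TensorProduct.productMap_left_apply gA dA a
  · exact RingHom.ext fun x ↦ Algebra.TensorProduct.productMap_right_apply gA dA x
  · intro x hx
    have h1 : t ((Algebra.TensorProduct.includeRight : D →ₐ[B] A ⊗[B] D) x) =
      Ideal.Quotient.mk I x := Algebra.TensorProduct.productMap_right_apply s _ x
    have h2 : (Algebra.TensorProduct.includeRight : D →ₐ[B] A ⊗[B] D) x = 0 := hx
    rw [h2, map_zero, eq_comm, Ideal.Quotient.eq_zero_iff_mem] at h1
    exact h1

lemma Ideal.FG.exists_ofList_eq {A : Type*} [CommRing A] {I : Ideal A} (h : I.FG) :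
    ∃ as : List A, Ideal.ofList as = I := by
  obtain ⟨s, hs⟩ := h
  refine ⟨s.toList, ?_⟩
  rw [← hs, Ideal.ofList]
  congr 1
  ext
  simp

/-- Homomorphisms from a Cohen ring lift along surjections of complete local rings. -/
lemma IsCohenRing.exists_lift_of_surjective {p : ℕ} {k C : Type u} [Field k] [CharP k p]
    [CommRing C] {π : C →+* k} (hC : IsCohenRing p π) {B T : Type u} [CommRing B] [CommRing T]
    [IsLocalRing B] [IsLocalRing T] [IsAdicComplete (maximalIdeal B) B]
    [IsHausdorff (maximalIdeal T) T] (hp : (p : B) ∈ maximalIdeal B) (e : B →+* T)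
    (he : Surjective e) (φ : C →+* T) : ∃ Φ : C →+* B, e.comp Φ = φ := by
  let E := RingHom.quotientKerEquivOfSurjective he
  have hm := IsLocalRing.map_maximalIdeal_of_surjective e he
  obtain ⟨Φ, hΦ⟩ := hC.exists_lift_of_isAdicComplete (maximalIdeal B) (RingHom.ker e) hp
    (IsLocalRing.le_maximalIdeal (RingHom.ker_ne_top e)) (fun x hx ↦ by
      refine eq_zero_of_forall_mem_pow (maximalIdeal T) fun n ↦ ?_
      have := Ideal.mem_map_of_mem e (hx n)
      rwa [Ideal.map_sup, (Ideal.map_eq_bot_iff_le_ker e).2 le_rfl, bot_sup_eq, Ideal.map_pow,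
        hm] at this)
    (E.symm.toRingHom.comp φ)
  refine ⟨Φ, RingHom.ext fun c ↦ ?_⟩
  have h1 : Ideal.Quotient.mk (RingHom.ker e) (Φ c) = E.symm (φ c) := RingHom.congr_fun hΦ c
  have h2 := congrArg E h1
  rw [RingEquiv.apply_symm_apply] at h2
  exact h2

theorem exists_flat_regular_factorization {A T : Type u} [CommRing A] [CommRing T] [IsLocalRing A]
    [IsLocalRing T] [IsAdicComplete (maximalIdeal A) A] [IsAdicComplete (maximalIdeal T) T]
    (hA : (maximalIdeal A).FG) (hT : (maximalIdeal T).FG) (g : A →+* T) [IsLocalHom g] :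
    ∃ (P : Type u) (_ : CommRing P) (_ : IsNoetherianRing P) (_ : IsLocalRing P)
      (_ : IsAdicComplete (maximalIdeal P) P) (g' : A →+* P) (h : P →+* T) (ys : List P),
      IsLocalHom g' ∧ g'.Flat ∧ Surjective h ∧ h.comp g' = g ∧
      IsRegularMod ys ((maximalIdeal A).map g') ∧
      (maximalIdeal A).map g' ⊔ Ideal.ofList ys = maximalIdeal P := by
  obtain ⟨as, has⟩ := hA.exists_ofList_eq
  obtain ⟨ts, hts⟩ := hT.exists_ofList_eq
  let p := ringChar (ResidueField T)
  have hpT : CharP (ResidueField T) p := ringChar.charP _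
  have hpA : CharP (ResidueField A) p :=
    RingHom.charP (ResidueField.map g) (RingHom.injective _) p
  obtain ⟨C₁, _, π₁, hC₁⟩ := exists_isCohenRing p (ResidueField A)
  obtain ⟨C₂, _, π₂, hC₂⟩ := exists_isCohenRing p (ResidueField T)
  have hC : ∀ {k C : Type u} [Field k] [CharP k p] [CommRing C] {π : C →+* k}
      (_ : IsCohenRing p π) (n : ℕ),
      ∃ (B : Type u) (_ : CommRing B) (_ : IsNoetherianRing B) (_ : IsLocalRing B)
        (_ : IsAdicComplete (maximalIdeal B) B) (i : C →+* B) (xs : List B), xs.length = n ∧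
        IsRegularMod (xs ++ cohenParameters p B) ⊥ ∧
        Ideal.ofList (xs ++ cohenParameters p B) = maximalIdeal B ∧ IsFormalPower i xs := by
    intro k C _ _ _ π h n
    have := h.isLocalRing
    have := h.isNoetherianRing
    have hm := IsLocalRing.eq_maximalIdeal h.isMaximal
    have : IsAdicComplete (maximalIdeal C) C := hm ▸ h.complete
    obtain ⟨B, b1, b2, b3, b4, i, xs, hl, h1, h2, h3⟩ :=
      exists_isFormalPower h.isRegularMod ((ofList_cohenParameters C).trans hm) n
    rw [map_cohenParameters] at h1 h2
    exact ⟨B, b1, b2, b3, b4, i, xs, hl, h1, h2, h3⟩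
  obtain ⟨B₁, _, _, _, _, i₁, xs, hl₁, hreg₁, hm₁, hB₁⟩ := hC hC₁ as.length
  obtain ⟨B₂, _, _, _, _, i₂, zs, hl₂, hreg₂, hm₂, hB₂⟩ := hC hC₂ (as.length + ts.length)
  obtain ⟨e₁, he₁, hes₁⟩ := hB₁.exists_surjective hC₁ hm₁ hl₁.symm has
  obtain ⟨e₂, he₂, hes₂⟩ := hB₂.exists_surjective (as := as.map g ++ ts) hC₂ hm₂
    (by simp [hl₂]) (by
      rw [Ideal.ofList_append, hts, ← Ideal.map_ofList, has, sup_eq_right]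
      exact ((local_hom_TFAE g).out 0 2).1 ‹_›)
  obtain ⟨xs', ys, rfl, hl₃⟩ : ∃ xs' ys, zs = xs' ++ ys ∧ xs'.length = as.length :=
    ⟨_, _, (List.take_append_drop as.length zs).symm, by simp [hl₂]⟩
  have hes₃ : xs'.map e₂ = as.map g := by
    rw [List.map_append] at hes₂
    exact (List.append_inj hes₂ (by simp [hl₃])).1
  set L := cohenParameters p B₂ with hL
  have hmem : ∀ x ∈ xs' ++ ys ++ L, x ∈ maximalIdeal B₂ := fun x hx ↦
    hm₂ ▸ Ideal.subset_span hx
  have hp : (p : B₂) ∈ maximalIdeal B₂ := by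
    rw [← hm₂, Ideal.ofList_append, ofList_cohenParameters]
    exact Ideal.mem_sup_right (Ideal.mem_span_singleton_self _)
  obtain ⟨Φ, hΦ⟩ := hC₁.exists_lift_of_surjective hp e₂ he₂ ((g.comp e₁).comp i₁)
  obtain ⟨θ, hθ, hθxs⟩ := hB₁.exists_lift B₂ (maximalIdeal B₂) Φ xs' (hl₃.trans hl₁.symm)
    fun a ha ↦ hmem a (by simp [ha])
  have hge : (xs.map (g.comp e₁)) = as.map g := by
    rw [← hes₁, List.map_map]
    rfl
  have hcomp : e₂.comp θ = g.comp e₁ := by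
    refine hB₁.hom_ext T (maximalIdeal T) _ _ (by rw [RingHom.comp_assoc, hθ, hΦ]) ?_ ?_
    · rw [hge, ← hes₃, ← hθxs, List.map_map]
      rfl
    · intro x hx
      have h1 : θ x ∈ maximalIdeal B₂ :=
        hmem _ (by simp [← hθxs, List.mem_map_of_mem (f := θ) hx])
      have := Ideal.mem_map_of_mem e₂ h1
      rwa [IsLocalRing.map_maximalIdeal_of_surjective e₂ he₂] at this
  have hperm : (xs' ++ ys ++ L).Perm (xs' ++ L ++ ys) := by
    rw [List.append_assoc, List.append_assoc]
    exact List.perm_append_comm.append_left _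
  have hreg₃ : IsRegularMod (xs' ++ L ++ ys) ⊥ := by
    rw [← isWeaklyRegular_iff_isRegularMod_bot] at hreg₂ ⊢
    exact IsLocalRing.isWeaklyRegular_of_perm_of_subset_maximalIdeal hreg₂ hperm hmem
  have hm₃ : Ideal.ofList (xs' ++ L) ⊔ Ideal.ofList ys = maximalIdeal B₂ := by
    rw [← hm₂, ← Ideal.ofList_append, Ideal.ofList, Ideal.ofList]
    congr 1
    ext x
    exact hperm.symm.mem_iff
  obtain ⟨hregL, hregys⟩ := (isRegularMod_append_iff _ _ _).1 hreg₃
  rw [bot_sup_eq] at hregys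
  have hθm : (maximalIdeal B₁).map θ = Ideal.ofList (xs' ++ L) := by
    rw [← hm₁, Ideal.map_ofList, List.map_append, map_cohenParameters, hθxs]
  have hθloc : IsLocalHom θ := ((local_hom_TFAE θ).out 0 2).2 (by
    rw [hθm, ← hm₃]
    exact le_sup_left)
  have hθflat : θ.Flat := by
    algebraize [θ]
    have : IsLocalHom (algebraMap B₁ B₂) := hθloc
    refine flat_of_isWeaklyRegular (xs ++ cohenParameters p B₁) hm₁
      ((isWeaklyRegular_iff_isRegularMod_bot _).2 hreg₁) ?_
    rw [← isWeaklyRegular_map_algebraMap_iff B₂, List.map_append, map_cohenParameters]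
    exact (isWeaklyRegular_iff_isRegularMod_bot _).2 (hθxs.symm ▸ hregL)
  obtain ⟨P, _, g', q, h, hg', hq, hcomm, hhg, hhq, hker⟩ :=
    exists_flat_pushout e₁ he₁ θ hθflat g e₂ hcomp
  have hh : Surjective h := .of_comp (g := q) (by
    rw [← RingHom.coe_comp, hhq]
    exact he₂)
  have : Nontrivial P := hh.nontrivial
  have : IsNoetherianRing P := isNoetherianRing_of_surjective _ _ q hq
  have : IsLocalRing P := .of_surjective' q hq
  have hmg : (maximalIdeal A).map g' = (Ideal.ofList (xs' ++ L)).map q := by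
    rw [← IsLocalRing.map_maximalIdeal_of_surjective e₁ he₁, Ideal.map_map, hcomm,
      ← Ideal.map_map, hθm]
  have hcm : ((maximalIdeal A).map g').comap q = Ideal.ofList (xs' ++ L) := by
    rw [hmg, Ideal.comap_map_of_surjective q hq, sup_eq_left, ← hθm]
    exact hker.trans (Ideal.map_mono (IsLocalRing.le_maximalIdeal (RingHom.ker_ne_top e₁)))
  have hsup : (maximalIdeal A).map g' ⊔ Ideal.ofList (ys.map q) = maximalIdeal P := by
    rw [hmg, ← Ideal.map_ofList, ← Ideal.map_sup, hm₃,
      IsLocalRing.map_maximalIdeal_of_surjective q hq]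
  refine ⟨P, ‹_›, ‹_›, ‹_›, isAdicComplete_of_surjective q hq, g', h, ys.map q,
    ((local_hom_TFAE g').out 0 2).2 (hsup ▸ le_sup_left), hg', hh, hhg, ?_, hsup⟩
  rw [← isRegularMod_comap_iff q hq, hcm]
  exact hregys

end CohenFactorization

/- ## Flat dimension and complete intersection maps -/

section ExceptionalCompleteIntersection

open Function RingTheory.Sequence

/-- A local homomorphism `R → T` into a complete local ring extends to the completion of `R`. -/
lemma exists_adicCompletion_lift {R T : Type*} [CommRing R] [CommRing T] [IsLocalRing R]
    [IsLocalRing T] (φ : R →+* T) [IsLocalHom φ]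
    [IsAdicComplete (maximalIdeal T) T] :
    ∃ Φ : AdicCompletion (maximalIdeal R) R →+* T, Φ.comp (algebraMap R _) = φ := by
  have hφ : (maximalIdeal R).map φ ≤ maximalIdeal T := ((local_hom_TFAE φ).out 0 2).1 ‹_›
  have hpow (n : ℕ) : maximalIdeal R ^ n ≤ (maximalIdeal T ^ n).comap φ := by
    rw [← Ideal.map_le_iff_le_comap, Ideal.map_pow]
    exact Ideal.pow_right_mono hφ n
  let F (n : ℕ) : AdicCompletion (maximalIdeal R) R →+* T ⧸ maximalIdeal T ^ n :=
    (Ideal.quotientMap _ φ (hpow n)).comp (AdicCompletion.evalₐ (maximalIdeal R) n).toRingHom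
  have hF {m n : ℕ} (hle : m ≤ n) : (Ideal.Quotient.factorPow _ hle).comp (F n) = F m := by
    refine RingHom.ext fun x ↦ ?_
    obtain ⟨x, rfl⟩ := AdicCompletion.mk_surjective _ _ x
    change Ideal.Quotient.factorPow _ hle (Ideal.quotientMap _ φ (hpow n)
      (AdicCompletion.evalₐ _ n (AdicCompletion.mk _ _ x))) =
      Ideal.quotientMap _ φ (hpow m) (AdicCompletion.evalₐ _ m (AdicCompletion.mk _ _ x))
    rw [AdicCompletion.evalₐ_mk, AdicCompletion.evalₐ_mk, Ideal.quotientMap_mk,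
      Ideal.quotientMap_mk]
    change Ideal.Quotient.mk _ (φ (x.val n)) = Ideal.Quotient.mk _ (φ (x.val m))
    rw [Ideal.Quotient.eq, ← map_sub, ← Ideal.mem_comap]
    refine hpow m ?_
    have := (x.property hle).symm
    rwa [SModEq.sub_mem, smul_eq_mul, Ideal.mul_top] at this
  refine ⟨IsAdicComplete.liftRingHom (maximalIdeal T) F hF, RingHom.ext fun r ↦ ?_⟩
  rw [← sub_eq_zero]
  refine eq_zero_of_forall_mem_pow (maximalIdeal T) fun n ↦ ?_
  rw [← Ideal.Quotient.eq, RingHom.comp_apply, IsAdicComplete.mk_liftRingHom]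
  change Ideal.quotientMap _ φ (hpow n) (AdicCompletion.evalₐ _ n (algebraMap R _ r)) = _
  rw [AlgHom.commutes]
  exact Ideal.quotientMap_mk

lemma exists_fdLE_of_flatDim_add_eq {R M : Type u} [CommRing R] [AddCommGroup M] [Module R M]
    {a b : ℕ} (h : flatDim R M + a = (b : ℕ∞)) : ∃ n, fdLE R n M ∧ n + a = b := by
  have hne : ((↑) '' { n : ℕ | fdLE R n M } : Set ℕ∞).Nonempty := by
    by_contra hne
    rw [Set.not_nonempty_iff_eq_empty] at hne
    rw [flatDim, hne, sInf_empty, top_add] at h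
    exact ENat.natCast_ne_top b h.symm
  obtain ⟨n, hn, hn'⟩ := csInf_mem hne
  refine ⟨n, hn, ?_⟩
  rw [flatDim, ← hn'] at h
  exact_mod_cast h

lemma exists_ringKrullDim_eq_natCast (A : Type*) [CommRing A] [FiniteRingKrullDim A] :
    ∃ a : ℕ, ringKrullDim A = a := by
  obtain ⟨d, hd⟩ := WithBot.ne_bot_iff_exists.1 (ringKrullDim_ne_bot (R := A))
  have hd' : d ≠ ⊤ := by
    rintro rfl
    exact ringKrullDim_ne_top (R := A) hd.symm
  obtain ⟨a, rfl⟩ := ENat.ne_top_iff_exists.1 hd'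
  exact ⟨a, hd.symm⟩

lemma isRegularLocal_quotient {B : Type u} [CommRing B] [IsNoetherianRing B] [IsLocalRing B]
    {J : Ideal B} {ys : List B} (hys : IsRegularMod ys J)
    (hm : J ⊔ Ideal.ofList ys = maximalIdeal B) : IsRegularLocal (B ⧸ J) := by
  have hJ : J ≤ maximalIdeal B := hm ▸ le_sup_left
  have : Nontrivial (B ⧸ J) := Ideal.Quotient.nontrivial_iff.2 fun h ↦
    (maximalIdeal.isMaximal B).ne_top (top_le_iff.1 (h ▸ hJ))
  have : IsLocalRing (B ⧸ J) := .of_surjective' _ Ideal.Quotient.mk_surjective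
  have hspan : Ideal.ofList (ys.map (Ideal.Quotient.mk J)) = maximalIdeal (B ⧸ J) :=
    (ofList_map_mk hm).trans maximalIdeal_map_mk
  refine ⟨inferInstance, inferInstance, ys.map (Ideal.Quotient.mk J), ⟨?_, ?_⟩, hspan⟩
  · rw [isWeaklyRegular_iff_isRegularMod_bot,
      ← isRegularMod_comap_iff _ Ideal.Quotient.mk_surjective, comap_mk_bot]
    exact hys
  · rw [hspan, smul_eq_mul, Ideal.mul_top]
    exact (maximalIdeal.isMaximal _).ne_top.symm

lemma fg_maximalIdeal_adicCompletion (S : Type*) [CommRing S] [IsLocalRing S]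
    [IsNoetherianRing S] : (maximalIdeal (AdicCompletion (maximalIdeal S) S)).FG := by
  rw [AdicCompletion.maximalIdeal_eq_map]
  exact (maximalIdeal S).fg_of_isNoetherianRing.map _

/-- Existence of Cohen factorizations. -/
theorem exists_isCohenFactorization {R S : Type u} [CommRing R] [CommRing S] [IsLocalRing R]
    [IsLocalRing S] [IsNoetherianRing R] [IsNoetherianRing S] (f : R →+* S) [IsLocalHom f] :
    ∃ (P : Type u) (_ : CommRing P) (_ : IsNoetherianRing P) (_ : IsLocalRing P) (g : R →+* P)
      (h : P →+* AdicCompletion (maximalIdeal S) S) (ys : List P), IsCohenFactorization f g h ∧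
      IsRegularMod ys ((maximalIdeal R).map g) ∧
      (maximalIdeal R).map g ⊔ Ideal.ofList ys = maximalIdeal P := by
  have hloc : IsLocalHom ((completionHom S).comp f) := by
    have : IsLocalHom (completionHom S) :=
      inferInstanceAs (IsLocalHom (algebraMap S (AdicCompletion (maximalIdeal S) S)))
    infer_instance
  obtain ⟨Φ, hΦ⟩ := exists_adicCompletion_lift ((completionHom S).comp f)
  have hmR := AdicCompletion.maximalIdeal_eq_map (R := R)
  have hΦloc : IsLocalHom Φ := ((local_hom_TFAE Φ).out 0 2).2 (by
    rw [hmR, Ideal.map_map, hΦ]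
    exact ((local_hom_TFAE ((completionHom S).comp f)).out 0 2).1 hloc)
  obtain ⟨P, _, _, _, hP, g, h, ys, hg, hgflat, hh, hhg, hys, hm⟩ :=
    exists_flat_regular_factorization (fg_maximalIdeal_adicCompletion R)
      (fg_maximalIdeal_adicCompletion S) Φ
  have hmg : (maximalIdeal R).map (g.comp (algebraMap R (AdicCompletion (maximalIdeal R) R))) =
      (maximalIdeal (AdicCompletion (maximalIdeal R) R)).map g := by
    rw [hmR, Ideal.map_map]
  refine ⟨P, ‹_›, ‹_›, ‹_›, g.comp (algebraMap R _), h, ys, ⟨‹_›, ‹_›, ?_, ?_, ?_, ?_, ?_, hh⟩,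
    hmg.symm ▸ hys, hmg.symm ▸ hm⟩
  · rwa [jacobson_eq_maximalIdeal _ bot_ne_top]
  · rw [← RingHom.comp_assoc, hhg, hΦ]
  · infer_instance
  · refine RingHom.Flat.comp ?_ hgflat
    rw [RingHom.flat_algebraMap_iff]
    exact AdicCompletion.flat_of_isNoetherian _
  · rw [hmg]
    exact isRegularLocal_quotient hys hm

variable {R S T P : Type u} [CommRing R] [CommRing S] [CommRing T] [CommRing P] [IsLocalRing R]
  [IsLocalRing S] [IsLocalRing T] [IsLocalRing P] [IsNoetherianRing R] [IsNoetherianRing S]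
  [IsNoetherianRing T] [IsNoetherianRing P]

lemma embDim_le_of_map_eq (φ : S →+* T) (h : (maximalIdeal S).map φ = maximalIdeal T) :
    embDim T ≤ embDim S := by
  obtain ⟨s, hs, hspan⟩ := exists_span_eq_maximalIdeal S
  classical
  refine embDim_le_iff.2 ⟨s.image φ, Finset.card_image_le.trans hs.le, ?_⟩
  rw [← h, ← hspan, Ideal.map_span, Finset.coe_image]

lemma ringKrullDim_eq_of_map_maximalIdeal_eq [Algebra S T] [IsLocalHom (algebraMap S T)]
    [Module.Flat S T] (h : (maximalIdeal S).map (algebraMap S T) = maximalIdeal T) :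
    ringKrullDim T = ringKrullDim S := by
  simpa using ringKrullDim_eq_add_length (A := S) (B := T) (ys := []) trivial (by simpa using h)

/-- A factorization `R → P → T` of `R → S → T` through a flat map with regular closed fibre,
followed by a surjection, has kernel generated by a regular sequence. -/
theorem exists_isRegular_ker [Algebra R S] [Algebra R T] [Algebra S T] [IsScalarTower R S T]
    [IsLocalHom (algebraMap S T)] [Module.Flat S T]
    (hST : (maximalIdeal S).map (algebraMap S T) = maximalIdeal T) [Algebra R P]
    [IsLocalHom (algebraMap R P)] [Module.Flat R P] [Algebra P T] [IsScalarTower R P T]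
    (hPT : Surjective (algebraMap P T)) {ys : List P}
    (hys : IsRegularMod ys ((maximalIdeal R).map (algebraMap R P)))
    (hm : (maximalIdeal R).map (algebraMap R P) ⊔ Ideal.ofList ys = maximalIdeal P) {n : ℕ}
    (hfd : fdLE R n S) (hn : n + embDim S = embDim R) :
    (∃ rs : List P, IsRegular P rs ∧ RingHom.ker (algebraMap P T) = Ideal.ofList rs) ∧
      (embDim R : WithBot ℕ∞) + ringKrullDim S = embDim S + ringKrullDim R := by
  have htor : ∀ j ≥ n, TorSuccZero R j (R ⧸ maximalIdeal R) T := fun j hj ↦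
    (TorSuccZero.of_le hj (fun N _ _ ↦ torSuccZero_of_fdLE n hfd N) _).tower (S := S)
  let E : (P ⧸ RingHom.ker (algebraMap P T)) ≃ₐ[P] T :=
    Ideal.quotientKerAlgEquivOfSurjective (f := Algebra.ofId P T) hPT
  have : IsLocalRing (P ⧸ RingHom.ker (algebraMap P T)) := E.symm.toRingEquiv.isLocalRing
  have h1 := (TorSuccZero.of_regular_fibre htor ((isWeaklyRegular_quotient_iff _ _).2 hys)
    hm).of_linearEquiv E.symm.toLinearEquiv
  have h2 := embDim_add_length_le ys.length P ys rfl hys hm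
  have h3 := embDim_le_of_map_eq _ hST
  have h4 := embDim_le_of_surjective E.symm.toRingEquiv.toRingHom E.symm.surjective
  obtain ⟨rs, hrs, hlen, hker⟩ := exists_isRegular_of_torSuccZero _ _ h1 (by omega)
  refine ⟨⟨rs, hrs, hker⟩, ?_⟩
  have d1 := ringKrullDim_eq_add_length hys hm
  have d2 := ringKrullDim_add_length_eq_ringKrullDim_of_isRegular rs hrs
  rw [← hker, ringKrullDim_eq_of_ringEquiv E.toRingEquiv,
    ringKrullDim_eq_of_map_maximalIdeal_eq hST, d1, hlen] at d2
  obtain ⟨a, ha⟩ := exists_ringKrullDim_eq_natCast R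
  obtain ⟨b, hb⟩ := exists_ringKrullDim_eq_natCast S
  rw [ha, hb] at d2 ⊢
  have d3 : b + (n + ys.length) = a + ys.length := by exact_mod_cast d2
  have d4 : embDim R + b = embDim S + a := by omega
  exact_mod_cast d4

theorem exists_isRegular_ker_of_flatDimAlong {f : R →+* S} {c : S →+* T} [IsLocalHom c]
    (hc : c.Flat) (hST : (maximalIdeal S).map c = maximalIdeal T) {g : R →+* P} [IsLocalHom g]
    (hg : g.Flat) {h : P →+* T} (hh : Surjective h) (hcomp : h.comp g = c.comp f) {ys : List P}
    (hys : IsRegularMod ys ((maximalIdeal R).map g))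
    (hm : (maximalIdeal R).map g ⊔ Ideal.ofList ys = maximalIdeal P)
    (hfd : flatDimAlong f + embDim S = (embDim R : ℕ∞)) :
    (∃ rs : List P, IsRegular P rs ∧ RingHom.ker h = Ideal.ofList rs) ∧
      (embDim R : WithBot ℕ∞) + ringKrullDim S = embDim S + ringKrullDim R := by
  algebraize [f, c, g, h, c.comp f]
  have : IsScalarTower R P T := .of_algebraMap_eq' hcomp.symm
  have : IsLocalHom (algebraMap R P) := ‹IsLocalHom g›
  have : IsLocalHom (algebraMap S T) := ‹IsLocalHom c›
  obtain ⟨n, hn, hdim⟩ := exists_fdLE_of_flatDim_add_eq (R := R) (M := S) hfd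
  exact exists_isRegular_ker hST hh hys hm hn hdim

end ExceptionalCompleteIntersection

/-- If `f : R → S` is a local homomorphism of noetherian local rings with
`fd_R S = edim R - edim S`, then `f` is an exceptional complete intersection map. -/
theorem eci_of_flatDim_eq {R S : Type u} [CommRing R] [CommRing S]
    [IsLocalRing R] [IsLocalRing S] [IsNoetherianRing R] [IsNoetherianRing S]
    (f : R →+* S) (hloc : IsLocalHom f)
    (hfd : flatDimAlong f + embDim S = (embDim R : ℕ∞)) :
    IsExceptionalCIMap f := by
  obtain ⟨P, _, _, _, g, h, ys, hcf, hys, hm⟩ := exists_isCohenFactorization f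
  obtain ⟨-, -, -, hcomp, hgloc, hgflat, -, hh⟩ := id hcf
  have : IsNoetherianRing (AdicCompletion (maximalIdeal S) S) :=
    isNoetherianRing_of_surjective _ _ h hh
  have hloc' : IsLocalHom (completionHom S) :=
    inferInstanceAs (IsLocalHom (algebraMap S (AdicCompletion (maximalIdeal S) S)))
  have hflat : (completionHom S).Flat :=
    RingHom.flat_algebraMap_iff.2 (AdicCompletion.flat_of_isNoetherian _)
  obtain ⟨⟨rs, hrs, hker⟩, hnum⟩ := exists_isRegular_ker_of_flatDimAlong hflat
    AdicCompletion.maximalIdeal_eq_map.symm hgflat hh hcomp hys hm hfd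
  exact ⟨⟨P, _, g, h, hcf, rs, hrs, hker⟩, hnum⟩
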